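/- Let i ≥ 2 be such that #f_{i−1} = #f_i = #f_{i+1} = 1, write f_i = {d}, and let J be an invariant-factor count function for d. Then for every x ∈ ℝ, lim_{n→∞} (1/n)·#{1 ≤ m ≤ n : J(m) ≤ μ_i·log log n + x·σ_i·(log log n)^{1/2}} = Φ(x). -/

import Mathlib

open MeasureTheory ProbabilityTheory Filter

noncomputable section

/-- A key encoding the lexicographic order on pairs `(φ(q), q)`; this is a valid
encoding on prime powers since every prime power satisfies `q ≤ 2 * φ(q)`. -/
def ppKey (q : ℕ) : ℕ := 2 * Nat.totient q ^ 2 + q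

/-- The `n`-th smallest key of a prime power (0-indexed). -/
def ppNthKey (n : ℕ) : ℕ := Nat.nth (fun k => ∃ q : ℕ, IsPrimePow q ∧ ppKey q = k) n

/-- The total φ-sequence `q̃_i` (1-indexed): the enumeration of all prime powers
ordered by nondecreasing totient, with ties broken by increasing size. -/
def qt (i : ℕ) : ℕ := sInf {q : ℕ | IsPrimePow q ∧ ppKey q = ppNthKey (i - 1)}

/-- `lcm(q̃_1, …, q̃_i)`. -/
def Lseq (i : ℕ) : ℕ := (Finset.Icc 1 i).lcm qt

/-- The universal factor order set `f_i`. -/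
def UFO (i : ℕ) : Set ℕ :=
  if Nat.totient (qt i) < Nat.totient (qt (i + 1)) then {Lseq i}
  else {Lseq i, Nat.lcm (Lseq (i - 1)) (qt (i + 1))}

/-- `φ(q̃_i)` as a real number. -/
def phiQ (i : ℕ) : ℝ := (Nat.totient (qt i) : ℝ)

/-- `μ_i = 1/φ(q̃_i) − 1/φ(q̃_{i+1})`. -/
def muSeq (i : ℕ) : ℝ := 1 / phiQ i - 1 / phiQ (i + 1)

/-- `σ_i = (1/φ(q̃_i) + 1/φ(q̃_{i+1}) − 2/(φ(q̃_i)·φ(q̃_{i+1})))^{1/2}`. -/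
def sigSeq (i : ℕ) : ℝ :=
  Real.sqrt (1 / phiQ i + 1 / phiQ (i + 1) - 2 / (phiQ i * phiQ (i + 1)))

/-- `σ_{i;a,b} = (φ(q̃_i)^{−a} + φ(q̃_{i+1})^{−b} − 2/(φ(q̃_i)·φ(q̃_{i+1})))^{1/2}`. -/
def sigAB (i a b : ℕ) : ℝ :=
  Real.sqrt (1 / phiQ i ^ a + 1 / phiQ (i + 1) ^ b - 2 / (phiQ i * phiQ (i + 1)))

/-- `ν_j = (φ(q̃_j)^{−1}·(1 − φ(q̃_j)^{−1}))^{1/2}`. -/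
def nuSeq (j : ℕ) : ℝ := Real.sqrt (1 / phiQ j * (1 - 1 / phiQ j))

/-- `J` is an invariant-factor count function for `d`: whenever `(ℤ/mℤ)ˣ` is isomorphic to
a direct product of cyclic groups `ℤ/λ_1 × ⋯ × ℤ/λ_K` with `1 < λ_1 ∣ λ_2 ∣ ⋯ ∣ λ_K`,
`J m` is the number of indices `j` with `λ_j = d`. -/
def IsInvCount (d : ℕ) (J : ℕ → ℕ) : Prop :=
  ∀ m : ℕ, 1 ≤ m → ∀ K : ℕ, ∀ lam : Fin K → ℕ,
    (∀ j, 1 < lam j) →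
    (∀ j k : Fin K, j ≤ k → lam j ∣ lam k) →
    Nonempty ((ZMod m)ˣ ≃* Multiplicative (∀ j : Fin K, ZMod (lam j))) →
    J m = (Finset.univ.filter fun j : Fin K => lam j = d).card

/-- The number of `m ∈ {1, …, n}` satisfying `P`. -/
def cnt (P : ℕ → Prop) (n : ℕ) : ℕ := {m : ℕ | 1 ≤ m ∧ m ≤ n ∧ P m}.ncard

/-- The average `(1/n)·∑_{m=1}^n J(m)`. -/
def avg (J : ℕ → ℕ) (n : ℕ) : ℝ := (∑ m ∈ Finset.Icc 1 n, (J m : ℝ)) / n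

/-- `log log n`. -/
def LL (n : ℕ) : ℝ := Real.log (Real.log n)

/-- The standard normal cumulative distribution function. -/
def Phi (x : ℝ) : ℝ := (Real.sqrt (2 * Real.pi))⁻¹ * ∫ t in Set.Iic x, Real.exp (-t ^ 2 / 2)

/-- Owen's T-function. -/
def OwenT (h a : ℝ) : ℝ :=
  (2 * Real.pi)⁻¹ * ∫ t in (0:ℝ)..a, Real.exp (-(1 + t ^ 2) * h ^ 2 / 2) / (1 + t ^ 2)

/-- The skew-normal cumulative distribution function with parameter `α`. -/
def PhiSkew (x α : ℝ) : ℝ := Phi x - 2 * OwenT x α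

/-- The standard Gaussian probability measure `γ^k` on `ℝ^k`. -/
def stdGaussian (k : ℕ) : Measure (Fin k → ℝ) :=
  Measure.pi fun _ => gaussianReal 0 1

/-- `ω(m;q,1)`: the number of distinct primes `p ∣ m` with `p ≡ 1 (mod q)`. -/
def omegaQ (m q : ℕ) : ℕ := (m.primeFactors.filter fun p => p % q = 1 % q).card

/-- The correction term `Ē(m;p^α)`. -/
def Ebar (m p α : ℕ) : ℕ :=
  if p ^ α = 2 ∧ 8 ∣ m then 2
  else if p ^ α = 2 ∧ 4 ∣ m ∧ ¬(8 ∣ m) then 1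
  else if p = 2 ∧ 2 ≤ α ∧ 2 ^ (α + 2) ∣ m then 1
  else if p ≠ 2 ∧ p ^ (α + 1) ∣ m then 1
  else 0

/-- `prm(m;q)` for a prime power `q = p^α`: the unique `k` such that `p^k` is the cardinality
of the subgroup `{x ∈ (ℤ/mℤ)ˣ : x^p = 1 and x = y^{p^{α−1}} for some y}` (obtained here as the
`p`-adic valuation of that cardinality; note `p = q.minFac` and `p^{α−1} = q / p`). -/
def prm (m q : ℕ) : ℕ :=
  (Nat.card {x : (ZMod m)ˣ // x ^ q.minFac = 1 ∧ ∃ y : (ZMod m)ˣ, y ^ (q / q.minFac) = x}).factorization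
    q.minFac

/-- `m` is `y`-typical: for all prime powers `q₁, q₂` with `φ(q₁) ≤ y` and `φ(q₁) < φ(q₂)`
one has `prm(m;q₁) > prm(m;q₂)`. -/
def yTypical (y : ℝ) (m : ℕ) : Prop :=
  ∀ q₁ q₂ : ℕ, IsPrimePow q₁ → IsPrimePow q₂ →
    (Nat.totient q₁ : ℝ) ≤ y → Nat.totient q₁ < Nat.totient q₂ →
    prm m q₂ < prm m q₁



theorem IsPrimePow.le_two_mul_totient {q : ℕ} (h : IsPrimePow q) : q ≤ 2 * Nat.totient q := by
  obtain ⟨p, k, hp, hk, rfl⟩ := (isPrimePow_nat_iff q).1 h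
  rw [Nat.totient_prime_pow hp hk]
  obtain ⟨k, rfl⟩ : ∃ l, k = l + 1 := ⟨k - 1, by omega⟩
  rw [pow_succ, Nat.add_sub_cancel]
  have : p ≤ 2 * (p - 1) := by have := hp.two_le; omega
  nlinarith [Nat.zero_le (p ^ k)]

theorem ppKey_lt_of_totient_lt {q r : ℕ} (hq : IsPrimePow q)
    (h : Nat.totient q < Nat.totient r) : ppKey q < ppKey r := by
  have := hq.le_two_mul_totient
  unfold ppKey
  nlinarith

theorem totient_le_of_ppKey_le {q r : ℕ} (hr : IsPrimePow r) (h : ppKey q ≤ ppKey r) :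
    Nat.totient q ≤ Nat.totient r := by
  by_contra! hlt
  exact absurd (ppKey_lt_of_totient_lt hr hlt) (by omega)

theorem ppKey_inj {q r : ℕ} (hq : IsPrimePow q) (hr : IsPrimePow r) (h : ppKey q = ppKey r) :
    q = r := by
  have h1 := totient_le_of_ppKey_le hr h.le
  have h2 := totient_le_of_ppKey_le hq h.ge
  have h3 : Nat.totient q = Nat.totient r := le_antisymm h1 h2
  unfold ppKey at h
  rw [h3] at h
  omega

theorem infinite_ppKey : {k | ∃ q : ℕ, IsPrimePow q ∧ ppKey q = k}.Infinite := by
  refine Set.infinite_of_forall_exists_gt fun n => ?_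
  obtain ⟨p, hp, hpp⟩ := Nat.exists_infinite_primes (n + 1)
  refine ⟨ppKey p, ⟨p, hpp.isPrimePow, rfl⟩, ?_⟩
  unfold ppKey
  nlinarith [Nat.zero_le (Nat.totient p ^ 2)]

theorem ppNthKey_strictMono : StrictMono ppNthKey := Nat.nth_strictMono infinite_ppKey

theorem qt_spec (i : ℕ) : IsPrimePow (qt i) ∧ ppKey (qt i) = ppNthKey (i - 1) :=
  Nat.sInf_mem (s := {q : ℕ | IsPrimePow q ∧ ppKey q = ppNthKey (i - 1)})
    (Nat.nth_mem_of_infinite infinite_ppKey (i - 1))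

theorem exists_qt_eq {q : ℕ} (hq : IsPrimePow q) : ∃ j, 1 ≤ j ∧ qt j = q := by
  classical
  obtain ⟨n, hn⟩ : ppKey q ∈ Set.range ppNthKey := by
    unfold ppNthKey
    rw [Nat.range_nth_of_infinite infinite_ppKey]
    exact ⟨q, hq, rfl⟩
  refine ⟨n + 1, by omega, ppKey_inj (qt_spec _).1 hq ?_⟩
  rw [(qt_spec _).2, Nat.add_sub_cancel, hn]

theorem ppKey_qt_lt {i j : ℕ} (hi : 1 ≤ i) (h : i < j) : ppKey (qt i) < ppKey (qt j) := by
  rw [(qt_spec i).2, (qt_spec j).2]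
  exact ppNthKey_strictMono (by omega)

theorem totient_lt_of_isPrimePow_dvd {q r : ℕ} (hq : IsPrimePow q) (hr : IsPrimePow r)
    (h : q ∣ r) (hne : q ≠ r) : Nat.totient q < Nat.totient r := by
  obtain ⟨p, k, hp, hk, rfl⟩ := (isPrimePow_nat_iff q).1 hq
  obtain ⟨p', l, hp', hl, rfl⟩ := (isPrimePow_nat_iff r).1 hr
  obtain rfl : p = p' := by
    have := (dvd_pow_self p hk.ne').trans h
    exact (Nat.prime_dvd_prime_iff_eq hp hp').1 (hp.dvd_of_dvd_pow this)
  have hkl : k ≤ l := (Nat.pow_dvd_pow_iff_le_right hp.one_lt).1 h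
  have hkl' : k < l := lt_of_le_of_ne hkl fun e => hne (by rw [e])
  rw [Nat.totient_prime_pow hp hk, Nat.totient_prime_pow hp hl]
  exact Nat.mul_lt_mul_of_pos_right (Nat.pow_lt_pow_right hp.one_lt (by omega))
    (by have := hp.two_le; omega)

theorem IsPrimePow.dvd_lcm_iff {q : ℕ} (hq : IsPrimePow q) {a b : ℕ} (ha : a ≠ 0) (hb : b ≠ 0) :
    q ∣ Nat.lcm a b ↔ q ∣ a ∨ q ∣ b := by
  obtain ⟨p, k, hp, hk, rfl⟩ := (isPrimePow_nat_iff q).1 hq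
  rw [hp.pow_dvd_iff_le_factorization ha, hp.pow_dvd_iff_le_factorization hb,
    hp.pow_dvd_iff_le_factorization (Nat.lcm_ne_zero ha hb), Nat.factorization_lcm ha hb]
  simp

theorem IsPrimePow.dvd_finset_lcm {q : ℕ} (hq : IsPrimePow q) {ι : Type*} (s : Finset ι)
    (f : ι → ℕ) (hf : ∀ i ∈ s, f i ≠ 0) : q ∣ s.lcm f ↔ ∃ i ∈ s, q ∣ f i := by
  classical
  induction s using Finset.induction_on with
  | empty =>
    simp only [Finset.lcm_empty, Nat.dvd_one, Finset.notMem_empty, false_and, exists_false,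
      iff_false]
    exact hq.ne_one
  | insert a s ha ih =>
    rw [Finset.lcm_insert]
    have h0 : s.lcm f ≠ 0 := by
      intro h
      obtain ⟨i, hi, h0⟩ := Finset.lcm_eq_zero_iff.1 h
      exact hf i (Finset.mem_insert_of_mem hi) h0
    have := hq.dvd_lcm_iff (hf a (Finset.mem_insert_self _ _)) h0
    rw [show lcm (f a) (s.lcm f) = Nat.lcm (f a) (s.lcm f) from rfl, this,
      ih fun i hi => hf i (Finset.mem_insert_of_mem hi)]
    simp

theorem Lseq_ne_zero (i : ℕ) : Lseq i ≠ 0 := by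
  intro h
  obtain ⟨j, -, h0⟩ := Finset.lcm_eq_zero_iff.1 h
  exact (qt_spec j).1.ne_zero h0

theorem dvd_Lseq_iff {q : ℕ} (hq : IsPrimePow q) (i : ℕ) :
    q ∣ Lseq i ↔ ∃ j, 1 ≤ j ∧ j ≤ i ∧ q ∣ qt j := by
  unfold Lseq
  rw [hq.dvd_finset_lcm _ _ fun j _ => (qt_spec j).1.ne_zero]
  simp [and_assoc]

theorem totient_qt_lt_of_ncard {i : ℕ} (hi : 1 ≤ i) (h : (UFO i).ncard = 1) :
    Nat.totient (qt i) < Nat.totient (qt (i + 1)) := by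
  by_contra hlt
  have hkey := ppKey_qt_lt hi (Nat.lt_add_one i)
  have hle := totient_le_of_ppKey_le (qt_spec (i + 1)).1 hkey.le
  have heq : Nat.totient (qt i) = Nat.totient (qt (i + 1)) := by omega
  unfold UFO at h
  rw [if_neg hlt] at h
  have hL : Lseq i = Nat.lcm (Lseq (i - 1)) (qt (i + 1)) := by
    by_contra hne
    rw [Set.ncard_pair hne] at h
    omega
  have hd : qt i ∣ Lseq i := (dvd_Lseq_iff (qt_spec i).1 i).2 ⟨i, hi, le_rfl, dvd_rfl⟩
  rw [hL, (qt_spec i).1.dvd_lcm_iff (Lseq_ne_zero _) (qt_spec _).1.ne_zero,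
    dvd_Lseq_iff (qt_spec i).1] at hd
  rcases hd with ⟨j, hj1, hj2, hd⟩ | hd
  · have hk := ppKey_qt_lt hj1 (show j < i by omega)
    have hne : qt i ≠ qt j := fun e => by rw [e] at hk; omega
    have := totient_lt_of_isPrimePow_dvd (qt_spec i).1 (qt_spec j).1 hd hne
    have := totient_le_of_ppKey_le (qt_spec i).1 hk.le
    omega
  · have hne : qt i ≠ qt (i + 1) := fun e => by rw [e] at hkey; omega
    have := totient_lt_of_isPrimePow_dvd (qt_spec i).1 (qt_spec (i + 1)).1 hd hne
    omega

theorem one_lt_totient_qt {i : ℕ} (hi : 2 ≤ i) : 1 < Nat.totient (qt i) := by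
  by_contra! h
  have h2 : ∀ r, IsPrimePow r → Nat.totient r ≤ 1 → r = 2 := by
    intro r hr hr1
    have := hr.le_two_mul_totient
    have := hr.two_le
    omega
  have hk := ppKey_qt_lt le_rfl (show 1 < i by omega)
  have h3 := totient_le_of_ppKey_le (qt_spec i).1 hk.le
  rw [h2 _ (qt_spec 1).1 (by omega), h2 _ (qt_spec i).1 h] at hk
  omega

/-- The arithmetic content of `#f_{i-1} = #f_i = #f_{i+1} = 1`. -/
structure IsIsolatedPair (d q q' : ℕ) : Prop where
  left : IsPrimePow q
  right : IsPrimePow q'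
  one_lt : 1 < Nat.totient q
  lt : Nat.totient q < Nat.totient q'
  cases : ∀ s, IsPrimePow s → Nat.totient s < Nat.totient q ∨ s = q ∨ s = q' ∨
    Nat.totient q' < Nat.totient s
  ne_zero : d ≠ 0
  dvd_iff : ∀ s, IsPrimePow s → (s ∣ d ↔ Nat.totient s ≤ Nat.totient q)

theorem isIsolatedPair_qt {i : ℕ} (hi : 2 ≤ i) (h1 : (UFO (i - 1)).ncard = 1)
    (h2 : (UFO i).ncard = 1) (h3 : (UFO (i + 1)).ncard = 1) {d : ℕ} (hd : UFO i = {d}) :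
    IsIsolatedPair d (qt i) (qt (i + 1)) := by
  have t1 := totient_qt_lt_of_ncard (by omega) h1
  have t2 := totient_qt_lt_of_ncard (by omega) h2
  have t3 := totient_qt_lt_of_ncard (by omega) h3
  rw [Nat.sub_add_cancel (by omega)] at t1
  have hmono : ∀ j k, 1 ≤ j → j ≤ k → Nat.totient (qt j) ≤ Nat.totient (qt k) := by
    intro j k hj hjk
    rcases hjk.eq_or_lt with rfl | hlt
    · rfl
    · exact totient_le_of_ppKey_le (qt_spec k).1 (ppKey_qt_lt hj hlt).le
  have hdL : d = Lseq i := by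
    unfold UFO at hd
    rw [if_pos t2] at hd
    exact (Set.singleton_injective hd).symm
  refine ⟨(qt_spec _).1, (qt_spec _).1, one_lt_totient_qt hi, t2, fun s hs => ?_,
    hdL ▸ Lseq_ne_zero i, fun s hs => ?_⟩
  · obtain ⟨j, hj, rfl⟩ := exists_qt_eq hs
    rcases lt_trichotomy j i with h | rfl | h
    · have := hmono j (i - 1) hj (by omega)
      omega
    · simp
    · rcases (show j = i + 1 ∨ i + 2 ≤ j by omega) with rfl | h
      · simp
      · have := hmono (i + 1 + 1) j (by omega) (by omega)
        omega
  · rw [hdL, dvd_Lseq_iff hs]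
    constructor
    · rintro ⟨j, hj, hji, hdvd⟩
      exact (Nat.le_of_dvd (Nat.totient_pos.2 (qt_spec j).1.pos)
        (Nat.totient_dvd_of_dvd hdvd)).trans (hmono j i hj hji)
    · intro h
      obtain ⟨j, hj, rfl⟩ := exists_qt_eq hs
      refine ⟨j, hj, ?_, dvd_rfl⟩
      by_contra! hlt
      have := hmono (i + 1) j (by omega) hlt
      omega

/-- Bertrand's postulate rules out consecutive powers of one prime. -/
theorem IsIsolatedPair.coprime {d q q' : ℕ} (h : IsIsolatedPair d q q') : Nat.Coprime q q' := by
  obtain ⟨p, k, hp, hk, hq⟩ := (isPrimePow_nat_iff q).1 h.left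
  obtain ⟨p', l, hp', hl, hq'⟩ := (isPrimePow_nat_iff q').1 h.right
  by_cases hpp : p = p'
  swap
  · rw [← hq, ← hq']
    exact Nat.Coprime.pow _ _ ((Nat.coprime_primes hp hp').2 hpp)
  exfalso
  subst hpp
  obtain ⟨k, rfl⟩ : ∃ m, k = m + 1 := ⟨k - 1, by omega⟩
  have htq : Nat.totient q = p ^ k * (p - 1) := by
    rw [← hq, Nat.totient_prime_pow hp hk, Nat.add_sub_cancel]
  have htq' : Nat.totient q' = p ^ (l - 1) * (p - 1) := by
    rw [← hq', Nat.totient_prime_pow hp hl]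
  have hp1 : 0 < p - 1 := by have := hp.two_le; omega
  have hkl : k < l - 1 := by
    have := h.lt
    rw [htq, htq'] at this
    exact (Nat.pow_lt_pow_iff_right hp.one_lt).1 (Nat.lt_of_mul_lt_mul_right this)
  have hmul : p * Nat.totient q ≤ Nat.totient q' := by
    rw [htq, htq', ← mul_assoc, ← pow_succ']
    exact Nat.mul_le_mul_right _ (Nat.pow_le_pow_right hp.pos hkl)
  obtain ⟨r, hr, hr1, hr2⟩ := Nat.exists_prime_lt_and_le_two_mul (Nat.totient q + 1) (by omega)
  have htr := Nat.totient_prime hr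
  have h1 := h.one_lt
  have h2 := h.lt
  have hp2 := hp.two_le
  rcases h.cases r hr.isPrimePow with c | c | c | c
  · omega
  · rw [← c] at htq h1 hmul h2 hr1; omega
  · rw [c, ← hq'] at hr
    have := hr.eq_one_of_pow
    omega
  · rcases (show p = 2 ∨ 3 ≤ p by omega) with rfl | hp3
    · have hk1 : k ≠ 0 := by rintro rfl; simp at htq; omega
      have he : Even (Nat.totient q) := by
        rw [htq]; exact (Nat.even_pow.2 ⟨even_two, hk1⟩).mul_right _
      have ho := hr.odd_of_ne_two (by omega)
      obtain ⟨a, ha⟩ := he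
      obtain ⟨b, hb⟩ := ho
      omega
    · have := Nat.mul_le_mul_right (Nat.totient q) hp3
      omega

/-! ### Invariant factors of a finite commutative group -/

/-- A cyclic subgroup whose order is the exponent is a direct factor. -/
theorem exists_mulEquiv_prod_zpowers (G : Type) [CommGroup G] [Finite G] (g : G)
    (hg : orderOf g = Monoid.exponent G) :
    ∃ K : Subgroup G, Nonempty (G ≃* K × Subgroup.zpowers g) := by
  obtain ⟨ζ, hζ⟩ := HasEnoughRootsOfUnity.exists_primitiveRoot ℂ (Monoid.exponent G)
  have he : Monoid.exponent G ≠ 0 := Monoid.exponent_ne_zero_of_finite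
  have : NeZero (Monoid.exponent G) := ⟨he⟩
  set z : ℂˣ := ((hζ.toRootsOfUnity : rootsOfUnity (Monoid.exponent G) ℂ) : ℂˣ) with hz
  have hzp : IsPrimitiveRoot z (Monoid.exponent G) := by
    rw [← IsPrimitiveRoot.coe_units_iff]
    simpa [hz] using hζ
  let e : Subgroup.zpowers g ≃* Subgroup.zpowers z :=
    mulEquivOfCyclicCardEq (by rw [Nat.card_zpowers, Nat.card_zpowers, hg, ← hzp.eq_orderOf])
  obtain ⟨ψ, hψ⟩ := MonoidHom.domRestrict_surjective ℂ (Subgroup.zpowers g)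
    ((Subgroup.zpowers z).subtype.comp e.toMonoidHom)
  have hψ' : ∀ h : Subgroup.zpowers g, ψ h = e h := fun h => by
    simpa using DFunLike.congr_fun hψ h
  refine ⟨ψ.ker, ⟨(MulEquiv.ofBijective
    (MonoidHom.coprod ψ.ker.subtype (Subgroup.zpowers g).subtype) ⟨?_, fun x => ?_⟩).symm⟩⟩
  · rw [injective_iff_map_eq_one]
    rintro ⟨⟨k, hk⟩, h⟩ hkh
    simp only [MonoidHom.coprod_apply, Subgroup.subtype_apply] at hkh
    have h1 : ψ (h : G) = 1 := by
      have := congrArg ψ hkh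
      rwa [map_mul, MonoidHom.mem_ker.1 hk, one_mul, map_one] at this
    rw [hψ'] at h1
    have h2 : h = 1 := by
      apply e.injective
      rw [map_one]
      exact Subtype.ext h1
    subst h2
    simp only [OneMemClass.coe_one, mul_one] at hkh
    subst hkh
    rfl
  · have hx : ψ x ∈ Subgroup.zpowers z := by
      rw [hzp.zpowers_eq, mem_rootsOfUnity, ← map_pow, Monoid.pow_exponent_eq_one, map_one]
    obtain ⟨h, hh⟩ := e.surjective ⟨ψ x, hx⟩
    have hh' : ψ (h : G) = ψ x := by rw [hψ', hh]
    refine ⟨⟨⟨x * (h : G)⁻¹, ?_⟩, h⟩, ?_⟩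
    · rw [MonoidHom.mem_ker, map_mul, map_inv, hh', mul_inv_cancel]
    · simp

theorem exists_snoc_mulEquiv {K : ℕ} (lam : Fin (K + 1) → ℕ) :
    Nonempty (Multiplicative (∀ j : Fin K, ZMod (lam j.castSucc)) ×
      Multiplicative (ZMod (lam (Fin.last K))) ≃*
        Multiplicative (∀ j : Fin (K + 1), ZMod (lam j))) := by
  refine ⟨MulEquiv.symm
    { toFun := fun f => (Multiplicative.ofAdd fun j => f.toAdd j.castSucc,
        Multiplicative.ofAdd (f.toAdd (Fin.last K)))
      invFun := fun f => Multiplicative.ofAdd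
        (Fin.snoc (α := fun j => ZMod (lam j)) (fun j => f.1.toAdd j) f.2.toAdd)
      left_inv := fun f => ?_
      right_inv := fun f => ?_
      map_mul' := fun f g => rfl }⟩
  · apply Multiplicative.toAdd.injective
    ext j
    refine Fin.lastCases ?_ (fun i => ?_) j <;> simp
  · ext <;> simp

theorem dvd_exponent_of_mulEquiv {G : Type} [CommGroup G] {K : ℕ} {lam : Fin K → ℕ}
    (e : G ≃* Multiplicative (∀ j : Fin K, ZMod (lam j))) (j : Fin K) :
    lam j ∣ Monoid.exponent G := by
  rw [Monoid.exponent_eq_of_mulEquiv e]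
  have h := Monoid.pow_exponent_eq_one
    (Multiplicative.ofAdd (fun _ => 1 : ∀ j : Fin K, ZMod (lam j)))
  have h2 := congrFun (congrArg Multiplicative.toAdd h) j
  rw [toAdd_pow, toAdd_ofAdd, Pi.smul_apply, toAdd_one, Pi.zero_apply, nsmul_one] at h2
  exact (ZMod.natCast_eq_zero_iff _ _).1 h2

theorem exists_invariantFactors (n : ℕ) : ∀ (G : Type) [CommGroup G] [Finite G], Nat.card G = n →
    ∃ (K : ℕ) (lam : Fin K → ℕ), (∀ j, 1 < lam j) ∧
      (∀ j k : Fin K, j ≤ k → lam j ∣ lam k) ∧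
      Nonempty (G ≃* Multiplicative (∀ j : Fin K, ZMod (lam j))) := by
  induction n using Nat.strong_induction_on with
  | _ n ih =>
  intro G _ _ hn
  rcases subsingleton_or_nontrivial G with hG | hG
  · refine ⟨0, Fin.elim0, fun j => j.elim0, fun j => j.elim0, ⟨?_⟩⟩
    have : Unique G := ⟨⟨1⟩, fun _ => Subsingleton.elim _ _⟩
    have : Unique (Multiplicative (∀ j : Fin 0, ZMod (Fin.elim0 j))) :=
      ⟨⟨1⟩, fun _ => Multiplicative.toAdd.injective (Subsingleton.elim _ _)⟩
    exact MulEquiv.ofUnique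
  obtain ⟨g, hg⟩ := Monoid.exists_orderOf_eq_exponent (G := G) Monoid.ExponentExists.of_finite
  obtain ⟨H, ⟨e⟩⟩ := exists_mulEquiv_prod_zpowers G g hg
  have h1 : 1 < Monoid.exponent G := by
    have h0 : Monoid.exponent G ≠ 0 := Monoid.exponent_ne_zero_of_finite
    have h1 : Monoid.exponent G ≠ 1 := fun h =>
      not_subsingleton G (Monoid.exp_eq_one_iff.1 h)
    omega
  have hcard : Nat.card H * Monoid.exponent G = n := by
    rw [← hn, Nat.card_congr e.toEquiv, Nat.card_prod, Nat.card_zpowers, hg]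
  have hpos : 0 < Nat.card H := Nat.card_pos
  obtain ⟨K, lam, hl1, hl2, ⟨f⟩⟩ := ih (Nat.card H) (by nlinarith) H rfl
  obtain ⟨lam', hlast, hcast⟩ : ∃ lam' : Fin (K + 1) → ℕ,
      lam' (Fin.last K) = Monoid.exponent G ∧ ∀ j : Fin K, lam' j.castSucc = lam j :=
    ⟨Fin.snoc (α := fun _ => ℕ) lam (Monoid.exponent G), by simp, by simp⟩
  obtain rfl : (fun j : Fin K => lam' j.castSucc) = lam := funext hcast
  obtain ⟨s⟩ := exists_snoc_mulEquiv lam'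
  have hz : Nat.card (Subgroup.zpowers g) = lam' (Fin.last K) := by
    rw [Nat.card_zpowers, hg, hlast]
  have c : Subgroup.zpowers g ≃* Multiplicative (ZMod (lam' (Fin.last K))) :=
    (zmodMulEquivOfGenerator (g := (⟨g, Subgroup.mem_zpowers g⟩ : Subgroup.zpowers g))
      (fun x => by
        obtain ⟨x, k, rfl⟩ := x
        exact ⟨k, rfl⟩) hz).symm
  refine ⟨K + 1, lam', fun j => ?_, fun j k => ?_, ⟨(e.trans (MulEquiv.prodCongr f c)).trans s⟩⟩
  · refine Fin.lastCases ?_ (fun i => ?_) j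
    · rwa [hlast]
    · exact hl1 i
  · refine Fin.lastCases (fun _ => ?_) (fun k' => ?_) k
    · rw [hlast]
      refine Fin.lastCases ?_ (fun i => ?_) j
      · rw [hlast]
      · exact (dvd_exponent_of_mulEquiv f i).trans (Monoid.exponent_submonoid_dvd H.toSubmonoid)
    · refine Fin.lastCases (fun h => ?_) (fun i h => ?_) j
      · exact absurd h (not_le.2 (Fin.castSucc_lt_last k'))
      · exact hl2 i k' (Fin.castSucc_le_castSucc_iff.1 h)

/-! ### Torsion counts -/

/-- The number of solutions of `x ^ n = 1`. -/
def torsionCard (G : Type*) [CommGroup G] (n : ℕ) : ℕ := Nat.card {x : G // x ^ n = 1}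

theorem torsionCard_congr {G H : Type*} [CommGroup G] [CommGroup H] (e : G ≃* H) (n : ℕ) :
    torsionCard G n = torsionCard H n :=
  Nat.card_congr (e.toEquiv.subtypeEquiv fun x => by
    change x ^ n = 1 ↔ e x ^ n = 1
    rw [← map_pow, map_eq_one_iff e e.injective])

theorem torsionCard_prod (G H : Type*) [CommGroup G] [CommGroup H] (n : ℕ) :
    torsionCard (G × H) n = torsionCard G n * torsionCard H n := by
  unfold torsionCard
  rw [← Nat.card_prod]
  refine Nat.card_congr ⟨fun x => (⟨x.1.1, ?_⟩, ⟨x.1.2, ?_⟩), fun x => ⟨(x.1.1, x.2.1), ?_⟩,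
    fun x => rfl, fun x => rfl⟩
  · exact congrArg Prod.fst x.2
  · exact congrArg Prod.snd x.2
  · exact Prod.ext x.1.2 x.2.2

theorem torsionCard_pos (G : Type*) [CommGroup G] [Finite G] (n : ℕ) : 0 < torsionCard G n :=
  have : Nonempty {x : G // x ^ n = 1} := ⟨⟨1, one_pow n⟩⟩
  Nat.card_pos

theorem torsionCard_le_of_dvd (G : Type*) [CommGroup G] [Finite G] {m n : ℕ} (h : m ∣ n) :
    torsionCard G m ≤ torsionCard G n := by
  refine Nat.card_le_card_of_injective
    (fun x : {x : G // x ^ m = 1} => (⟨x.1, ?_⟩ : {x : G // x ^ n = 1})) fun x y hxy => ?_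
  · obtain ⟨k, rfl⟩ := h
    rw [pow_mul, x.2, one_pow]
  · exact Subtype.ext (Subtype.mk.inj hxy)

theorem torsionCard_of_subsingleton (G : Type*) [CommGroup G] [Subsingleton G] (n : ℕ) :
    torsionCard G n = 1 :=
  have : Unique {x : G // x ^ n = 1} :=
    ⟨⟨⟨1, one_pow n⟩⟩, fun _ => Subtype.ext (Subsingleton.elim _ _)⟩
  Nat.card_unique

theorem torsionCard_eq_card_ker (G : Type*) [CommGroup G] (n : ℕ) :
    torsionCard G n = Nat.card (powMonoidHom n : G →* G).ker :=
  Nat.card_congr (Equiv.subtypeEquivRight fun x => by simp [MonoidHom.mem_ker])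

theorem torsionCard_of_isCyclic (G : Type*) [CommGroup G] [Finite G] [IsCyclic G] (n : ℕ) :
    torsionCard G n = (Nat.card G).gcd n := by
  rw [torsionCard_eq_card_ker, IsCyclic.card_powMonoidHom_ker]

theorem torsionCard_mul_le (G : Type*) [CommGroup G] [Finite G] (m n : ℕ) :
    torsionCard G (m * n) ≤ torsionCard G m * torsionCard G n := by
  rw [torsionCard_eq_card_ker, torsionCard_eq_card_ker, torsionCard_eq_card_ker]
  let f : (powMonoidHom (m * n) : G →* G).ker →* (powMonoidHom n : G →* G).ker :=
    ((powMonoidHom m : G →* G).comp (Subgroup.subtype _)).codRestrict _ fun x => by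
      have h : (x : G) ^ (m * n) = 1 := MonoidHom.mem_ker.1 x.2
      rw [pow_mul] at h
      exact MonoidHom.mem_ker.2 h
  rw [← Subgroup.card_mul_index f.ker]
  refine Nat.mul_le_mul ?_ ?_
  · refine Nat.card_le_card_of_injective
      (fun x => (⟨(x.1 : G), ?_⟩ : (powMonoidHom m : G →* G).ker)) fun x y hxy => ?_
    · exact congrArg Subtype.val x.2
    · exact Subtype.ext (Subtype.ext (Subtype.mk.inj hxy))
  · rw [Subgroup.index_ker]
    exact Nat.card_le_card_of_injective _ Subtype.val_injective

theorem torsionCard_pi {K : ℕ} (lam : Fin K → ℕ) (h : ∀ j, lam j ≠ 0) (n : ℕ) :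
    torsionCard (Multiplicative (∀ j, ZMod (lam j))) n = ∏ j, (lam j).gcd n := by
  have h1 : ∀ j, (lam j).gcd n = Nat.card {x : Multiplicative (ZMod (lam j)) // x ^ n = 1} := by
    intro j
    have : NeZero (lam j) := ⟨h j⟩
    have := torsionCard_of_isCyclic (Multiplicative (ZMod (lam j))) n
    rw [torsionCard] at this
    rw [this, Nat.card_congr Multiplicative.toAdd, Nat.card_zmod]
  simp_rw [h1]
  rw [← Nat.card_pi]
  refine Nat.card_congr ⟨fun x j => ⟨Multiplicative.ofAdd (x.1.toAdd j), ?_⟩,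
    fun x => ⟨Multiplicative.ofAdd fun j => (x j).1.toAdd, ?_⟩, fun x => rfl, fun x => rfl⟩
  · exact congrFun (congrArg Multiplicative.toAdd x.2) j
  · exact Multiplicative.toAdd.injective (funext fun j => congrArg Multiplicative.toAdd (x j).2)

theorem gcd_prime_pow_succ {p : ℕ} (hp : p.Prime) (l a : ℕ) :
    l.gcd (p ^ (a + 1)) = l.gcd (p ^ a) * if p ^ (a + 1) ∣ l then p else 1 := by
  split_ifs with h
  · rw [Nat.gcd_eq_right h, Nat.gcd_eq_right ((pow_dvd_pow p a.le_succ).trans h), pow_succ]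
  · rw [mul_one]
    refine Nat.dvd_antisymm (Nat.dvd_gcd (Nat.gcd_dvd_left _ _) ?_)
      (Nat.gcd_dvd_gcd_of_dvd_right _ (pow_dvd_pow p a.le_succ))
    obtain ⟨b, hb, hb'⟩ := (Nat.dvd_prime_pow hp).1 (Nat.gcd_dvd_right l (p ^ (a + 1)))
    rw [hb']
    apply pow_dvd_pow
    by_contra hlt
    obtain rfl : b = a + 1 := by omega
    exact h (hb' ▸ Nat.gcd_dvd_left l (p ^ (a + 1)))

theorem torsionCard_pi_prime_pow {K : ℕ} (lam : Fin K → ℕ) (h : ∀ j, lam j ≠ 0) {p : ℕ}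
    (hp : p.Prime) (a : ℕ) :
    torsionCard (Multiplicative (∀ j, ZMod (lam j))) (p ^ (a + 1)) =
      torsionCard (Multiplicative (∀ j, ZMod (lam j))) (p ^ a) *
        p ^ (Finset.univ.filter fun j => p ^ (a + 1) ∣ lam j).card := by
  rw [torsionCard_pi lam h, torsionCard_pi lam h]
  simp_rw [fun j => gcd_prime_pow_succ hp (lam j) a]
  rw [Finset.prod_mul_distrib, Finset.prod_ite]
  simp

theorem torsionCard_units_mul {m n : ℕ} (h : Nat.Coprime m n) (k : ℕ) :
    torsionCard (ZMod (m * n))ˣ k = torsionCard (ZMod m)ˣ k * torsionCard (ZMod n)ˣ k := by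
  rw [← torsionCard_prod]
  exact torsionCard_congr
    ((Units.mapEquiv (ZMod.chineseRemainder h).toMulEquiv).trans MulEquiv.prodUnits) k

theorem torsionCard_units_eq_prod {m : ℕ} (hm : m ≠ 0) (k : ℕ) :
    torsionCard (ZMod m)ˣ k =
      ∏ l ∈ m.primeFactors, torsionCard (ZMod (l ^ m.factorization l))ˣ k := by
  refine Nat.multiplicative_factorization (fun m => torsionCard (ZMod m)ˣ k)
    (fun x y h => torsionCard_units_mul h k) ?_ hm
  exact torsionCard_of_subsingleton _ _

theorem torsionCard_units_two_pow_le (v : ℕ) : torsionCard (ZMod (2 ^ v))ˣ 2 ≤ 4 := by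
  rcases v with _ | w
  · rw [pow_zero, torsionCard_of_subsingleton]
    norm_num
  have key : ∀ x : (ZMod (2 ^ (w + 1)))ˣ, x ^ 2 = 1 →
      (x : ZMod (2 ^ (w + 1))) ∈ ({1, 1 + 2 ^ w, -1, -1 + 2 ^ w} : Finset (ZMod (2 ^ (w + 1)))) := by
    intro x hx
    have main : ∀ e y : ℤ, (2 ^ w : ℤ) ∣ y - e → (y : ZMod (2 ^ (w + 1))) = e ∨
        (y : ZMod (2 ^ (w + 1))) = e + 2 ^ w := by
      intro e y ⟨k, hk⟩
      have h0 : (2 : ZMod (2 ^ (w + 1))) ^ (w + 1) = 0 := by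
        have := ZMod.natCast_self (2 ^ (w + 1))
        exact_mod_cast this
      obtain rfl : y = e + 2 ^ w * k := by linarith
      rcases Int.even_or_odd' k with ⟨c, rfl | rfl⟩
      · left
        push_cast
        linear_combination (c : ZMod (2 ^ (w + 1))) * h0
      · right
        push_cast
        linear_combination (c : ZMod (2 ^ (w + 1))) * h0
    obtain ⟨y, hy⟩ := ZMod.intCast_surjective (x : ZMod (2 ^ (w + 1)))
    have h1 : ((2 ^ (w + 1) : ℕ) : ℤ) ∣ y ^ 2 - 1 := by
      rw [← ZMod.intCast_zmod_eq_zero_iff_dvd]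
      have : (x : ZMod (2 ^ (w + 1))) ^ 2 = 1 := by
        rw [← Units.val_pow_eq_pow_val, hx, Units.val_one]
      push_cast
      rw [hy, this, sub_self]
    push_cast at h1
    have h2 : (2 ^ w : ℤ) ∣ y - 1 ∨ (2 ^ w : ℤ) ∣ y - (-1) := by
      have hodd : Odd y := by
        by_contra he
        rw [Int.not_odd_iff_even] at he
        have h3 : (2 : ℤ) ∣ y ^ 2 - 1 := (dvd_pow_self 2 (by omega)).trans h1
        obtain ⟨c, rfl⟩ := he
        obtain ⟨k, hk⟩ := h3
        ring_nf at hk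
        omega
      obtain ⟨b, rfl⟩ := hodd
      have h3 : (2 * 2 ^ w : ℤ) ∣ 2 * (2 * (b * (b + 1))) := by
        rw [pow_succ'] at h1
        convert h1 using 1
        ring
      have h4 := (mul_dvd_mul_iff_left (two_ne_zero (α := ℤ))).1 h3
      have h5 : IsCoprime b (b + 1) := ⟨-1, 1, by ring⟩
      rcases Int.even_or_odd b with hb | hb
      · left
        have hc : IsCoprime (2 ^ w : ℤ) (b + 1) :=
          IsCoprime.pow_left (by obtain ⟨c, rfl⟩ := hb; exact ⟨-c, 1, by ring⟩)
        have : 2 * b + 1 - 1 = 2 * b := by ring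
        rw [this]
        refine hc.dvd_of_dvd_mul_right (by rwa [mul_assoc])
      · right
        have hc : IsCoprime (2 ^ w : ℤ) b :=
          IsCoprime.pow_left (by obtain ⟨c, rfl⟩ := hb; exact ⟨-c, 1, by ring⟩)
        have : 2 * b + 1 - (-1) = 2 * (b + 1) := by ring
        rw [this]
        refine hc.dvd_of_dvd_mul_left ?_
        convert h4 using 1
        ring
    rcases h2 with h2 | h2
    · have := main _ _ h2
      rw [hy] at this
      simp only [Finset.mem_insert, Finset.mem_singleton]
      push_cast at this
      tauto
    · have := main _ _ h2
      rw [hy] at this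
      simp only [Finset.mem_insert, Finset.mem_singleton]
      push_cast at this
      tauto
  have h := Nat.card_le_card_of_injective
    (fun x : {x : (ZMod (2 ^ (w + 1)))ˣ // x ^ 2 = 1} =>
      (⟨(x.1 : ZMod (2 ^ (w + 1))), key x.1 x.2⟩ :
        ({1, 1 + 2 ^ w, -1, -1 + 2 ^ w} : Finset (ZMod (2 ^ (w + 1))))))
    fun x y hxy => Subtype.ext (Units.ext (congrArg Subtype.val hxy))
  rw [Nat.card_eq_finsetCard] at h
  exact h.trans Finset.card_le_four

theorem torsionCard_units_prime_pow_bounds {p l : ℕ} (hp : p.Prime) (hl : l.Prime) (a v : ℕ)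
    (hv : v ≠ 0) :
    (p ^ if l % p ^ (a + 1) = 1 % p ^ (a + 1) then 1 else 0) *
        torsionCard (ZMod (l ^ v))ˣ (p ^ a) ≤ torsionCard (ZMod (l ^ v))ˣ (p ^ (a + 1)) ∧
      torsionCard (ZMod (l ^ v))ˣ (p ^ (a + 1)) ≤
        (p ^ if l % p ^ (a + 1) = 1 % p ^ (a + 1) then 1 else 0) *
          (p ^ if l = p then 2 else 0) * torsionCard (ZMod (l ^ v))ˣ (p ^ a) := by
  have : NeZero (l ^ v) := ⟨pow_ne_zero v hl.ne_zero⟩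
  have hdvd : l % p ^ (a + 1) = 1 % p ^ (a + 1) ↔ p ^ (a + 1) ∣ l - 1 := by
    rw [← Nat.modEq_iff_dvd' hl.one_le, Nat.ModEq, eq_comm]
  rw [if_congr hdvd rfl rfl]
  have hcard : Nat.card (ZMod (l ^ v))ˣ = l ^ (v - 1) * (l - 1) := by
    rw [Nat.card_eq_fintype_card, ZMod.card_units_eq_totient,
      Nat.totient_prime_pow hl (Nat.pos_of_ne_zero hv)]
  by_cases hlp : l = p
  · subst hlp
    have hn : ¬ l ^ (a + 1) ∣ l - 1 := fun h => by
      have h1 := Nat.le_of_dvd (by have := hl.two_le; omega) h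
      have h2 := Nat.le_self_pow (show a + 1 ≠ 0 by omega) l
      have := hl.two_le
      omega
    rw [if_neg hn, if_pos rfl, pow_zero, one_mul, one_mul]
    refine ⟨torsionCard_le_of_dvd _ (pow_dvd_pow l a.le_succ), ?_⟩
    rw [pow_succ' l a]
    refine (torsionCard_mul_le _ _ _).trans (Nat.mul_le_mul_right _ ?_)
    rcases hl.eq_two_or_odd' with rfl | hodd
    · exact torsionCard_units_two_pow_le v
    · have := ZMod.isCyclic_units_of_prime_pow l hl (by rintro rfl; exact absurd hodd (by decide)) v
      rw [torsionCard_of_isCyclic]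
      exact (Nat.le_of_dvd hl.pos (Nat.gcd_dvd_right _ _)).trans (Nat.le_self_pow two_ne_zero l)
  · rw [if_neg hlp, pow_zero, mul_one]
    suffices h : torsionCard (ZMod (l ^ v))ˣ (p ^ (a + 1)) =
        (p ^ if p ^ (a + 1) ∣ l - 1 then 1 else 0) * torsionCard (ZMod (l ^ v))ˣ (p ^ a) from
      ⟨h.ge, h.le⟩
    rcases hl.eq_two_or_odd' with rfl | hodd
    · have h1 : ∀ b, torsionCard (ZMod (2 ^ v))ˣ (p ^ b) = 1 := by
        intro b
        have : Unique {x : (ZMod (2 ^ v))ˣ // x ^ p ^ b = 1} := by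
          refine ⟨⟨⟨1, one_pow _⟩⟩, fun x => Subtype.ext ?_⟩
          have h2 := orderOf_dvd_of_pow_eq_one x.2
          have h3 := orderOf_dvd_natCard x.1
          rw [hcard] at h3
          have hc : Nat.Coprime (p ^ b) (2 ^ (v - 1) * (2 - 1)) := by
            rw [Nat.add_one_sub_one, mul_one]
            exact Nat.Coprime.pow _ _ ((Nat.coprime_primes hp hl).2 (Ne.symm hlp))
          have := Nat.eq_one_of_dvd_coprimes hc h2 h3
          exact orderOf_eq_one_iff.1 this
        exact Nat.card_unique
      rw [h1, h1, if_neg, pow_zero, mul_one]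
      intro h
      have := Nat.le_of_dvd one_pos h
      have h2 := Nat.le_self_pow (show a + 1 ≠ 0 by omega) p
      have := hp.two_le
      omega
    · have := ZMod.isCyclic_units_of_prime_pow l hl (by rintro rfl; exact absurd hodd (by decide)) v
      have hg : ∀ b, torsionCard (ZMod (l ^ v))ˣ (p ^ b) = (l - 1).gcd (p ^ b) := by
        intro b
        rw [torsionCard_of_isCyclic, hcard]
        exact Nat.Coprime.gcd_mul_left_cancel _
          (Nat.Coprime.pow _ _ ((Nat.coprime_primes hl hp).2 hlp))
      rw [hg, hg, gcd_prime_pow_succ hp, mul_comm]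
      congr 1
      split_ifs <;> simp

theorem omegaQ_le_card_filter_dvd {m K : ℕ} (hm : m ≠ 0) {lam : Fin K → ℕ} (h : ∀ j, lam j ≠ 0)
    (e : (ZMod m)ˣ ≃* Multiplicative (∀ j, ZMod (lam j))) {q : ℕ} (hq : IsPrimePow q) :
    omegaQ m q ≤ (Finset.univ.filter fun j => q ∣ lam j).card ∧
      (Finset.univ.filter fun j => q ∣ lam j).card ≤ omegaQ m q + 2 := by
  obtain ⟨p, k, hp, hk, rfl⟩ := (isPrimePow_nat_iff q).1 hq
  obtain ⟨a, rfl⟩ : ∃ a, k = a + 1 := ⟨k - 1, by omega⟩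
  have : NeZero m := ⟨hm⟩
  have h1 := torsionCard_pi_prime_pow lam h hp a
  rw [← torsionCard_congr e, ← torsionCard_congr e] at h1
  have hpos := torsionCard_pos (ZMod m)ˣ (p ^ a)
  have hv : ∀ l ∈ m.primeFactors, m.factorization l ≠ 0 := fun l hl => by
    rwa [← Finsupp.mem_support_iff, Nat.support_factorization]
  have hω : ∏ l ∈ m.primeFactors, (p ^ if l % p ^ (a + 1) = 1 % p ^ (a + 1) then 1 else 0) =
      p ^ omegaQ m (p ^ (a + 1)) := by
    rw [Finset.prod_pow_eq_pow_sum, omegaQ, Finset.card_filter]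
  have h2 : ∏ l ∈ m.primeFactors, (p ^ if l = p then 2 else 0) ≤ p ^ 2 := by
    rw [Finset.prod_pow_eq_pow_sum, Finset.sum_ite_eq']
    exact Nat.pow_le_pow_right hp.pos (by split_ifs <;> omega)
  have hlow : p ^ omegaQ m (p ^ (a + 1)) * torsionCard (ZMod m)ˣ (p ^ a) ≤
      torsionCard (ZMod m)ˣ (p ^ (a + 1)) := by
    rw [torsionCard_units_eq_prod hm, torsionCard_units_eq_prod hm, ← hω,
      ← Finset.prod_mul_distrib]
    exact Finset.prod_le_prod' fun l hl => (torsionCard_units_prime_pow_bounds hp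
      (Nat.prime_of_mem_primeFactors hl) a _ (hv l hl)).1
  have hup : torsionCard (ZMod m)ˣ (p ^ (a + 1)) ≤
      p ^ (omegaQ m (p ^ (a + 1)) + 2) * torsionCard (ZMod m)ˣ (p ^ a) := by
    rw [pow_add _ (omegaQ _ _), ← hω]
    refine le_trans ?_ (Nat.mul_le_mul_right _ (Nat.mul_le_mul_left _ h2))
    rw [torsionCard_units_eq_prod hm, torsionCard_units_eq_prod hm,
      ← Finset.prod_mul_distrib, ← Finset.prod_mul_distrib]
    exact Finset.prod_le_prod' fun l hl => (torsionCard_units_prime_pow_bounds hp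
      (Nat.prime_of_mem_primeFactors hl) a _ (hv l hl)).2
  rw [h1, mul_comm] at hlow
  rw [h1, mul_comm (p ^ _)] at hup
  exact ⟨(Nat.pow_le_pow_iff_right hp.one_lt).1 (Nat.le_of_mul_le_mul_left hlow hpos),
    (Nat.pow_le_pow_iff_right hp.one_lt).1 (Nat.le_of_mul_le_mul_left hup hpos)⟩

/-! ### Counting an invariant factor -/

theorem filter_dvd_subset_of_card_le {K : ℕ} {lam : Fin K → ℕ}
    (hc : ∀ j k : Fin K, j ≤ k → lam j ∣ lam k) {s t : ℕ}
    (h : (Finset.univ.filter fun j => s ∣ lam j).card ≤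
      (Finset.univ.filter fun j => t ∣ lam j).card) {j : Fin K} (hj : s ∣ lam j) : t ∣ lam j := by
  by_contra ht
  have hsub : (Finset.univ.filter fun j => t ∣ lam j) ⊂ Finset.univ.filter fun j => s ∣ lam j := by
    rw [Finset.ssubset_iff_of_subset]
    · exact ⟨j, by simpa using hj, by simpa using ht⟩
    · intro k hk
      rw [Finset.mem_filter] at hk ⊢
      refine ⟨hk.1, hj.trans (hc j k ?_)⟩
      by_contra! hkj
      exact ht (hk.2.trans (hc k j hkj.le))
  exact absurd (Finset.card_lt_card hsub) (by omega)

theorem eq_of_isPrimePow_dvd_iff {a b : ℕ} (ha : a ≠ 0) (hb : b ≠ 0)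
    (h : ∀ s, IsPrimePow s → (s ∣ a ↔ s ∣ b)) : a = b := by
  have key : ∀ {a b : ℕ}, b ≠ 0 → (∀ s, IsPrimePow s → (s ∣ a → s ∣ b)) → a ∣ b := by
    intro a b hb h
    rw [Nat.dvd_iff_prime_pow_dvd_dvd]
    intro p k hp hk
    rcases Nat.eq_zero_or_pos k with rfl | hk0
    · simp
    · exact h _ (hp.isPrimePow.pow hk0.ne') hk
  exact Nat.dvd_antisymm (key hb fun s hs => (h s hs).1) (key ha fun s hs => (h s hs).2)

theorem IsIsolatedPair.card_filter_eq {d q q' K : ℕ} (hd : IsIsolatedPair d q q')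
    {lam : Fin K → ℕ} (h0 : ∀ j, lam j ≠ 0) (hc : ∀ j k : Fin K, j ≤ k → lam j ∣ lam k)
    (h1 : ∀ s, IsPrimePow s → Nat.totient s < Nat.totient q →
      (Finset.univ.filter fun j => q ∣ lam j).card ≤ (Finset.univ.filter fun j => s ∣ lam j).card)
    (h2 : (Finset.univ.filter fun j => q' ∣ lam j).card ≤
      (Finset.univ.filter fun j => q ∣ lam j).card)
    (h3 : ∀ s, IsPrimePow s → Nat.totient q' < Nat.totient s →
      (Finset.univ.filter fun j => s ∣ lam j).card ≤
        (Finset.univ.filter fun j => q' ∣ lam j).card) :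
    (Finset.univ.filter fun j => lam j = d).card + (Finset.univ.filter fun j => q' ∣ lam j).card =
      (Finset.univ.filter fun j => q ∣ lam j).card := by
  have hsub : (Finset.univ.filter fun j => q' ∣ lam j) ⊆ Finset.univ.filter fun j => q ∣ lam j := by
    intro j hj
    rw [Finset.mem_filter] at hj ⊢
    exact ⟨hj.1, filter_dvd_subset_of_card_le hc h2 hj.2⟩
  have : (Finset.univ.filter fun j => lam j = d) =
      (Finset.univ.filter fun j => q ∣ lam j) \ Finset.univ.filter fun j => q' ∣ lam j := by
    ext j
    simp only [Finset.mem_filter, Finset.mem_univ, true_and, Finset.mem_sdiff]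
    constructor
    · intro h
      rw [h, hd.dvd_iff q hd.left, hd.dvd_iff q' hd.right]
      have := hd.lt
      omega
    · rintro ⟨hq, hq'⟩
      refine eq_of_isPrimePow_dvd_iff (h0 j) hd.ne_zero fun s hs => ?_
      rw [hd.dvd_iff s hs]
      constructor
      · intro hsj
        by_contra! hlt
        rcases hd.cases s hs with h | rfl | rfl | h
        · omega
        · omega
        · exact hq' hsj
        · exact hq' (filter_dvd_subset_of_card_le hc (h3 s hs h) hsj)
      · intro hle
        rcases hle.lt_or_eq with h | h
        · exact filter_dvd_subset_of_card_le hc (h1 s hs h) hq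
        · have := hd.lt
          rcases hd.cases s hs with h' | rfl | rfl | h'
          · omega
          · exact hq
          · omega
          · omega
  rw [this, Finset.card_sdiff_add_card_eq_card hsub]

/-- Away from a few exceptional `m`, the count is a difference of two values of `ω`. -/
theorem IsInvCount.abs_sub_le {d q q' : ℕ} (hd : IsIsolatedPair d q q') {J : ℕ → ℕ}
    (hJ : IsInvCount d J) {m Y : ℕ} (hm : 1 ≤ m)
    (h1 : ∀ s, IsPrimePow s → Nat.totient s < Nat.totient q → omegaQ m q + 2 ≤ omegaQ m s)
    (h2 : omegaQ m q' + 2 ≤ omegaQ m q)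
    (h3 : ∀ s, IsPrimePow s → Nat.totient q' < Nat.totient s → s ≤ Y * (2 * Nat.totient q' + 1) →
      omegaQ m s + 2 ≤ omegaQ m q')
    (h4 : ∀ r, r.Prime → Y < r → omegaQ m r + 2 ≤ omegaQ m q') :
    |(J m : ℝ) - ((omegaQ m q : ℝ) - omegaQ m q')| ≤ 2 := by
  have : NeZero m := ⟨by omega⟩
  obtain ⟨K, lam, hl, hc, ⟨e⟩⟩ := exists_invariantFactors _ (ZMod m)ˣ rfl
  have h0 : ∀ j, lam j ≠ 0 := fun j => by have := hl j; omega
  have hω := fun s (hs : IsPrimePow s) => omegaQ_le_card_filter_dvd (by omega : m ≠ 0) h0 e hs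
  have hanti : ∀ s t, s ∣ t → (Finset.univ.filter fun j => t ∣ lam j).card ≤
      (Finset.univ.filter fun j => s ∣ lam j).card := by
    intro s t hst
    refine Finset.card_le_card fun j hj => ?_
    rw [Finset.mem_filter] at hj ⊢
    exact ⟨hj.1, hst.trans hj.2⟩
  have hq := hω q hd.left
  have hq' := hω q' hd.right
  have key := hd.card_filter_eq h0 hc ?_ (by omega) ?_
  · rw [hJ m hm K lam hl hc ⟨e⟩, abs_le]
    have e1 : ((Finset.univ.filter fun j => lam j = d).card : ℝ) +
        ((Finset.univ.filter fun j => q' ∣ lam j).card : ℝ) =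
        ((Finset.univ.filter fun j => q ∣ lam j).card : ℝ) := by exact_mod_cast key
    have e2 : (omegaQ m q : ℝ) ≤ ((Finset.univ.filter fun j => q ∣ lam j).card : ℝ) := by
      exact_mod_cast hq.1
    have e3 : ((Finset.univ.filter fun j => q ∣ lam j).card : ℝ) ≤ (omegaQ m q : ℝ) + 2 := by
      exact_mod_cast hq.2
    have e4 : (omegaQ m q' : ℝ) ≤ ((Finset.univ.filter fun j => q' ∣ lam j).card : ℝ) := by
      exact_mod_cast hq'.1
    have e5 : ((Finset.univ.filter fun j => q' ∣ lam j).card : ℝ) ≤ (omegaQ m q' : ℝ) + 2 := by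
      exact_mod_cast hq'.2
    constructor <;> linarith
  · intro s hs hlt
    have := hω s hs
    have := h1 s hs hlt
    omega
  · intro s hs hlt
    obtain ⟨p, k, hp, hk, rfl⟩ := (isPrimePow_nat_iff s).1 hs
    by_cases hpY : Y < p
    · have := hω p hp.isPrimePow
      have := h4 p hp hpY
      have := hanti _ _ (dvd_pow_self p hk.ne')
      omega
    · obtain ⟨b, hb, hbmin⟩ : ∃ b, (0 < b ∧ Nat.totient q' < Nat.totient (p ^ b)) ∧
          ∀ c < b, ¬ (0 < c ∧ Nat.totient q' < Nat.totient (p ^ c)) := by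
        classical
        have hex : ∃ b, 0 < b ∧ Nat.totient q' < Nat.totient (p ^ b) := ⟨k, hk, hlt⟩
        exact ⟨Nat.find hex, Nat.find_spec hex, fun c hc => Nat.find_min hex hc⟩
      have hbk : b ≤ k := by
        by_contra! h
        exact hbmin k h ⟨hk, hlt⟩
      have hbd : p ^ b ≤ Y * (2 * Nat.totient q' + 1) := by
        obtain ⟨c, rfl⟩ : ∃ c, b = c + 1 := ⟨b - 1, by omega⟩
        rw [pow_succ, mul_comm]
        refine Nat.mul_le_mul (not_lt.1 hpY) ?_
        rcases Nat.eq_zero_or_pos c with rfl | hc0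
        · rw [pow_zero]; omega
        · have h5 := hbmin c (by omega)
          have h6 := (hp.isPrimePow.pow hc0.ne').le_two_mul_totient
          have : Nat.totient (p ^ c) ≤ Nat.totient q' := by
            by_contra! h
            exact h5 ⟨hc0, h⟩
          omega
      have hpb : IsPrimePow (p ^ b) := hp.isPrimePow.pow hb.1.ne'
      have := hω _ hpb
      have := h3 _ hpb hb.2 hbd
      have := hanti _ _ (pow_dvd_pow p hbk)
      omega

/-! ### Reciprocals of primes congruent to one -/

/-- The indicator function of the primes `p ≡ 1 (mod q)`. -/
def primeInd (q n : ℕ) : ℝ := if n.Prime ∧ n % q = 1 % q then 1 else 0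

theorem primeInd_nonneg (q n : ℕ) : 0 ≤ primeInd q n := by
  unfold primeInd; split_ifs <;> norm_num

theorem primeInd_le_one (q n : ℕ) : primeInd q n ≤ 1 := by
  unfold primeInd; split_ifs <;> norm_num

theorem primeInd_eq_zero_of_lt_two {q n : ℕ} (h : n < 2) : primeInd q n = 0 := by
  unfold primeInd
  rw [if_neg]
  rintro ⟨h1, -⟩
  exact absurd h1.two_le (by omega)

open ArithmeticFunction ArithmeticFunction.vonMangoldt in
theorem exists_abs_tsum_log_sub_le (q : ℕ) (hq : q ≠ 0) :
    ∃ C : ℝ, 0 ≤ C ∧ ∀ s ∈ Set.Ioc (1 : ℝ) 2,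
      Summable (fun n : ℕ => primeInd q n * Real.log n / (n : ℝ) ^ s) ∧
      |∑' n : ℕ, primeInd q n * Real.log n / (n : ℝ) ^ s - (q.totient : ℝ)⁻¹ / (s - 1)| ≤ C := by
  have : NeZero q := ⟨hq⟩
  have ha : IsUnit (1 : ZMod q) := isUnit_one
  have hcont : ContinuousOn (fun x : ℝ => (LFunctionResidueClassAux (1 : ZMod q) x).re)
      (Set.Icc 1 2) :=
    Complex.continuous_re.continuousOn.comp (t := Set.univ)
      (continuousOn_LFunctionResidueClassAux (1 : ZMod q)) (fun _ _ => trivial) |>.comp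
        Complex.continuous_ofReal.continuousOn fun x hx => by
          simpa only [Set.mem_ofPred_eq, Complex.ofReal_re] using hx.1
  obtain ⟨C, hC⟩ := isCompact_Icc.exists_bound_of_continuousOn hcont
  have H : ∀ x : ℝ, 1 < x → ∑' n : ℕ, residueClass (1 : ZMod q) n / (n : ℝ) ^ x =
      (LFunctionResidueClassAux (1 : ZMod q) x).re + (q.totient : ℝ)⁻¹ / (x - 1) := by
    intro x hx
    refine Complex.ofReal_injective ?_
    simp only [Complex.ofReal_tsum, Complex.ofReal_div, Complex.ofReal_cpow (Nat.cast_nonneg _),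
      Complex.ofReal_natCast, Complex.ofReal_add, Complex.ofReal_inv, Complex.ofReal_sub,
      Complex.ofReal_one]
    simp_rw [← LFunctionResidueClassAux_real ha hx,
      eqOn_LFunctionResidueClassAux ha <| Set.mem_ofPred.mpr (Complex.ofReal_re x ▸ hx),
      sub_add_cancel, LSeries, LSeries.term]
    refine tsum_congr fun n => ?_
    split_ifs with hn
    · simp only [hn, residueClass_apply_zero, Complex.ofReal_zero, zero_div]
    · rfl
  have hsumR : ∀ x : ℝ, 1 < x →
      Summable fun n : ℕ => residueClass (1 : ZMod q) n / (n : ℝ) ^ x := by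
    intro x hx
    have h1 := LSeriesSummable_of_abscissaOfAbsConv_lt_re (s := (x : ℂ))
      (lt_of_le_of_lt (abscissaOfAbsConv_residueClass_le_one (1 : ZMod q))
        (by rw [Complex.ofReal_re]; exact_mod_cast hx))
    refine (summable_congr fun n => ?_).1 h1.norm
    rw [LSeries.norm_term_eq]
    split_ifs with hn
    · simp only [hn, residueClass_apply_zero, zero_div]
    · simp [abs_of_nonneg (residueClass_nonneg (1 : ZMod q) n)]
  have hsplit : ∀ n : ℕ, residueClass (1 : ZMod q) n = primeInd q n * Real.log n +
      if n.Prime then 0 else residueClass (1 : ZMod q) n := by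
    intro n
    unfold primeInd
    have hmem : n ∈ {n : ℕ | (n : ZMod q) = 1} ↔ n % q = 1 % q := by
      rw [Set.mem_ofPred_eq, ← ZMod.natCast_eq_natCast_iff', Nat.cast_one]
    by_cases hp : n.Prime
    · rw [if_pos hp, add_zero]
      by_cases h1 : n % q = 1 % q
      · rw [if_pos ⟨hp, h1⟩, residueClass, Set.indicator_of_mem (hmem.2 h1),
          vonMangoldt_apply_prime hp, one_mul]
      · rw [if_neg fun h => h1 h.2, residueClass, Set.indicator_of_notMem fun h => h1 (hmem.1 h),
          zero_mul]
    · rw [if_neg hp, if_neg fun h => hp h.1, zero_mul, zero_add]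
  have hN := summable_residueClass_non_primes_div (1 : ZMod q)
  have hN0 : ∀ n : ℕ, 0 ≤ if n.Prime then 0 else residueClass (1 : ZMod q) n := by
    intro n
    split_ifs
    · rfl
    · exact residueClass_nonneg _ n
  have hle : ∀ s : ℝ, 1 < s → ∀ n : ℕ,
      (if n.Prime then 0 else residueClass (1 : ZMod q) n) / (n : ℝ) ^ s ≤
        (if n.Prime then 0 else residueClass (1 : ZMod q) n) / n := by
    intro s hs n
    rcases Nat.eq_zero_or_pos n with rfl | hn
    · simp
    · refine div_le_div_of_nonneg_left (hN0 n) (by positivity) ?_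
      calc (n : ℝ) = (n : ℝ) ^ (1 : ℝ) := (Real.rpow_one _).symm
        _ ≤ (n : ℝ) ^ s := Real.rpow_le_rpow_of_exponent_le (by exact_mod_cast hn) hs.le
  refine ⟨|C| + ∑' n : ℕ, (if n.Prime then 0 else residueClass (1 : ZMod q) n) / n,
    add_nonneg (abs_nonneg C) (tsum_nonneg fun n => div_nonneg (hN0 n) n.cast_nonneg),
    fun s hs => ?_⟩
  have hNs : Summable fun n : ℕ =>
      (if n.Prime then 0 else residueClass (1 : ZMod q) n) / (n : ℝ) ^ s :=
    Summable.of_nonneg_of_le (fun n => div_nonneg (hN0 n) (by positivity)) (hle s hs.1) hN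
  have heq : (fun n : ℕ => primeInd q n * Real.log n / (n : ℝ) ^ s) =
      fun n : ℕ => residueClass (1 : ZMod q) n / (n : ℝ) ^ s -
        (if n.Prime then 0 else residueClass (1 : ZMod q) n) / (n : ℝ) ^ s := by
    funext n
    rw [← sub_div]
    congr 1
    linarith [hsplit n]
  refine ⟨by rw [heq]; exact (hsumR s hs.1).sub hNs, ?_⟩
  rw [heq, (hsumR s hs.1).tsum_sub hNs, H s hs.1]
  have h1 := hC s (Set.Ioc_subset_Icc_self hs)
  have h2 := hNs.tsum_le_tsum (hle s hs.1) hN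
  have h3 : 0 ≤ ∑' n : ℕ, (if n.Prime then 0 else residueClass (1 : ZMod q) n) / (n : ℝ) ^ s :=
    tsum_nonneg fun n => div_nonneg (hN0 n) (by positivity)
  rw [Real.norm_eq_abs] at h1
  have h4 := abs_le.1 (h1.trans (le_abs_self C))
  rw [abs_le]
  constructor <;> linarith

theorem summable_primeInd_div (q : ℕ) {s : ℝ} (hs : 1 < s) :
    Summable fun n : ℕ => primeInd q n / (n : ℝ) ^ s := by
  refine Summable.of_nonneg_of_le (fun n => div_nonneg (primeInd_nonneg q n) (by positivity))
    (fun n => ?_) (Real.summable_one_div_nat_rpow.2 hs)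
  exact div_le_div_of_nonneg_right (primeInd_le_one q n) (by positivity)

theorem hasDerivAt_primeInd_div (q n : ℕ) (y : ℝ) :
    HasDerivAt (fun y : ℝ => primeInd q n / (n : ℝ) ^ y)
      (-(primeInd q n * Real.log n / (n : ℝ) ^ y)) y := by
  rcases Nat.lt_or_ge n 2 with h | h
  · simp only [primeInd_eq_zero_of_lt_two h, zero_div, zero_mul, neg_zero]
    exact hasDerivAt_const y 0
  · have hn : (0 : ℝ) < n := by exact_mod_cast (show 0 < n by omega)
    have h1 : HasDerivAt (fun y : ℝ => primeInd q n * (n : ℝ) ^ (-y))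
        (primeInd q n * ((n : ℝ) ^ (-y) * Real.log n * (-1))) y := by
      refine HasDerivAt.const_mul _ ?_
      exact HasDerivAt.comp y (Real.hasStrictDerivAt_const_rpow hn (-y)).hasDerivAt
        (hasDerivAt_neg y)
    have h2 : (fun y : ℝ => primeInd q n * (n : ℝ) ^ (-y)) =
        fun y : ℝ => primeInd q n / (n : ℝ) ^ y := by
      funext y
      rw [Real.rpow_neg hn.le, div_eq_mul_inv]
    rw [h2] at h1
    refine h1.congr_deriv ?_
    rw [Real.rpow_neg hn.le]
    ring

theorem norm_primeInd_log_div_le (q n : ℕ) {t y : ℝ} (h : t ≤ y) :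
    ‖-(primeInd q n * Real.log n / (n : ℝ) ^ y)‖ ≤ primeInd q n * Real.log n / (n : ℝ) ^ t := by
  rcases Nat.lt_or_ge n 2 with h2 | h2
  · simp [primeInd_eq_zero_of_lt_two h2]
  · have hn : (1 : ℝ) ≤ n := by exact_mod_cast (show 1 ≤ n by omega)
    have h0 := mul_nonneg (primeInd_nonneg q n) (Real.log_nonneg hn)
    rw [norm_neg, Real.norm_of_nonneg (div_nonneg h0 (by positivity))]
    exact div_le_div_of_nonneg_left h0 (by positivity) (Real.rpow_le_rpow_of_exponent_le hn h)

theorem exists_abs_tsum_primeInd_sub_le (q : ℕ) (hq : q ≠ 0) :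
    ∃ C : ℝ, ∀ s ∈ Set.Ioc (1 : ℝ) 2,
      |∑' n : ℕ, primeInd q n / (n : ℝ) ^ s + (q.totient : ℝ)⁻¹ * Real.log (s - 1)| ≤ C := by
  obtain ⟨C, hC0, hC⟩ := exists_abs_tsum_log_sub_le q hq
  set G : ℝ → ℝ := fun s => ∑' n : ℕ, primeInd q n / (n : ℝ) ^ s with hG
  have hderiv : ∀ s ∈ Set.Ioo (1 : ℝ) 2, HasDerivAt G
      (∑' n : ℕ, -(primeInd q n * Real.log n / (n : ℝ) ^ s)) s := by
    intro s hs
    obtain ⟨t, ht1, ht2⟩ := exists_between hs.1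
    refine hasDerivAt_tsum_of_isPreconnected (t := Set.Ioo t 2) (y₀ := s)
      (g := fun (n : ℕ) (y : ℝ) => primeInd q n / (n : ℝ) ^ y)
      (g' := fun (n : ℕ) (y : ℝ) => -(primeInd q n * Real.log n / (n : ℝ) ^ y))
      (u := fun n : ℕ => primeInd q n * Real.log n / (n : ℝ) ^ t)
      (hC t ⟨ht1, (ht2.trans hs.2).le⟩).1 isOpen_Ioo isPreconnected_Ioo ?_ ?_ ⟨ht2, hs.2⟩
      (summable_primeInd_div q hs.1) ⟨ht2, hs.2⟩
    · exact fun n y _ => hasDerivAt_primeInd_div q n y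
    · exact fun n y hy => norm_primeInd_log_div_le q n hy.1.le
  have hHd : ∀ s ∈ Set.Ioo (1 : ℝ) 2, HasDerivAt
      (fun s => G s + (q.totient : ℝ)⁻¹ * Real.log (s - 1))
      (∑' n : ℕ, -(primeInd q n * Real.log n / (n : ℝ) ^ s) +
        (q.totient : ℝ)⁻¹ * (1 / (s - 1))) s := by
    intro s hs
    refine (hderiv s hs).add (HasDerivAt.const_mul _ ?_)
    exact HasDerivAt.log ((hasDerivAt_id s).sub_const 1) (by have := hs.1; simp; linarith)
  have hbound : ∀ s ∈ Set.Ioo (1 : ℝ) 2, ∀ t ∈ Set.Ioo (1 : ℝ) 2,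
      |(G s + (q.totient : ℝ)⁻¹ * Real.log (s - 1)) -
        (G t + (q.totient : ℝ)⁻¹ * Real.log (t - 1))| ≤ C := by
    intro s hs t ht
    have := Convex.norm_image_sub_le_of_norm_hasDerivWithin_le (C := C)
      (fun x hx => (hHd x hx).hasDerivWithinAt) (fun x hx => ?_) (convex_Ioo (1 : ℝ) 2) ht hs
    · rw [Real.norm_eq_abs, Real.norm_eq_abs] at this
      refine this.trans ?_
      have h1 : |s - t| ≤ 1 := by
        rw [abs_le]
        constructor <;> linarith [hs.1, hs.2, ht.1, ht.2]
      nlinarith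
    · have := (hC x ⟨hx.1, hx.2.le⟩).2
      rw [tsum_neg, Real.norm_eq_abs, ← abs_neg]
      convert this using 2
      ring
  have hG2 : ∀ s ∈ Set.Ioc (1 : ℝ) 2, 0 ≤ G s := fun s _ =>
    tsum_nonneg fun n => div_nonneg (primeInd_nonneg q n) (by positivity)
  have hmono : G 2 ≤ G (3 / 2) := by
    refine (summable_primeInd_div q (by norm_num)).tsum_le_tsum (fun n => ?_)
      (summable_primeInd_div q (by norm_num))
    rcases Nat.lt_or_ge n 2 with h | h
    · simp [primeInd_eq_zero_of_lt_two h]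
    · have hn : (1 : ℝ) ≤ n := by exact_mod_cast (show 1 ≤ n by omega)
      exact div_le_div_of_nonneg_left (primeInd_nonneg q n) (by positivity)
        (Real.rpow_le_rpow_of_exponent_le hn (by norm_num))
  refine ⟨C + |G (3 / 2) + (q.totient : ℝ)⁻¹ * Real.log (3 / 2 - 1)| + G (3 / 2), fun s hs => ?_⟩
  have h32 := hG2 (3 / 2) ⟨by norm_num, by norm_num⟩
  rcases hs.2.eq_or_lt with rfl | h
  · have h1 : Real.log (2 - 1) = 0 := by norm_num
    rw [h1, mul_zero, add_zero]
    change |G 2| ≤ _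
    rw [abs_of_nonneg (hG2 2 ⟨by norm_num, le_rfl⟩)]
    have := abs_nonneg (G (3 / 2) + (q.totient : ℝ)⁻¹ * Real.log (3 / 2 - 1))
    linarith
  · have h1 := hbound s ⟨hs.1, h⟩ (3 / 2) ⟨by norm_num, by norm_num⟩
    have h2 := abs_add_le ((G s + (q.totient : ℝ)⁻¹ * Real.log (s - 1)) -
        (G (3 / 2) + (q.totient : ℝ)⁻¹ * Real.log (3 / 2 - 1)))
      (G (3 / 2) + (q.totient : ℝ)⁻¹ * Real.log (3 / 2 - 1))
    rw [sub_add_cancel] at h2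
    change |G s + _| ≤ _
    linarith

theorem one_le_log_of_three_le {n : ℕ} (hn : 3 ≤ n) : 1 ≤ Real.log n := by
  have h3 : (3 : ℝ) ≤ n := by exact_mod_cast hn
  rw [Real.le_log_iff_exp_le (by linarith)]
  have := Real.exp_one_lt_d9
  linarith

theorem rpow_one_add_inv {k : ℕ} (hk : 0 < k) (L : ℝ) :
    (k : ℝ) ^ (1 + L⁻¹) = k * Real.exp (Real.log k / L) := by
  have hk' : (0 : ℝ) < k := by exact_mod_cast hk
  rw [Real.rpow_add hk', Real.rpow_one, Real.rpow_def_of_pos hk', div_eq_mul_inv]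

/-- Mertens' theorem for the progression `1 (mod q)`. -/
theorem exists_abs_sum_primeInd_sub_le (q : ℕ) (hq : q ≠ 0) :
    ∃ C : ℝ, ∀ n : ℕ, 3 ≤ n →
      |∑ k ∈ Finset.Icc 1 n, primeInd q k / k - (q.totient : ℝ)⁻¹ * LL n| ≤ C := by
  obtain ⟨C₁, hC₁0, hC₁⟩ := exists_abs_tsum_log_sub_le q hq
  obtain ⟨C₂, hC₂⟩ := exists_abs_tsum_primeInd_sub_le q hq
  have hφ : (0 : ℝ) ≤ (q.totient : ℝ)⁻¹ := by positivity
  refine ⟨C₂ + Real.exp 1 * ((q.totient : ℝ)⁻¹ + C₁), fun n hn => ?_⟩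
  set L := Real.log n with hL
  have hL1 : 1 ≤ L := one_le_log_of_three_le hn
  have hL0 : 0 < L := by linarith
  have hs : 1 + L⁻¹ ∈ Set.Ioc (1 : ℝ) 2 :=
    ⟨by have := inv_pos.2 hL0; linarith, by have := inv_le_one_of_one_le₀ hL1; linarith⟩
  obtain ⟨hsum, hF⟩ := hC₁ _ hs
  have hG := hC₂ _ hs
  have hGs := summable_primeInd_div q hs.1
  set F := ∑' k : ℕ, primeInd q k * Real.log k / (k : ℝ) ^ (1 + L⁻¹) with hFdef
  set G := ∑' k : ℕ, primeInd q k / (k : ℝ) ^ (1 + L⁻¹) with hGdef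
  rw [add_sub_cancel_left, Real.log_inv] at hG
  rw [add_sub_cancel_left, div_inv_eq_mul] at hF
  have hFL : F / L ≤ (q.totient : ℝ)⁻¹ + C₁ := by
    rw [div_le_iff₀ hL0]
    have := (abs_le.1 hF).2
    nlinarith
  have hterm0 : ∀ k : ℕ, 0 ≤ primeInd q k * Real.log k / (k : ℝ) ^ (1 + L⁻¹) := fun k =>
    div_nonneg (mul_nonneg (primeInd_nonneg q k) (Real.log_natCast_nonneg k)) (by positivity)
  have hF0 : 0 ≤ F := tsum_nonneg hterm0
  have hlow : G ≤ ∑ k ∈ Finset.Icc 1 n, primeInd q k / k + F / L := by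
    have h1 : HasSum (fun k : ℕ => (if k ∈ Finset.Icc 1 n then primeInd q k / (k : ℝ) else 0) +
        primeInd q k * Real.log k / (k : ℝ) ^ (1 + L⁻¹) / L)
        (∑ k ∈ Finset.Icc 1 n, primeInd q k / (k : ℝ) + F / L) := by
      refine HasSum.add ?_ (hsum.hasSum.div_const L)
      have := hasSum_sum_of_ne_finset_zero (L := SummationFilter.unconditional ℕ) (s := Finset.Icc 1 n)
        (f := fun k : ℕ => if k ∈ Finset.Icc 1 n then primeInd q k / (k : ℝ) else 0)
        (fun k hk => if_neg hk)
      rwa [Finset.sum_ite_mem, Finset.inter_self] at this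
    refine hasSum_le (fun k => ?_) hGs.hasSum h1
    rcases Nat.eq_zero_or_pos k with rfl | hk
    · simp [primeInd_eq_zero_of_lt_two]
    have hk' : (0 : ℝ) < k := by exact_mod_cast hk
    have hd : 0 ≤ primeInd q k := primeInd_nonneg q k
    split_ifs with hmem
    · have h2 : primeInd q k / (k : ℝ) ^ (1 + L⁻¹) ≤ primeInd q k / k := by
        refine div_le_div_of_nonneg_left hd hk' ?_
        rw [rpow_one_add_inv hk]
        have := Real.one_le_exp (div_nonneg (Real.log_natCast_nonneg k) hL0.le)
        nlinarith
      have := div_nonneg (hterm0 k) hL0.le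
      linarith
    · rw [zero_add, div_right_comm]
      refine div_le_div_of_nonneg_right ?_ (by positivity)
      rw [le_div_iff₀ hL0]
      refine mul_le_mul_of_nonneg_left (Real.log_le_log (by positivity) ?_) hd
      rw [Finset.mem_Icc] at hmem
      exact_mod_cast (show n ≤ k by omega)
  have hup : ∑ k ∈ Finset.Icc 1 n, primeInd q k / k ≤ G + Real.exp 1 * (F / L) := by
    have h1 : ∀ k ∈ Finset.Icc 1 n, primeInd q k / (k : ℝ) ≤ primeInd q k / (k : ℝ) ^ (1 + L⁻¹) +
        Real.exp 1 * (primeInd q k * Real.log k / (k : ℝ) ^ (1 + L⁻¹) / L) := by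
      intro k hk
      rw [Finset.mem_Icc] at hk
      have hk' : (0 : ℝ) < k := by exact_mod_cast hk.1
      rw [rpow_one_add_inv hk.1]
      set u := Real.log k / L with hu
      have hu0 : 0 ≤ u := div_nonneg (Real.log_natCast_nonneg k) hL0.le
      have hu1 : u ≤ 1 := by
        rw [hu, div_le_one hL0]
        exact Real.log_le_log hk' (by exact_mod_cast hk.2)
      have h2 : primeInd q k / (k * Real.exp u) +
          Real.exp 1 * (primeInd q k * Real.log k / (k * Real.exp u) / L) =
          primeInd q k / k * ((1 + Real.exp 1 * u) / Real.exp u) := by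
        rw [hu]
        field_simp
      rw [h2]
      refine le_mul_of_one_le_right (div_nonneg (primeInd_nonneg q k) hk'.le) ?_
      rw [one_le_div (Real.exp_pos u)]
      have h3 : 1 - u ≤ Real.exp (-u) := by linarith [Real.add_one_le_exp (-u)]
      have h4 : Real.exp u * Real.exp (-u) = 1 := by rw [← Real.exp_add, add_neg_cancel, Real.exp_zero]
      have h5 : Real.exp u ≤ Real.exp 1 := Real.exp_le_exp.2 hu1
      nlinarith [Real.exp_pos u]
    refine (Finset.sum_le_sum h1).trans ?_
    rw [Finset.sum_add_distrib, ← Finset.mul_sum, ← Finset.sum_div]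
    have h2 : ∑ k ∈ Finset.Icc 1 n, primeInd q k / (k : ℝ) ^ (1 + L⁻¹) ≤ G :=
      hGs.sum_le_tsum _ fun k _ => div_nonneg (primeInd_nonneg q k) (by positivity)
    have h3 : ∑ k ∈ Finset.Icc 1 n, primeInd q k * Real.log k / (k : ℝ) ^ (1 + L⁻¹) ≤ F :=
      hsum.sum_le_tsum _ fun k _ => hterm0 k
    gcongr
  have hlog : Real.log L = LL n := rfl
  rw [hlog] at hG
  have hG' := abs_le.1 hG
  have he : 1 ≤ Real.exp 1 := Real.one_le_exp zero_le_one
  have h6 : F / L ≤ Real.exp 1 * ((q.totient : ℝ)⁻¹ + C₁) :=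
    hFL.trans (le_mul_of_one_le_left (by linarith) he)
  have h7 : Real.exp 1 * (F / L) ≤ Real.exp 1 * ((q.totient : ℝ)⁻¹ + C₁) := by gcongr
  rw [abs_le]
  constructor <;> linarith

/-! ### A probabilistic model for the small prime factors -/

/-- The weight of `S` when each `p ∈ P` is selected independently with probability `1 / p`. -/
def modelWeight (P S : Finset ℕ) : ℝ := (∏ p ∈ S, (p : ℝ)⁻¹) * ∏ p ∈ P \ S, (1 - (p : ℝ)⁻¹)

/-- The expectation of `F` over random subsets of `P` selecting each `p` with probability `1/p`. -/
def modelMean {E : Type*} [AddCommGroup E] [Module ℝ E] (P : Finset ℕ) (F : Finset ℕ → E) : E :=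
  ∑ S ∈ P.powerset, modelWeight P S • F S

/-- The average of `F` over the sets of those `p ∈ P` that divide `m`, for `1 ≤ m ≤ n`. -/
def divisorMean {E : Type*} [AddCommGroup E] [Module ℝ E] (P : Finset ℕ) (n : ℕ)
    (F : Finset ℕ → E) : E :=
  (n : ℝ)⁻¹ • ∑ m ∈ Finset.Icc 1 n, F (P.filter (· ∣ m))

/-- The indicator of `T ⊆ S`. -/
def subsetInd (T S : Finset ℕ) : ℝ := if T ⊆ S then 1 else 0

theorem modelWeight_nonneg {P S : Finset ℕ} (hP : ∀ p ∈ P, p.Prime) : 0 ≤ modelWeight P S := by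
  refine mul_nonneg (Finset.prod_nonneg fun p _ => by positivity)
    (Finset.prod_nonneg fun p hp => ?_)
  have h1 : (1 : ℝ) ≤ p := by exact_mod_cast (hP p (Finset.mem_sdiff.1 hp).1).one_le
  have := inv_le_one_of_one_le₀ h1
  linarith

theorem modelMean_prod (P : Finset ℕ) (c : ℕ → ℂ) :
    modelMean P (fun S => ∏ p ∈ S, c p) = ∏ p ∈ P, (1 + (p : ℂ)⁻¹ * (c p - 1)) := by
  have h : ∀ p ∈ P, (1 + (p : ℂ)⁻¹ * (c p - 1)) = (p : ℂ)⁻¹ * c p + (1 - (p : ℂ)⁻¹) :=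
    fun p _ => by ring
  rw [Finset.prod_congr rfl h, Finset.prod_add]
  refine Finset.sum_congr rfl fun S _ => ?_
  rw [Finset.prod_mul_distrib, modelWeight, Complex.real_smul]
  push_cast
  ring

theorem modelMean_prod_real (P : Finset ℕ) (c : ℕ → ℝ) :
    modelMean P (fun S => ∏ p ∈ S, c p) = ∏ p ∈ P, (1 + (p : ℝ)⁻¹ * (c p - 1)) := by
  have h : ∀ p ∈ P, (1 + (p : ℝ)⁻¹ * (c p - 1)) = (p : ℝ)⁻¹ * c p + (1 - (p : ℝ)⁻¹) :=
    fun p _ => by ring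
  rw [Finset.prod_congr rfl h, Finset.prod_add]
  refine Finset.sum_congr rfl fun S _ => ?_
  rw [Finset.prod_mul_distrib, modelWeight, smul_eq_mul]
  ring

theorem modelMean_indicator {P T : Finset ℕ} (hT : T ⊆ P) :
    modelMean P (subsetInd T) = ∏ p ∈ T, (p : ℝ)⁻¹ := by
  have h : ∏ p ∈ T, (p : ℝ)⁻¹ =
      ∏ p ∈ P, ((p : ℝ)⁻¹ + if p ∈ T then 0 else 1 - (p : ℝ)⁻¹) := by
    rw [← Finset.prod_subset hT]
    · exact Finset.prod_congr rfl fun p hp => by rw [if_pos hp, add_zero]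
    · intro p _ hp
      rw [if_neg hp]
      ring
  rw [h, Finset.prod_add]
  refine Finset.sum_congr rfl fun S _ => ?_
  rw [modelWeight, smul_eq_mul, mul_assoc]
  congr 1
  rw [subsetInd]
  split_ifs with hTS
  · rw [mul_one]
    refine Finset.prod_congr rfl fun p hp => ?_
    rw [if_neg fun h => (Finset.mem_sdiff.1 hp).2 (hTS h)]
  · rw [mul_zero, eq_comm, Finset.prod_eq_zero_iff]
    obtain ⟨p, hpT, hpS⟩ := Finset.not_subset.1 hTS
    exact ⟨p, Finset.mem_sdiff.2 ⟨hT hpT, hpS⟩, if_pos hpT⟩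

theorem divisorMean_indicator {P T : Finset ℕ} (hP : ∀ p ∈ P, p.Prime) (hT : T ⊆ P) (n : ℕ) :
    divisorMean P n (subsetInd T) =
      (n : ℝ)⁻¹ * (n / ∏ p ∈ T, p : ℕ) := by
  simp only [divisorMean, subsetInd]
  rw [smul_eq_mul, Finset.sum_boole, ← Nat.Ioc_filter_dvd_card_eq_div]
  congr 3
  ext m
  simp only [Finset.mem_filter, Finset.mem_Icc, Finset.mem_Ioc, Nat.succ_le_iff]
  refine and_congr_right fun _ => ⟨fun h => ?_, fun h p hp => ?_⟩
  · exact Finset.prod_primes_dvd m (fun p hp => (hP p (hT hp)).prime)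
      fun p hp => (Finset.mem_filter.1 (h hp)).2
  · exact Finset.mem_filter.2 ⟨hT hp, (Finset.dvd_prod_of_mem (fun p => p) hp).trans h⟩

theorem abs_divisorMean_sub_modelMean_indicator_le {P T : Finset ℕ} (hP : ∀ p ∈ P, p.Prime)
    (hT : T ⊆ P) {n : ℕ} (hn : 0 < n) :
    |divisorMean P n (subsetInd T) -
      modelMean P (subsetInd T)| ≤ (n : ℝ)⁻¹ := by
  rw [divisorMean_indicator hP hT, modelMean_indicator hT, Finset.prod_inv_distrib]
  have hn' : (0 : ℝ) < n := by exact_mod_cast hn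
  set d := ∏ p ∈ T, p with hd
  have hd0 : 0 < d := Finset.prod_pos fun p hp => (hP p (hT hp)).pos
  have hd0' : (0 : ℝ) < d := by exact_mod_cast hd0
  have hd' : ∏ p ∈ T, (p : ℝ) = d := by rw [hd]; push_cast; rfl
  rw [hd']
  have h1 : ((n / d : ℕ) : ℝ) ≤ (n : ℝ) / d := Nat.cast_div_le
  have h2 : (n : ℝ) / d < (n / d : ℕ) + 1 := by
    rw [div_lt_iff₀ hd0']
    have := Nat.lt_mul_div_succ n hd0
    rw [mul_comm]
    exact_mod_cast this
  have h3 : (n : ℝ)⁻¹ * (n / d : ℕ) - (d : ℝ)⁻¹ = (n : ℝ)⁻¹ * ((n / d : ℕ) - (n : ℝ) / d) := by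
    field_simp
  rw [h3, abs_mul, abs_of_pos (inv_pos.2 hn')]
  refine mul_le_of_le_one_right (inv_pos.2 hn').le ?_
  rw [abs_le]
  constructor <;> linarith

theorem divisorMean_sub_modelMean_sum {P : Finset ℕ} {n : ℕ} {ι : Type*} (s : Finset ι)
    (c : ι → ℝ) (F : ι → Finset ℕ → ℝ) :
    divisorMean P n (fun S => ∑ i ∈ s, c i * F i S) - modelMean P (fun S => ∑ i ∈ s, c i * F i S) =
      ∑ i ∈ s, c i * (divisorMean P n (F i) - modelMean P (F i)) := by
  simp only [divisorMean, modelMean, smul_eq_mul, mul_sub, Finset.sum_sub_distrib]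
  congr 1
  · rw [Finset.sum_comm, Finset.mul_sum]
    refine Finset.sum_congr rfl fun i _ => ?_
    rw [← Finset.mul_sum]
    ring
  · simp_rw [Finset.mul_sum]
    rw [Finset.sum_comm]
    exact Finset.sum_congr rfl fun i _ => Finset.sum_congr rfl fun S _ => by ring

theorem abs_moment_sub_le {P : Finset ℕ} (hP : ∀ p ∈ P, p.Prime) {h : ℕ → ℝ}
    (hh : ∀ p, |h p| ≤ 1) (A : ℝ) {n : ℕ} (hn : 0 < n) (j : ℕ) : ∀ T ⊆ P,
    |divisorMean P n (fun S => subsetInd T S * (∑ p ∈ P ∩ S, h p - A) ^ j) -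
      modelMean P (fun S => subsetInd T S * (∑ p ∈ P ∩ S, h p - A) ^ j)| ≤
      (P.card + |A|) ^ j / n := by
  induction j with
  | zero =>
    intro T hT
    simpa only [pow_zero, mul_one, one_div] using abs_divisorMean_sub_modelMean_indicator_le hP hT hn
  | succ j ih =>
    intro T hT
    have key : (fun S : Finset ℕ =>
        subsetInd T S * (∑ p ∈ P ∩ S, h p - A) ^ (j + 1)) =
        fun S => ∑ o ∈ Finset.insertNone P, (o.elim (-A) h) *
          (subsetInd (o.elim T fun p => insert p T) S *
            (∑ p ∈ P ∩ S, h p - A) ^ j) := by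
      funext S
      rw [Finset.sum_insertNone]
      simp only [Option.elim_none, Option.elim_some]
      have h1 : ∑ p ∈ P, h p * (subsetInd (insert p T) S *
          (∑ p ∈ P ∩ S, h p - A) ^ j) =
          subsetInd T S * (∑ p ∈ P ∩ S, h p) * (∑ p ∈ P ∩ S, h p - A) ^ j := by
        simp_rw [← mul_assoc]
        rw [← Finset.sum_mul]
        congr 1
        rw [← Finset.filter_mem_eq_inter, Finset.sum_filter, Finset.mul_sum]
        refine Finset.sum_congr rfl fun p _ => ?_
        simp only [subsetInd, Finset.insert_subset_iff]
        by_cases hpS : p ∈ S <;> by_cases hTS : T ⊆ S <;> simp [hpS, hTS]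
      rw [h1]
      ring
    rw [key, divisorMean_sub_modelMean_sum]
    refine (Finset.abs_sum_le_sum_abs _ _).trans ?_
    have h2 : ∀ o ∈ Finset.insertNone P, |(o.elim (-A) h) *
        (divisorMean P n (fun S => subsetInd (o.elim T fun p => insert p T) S *
            (∑ p ∈ P ∩ S, h p - A) ^ j) -
          modelMean P (fun S => subsetInd (o.elim T fun p => insert p T) S *
            (∑ p ∈ P ∩ S, h p - A) ^ j))| ≤ (o.elim |A| fun _ => 1) * ((P.card + |A|) ^ j / n) := by
      intro o ho
      rw [abs_mul]
      have hb : 0 ≤ ((P.card : ℝ) + |A|) ^ j / n := by positivity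
      rcases o with _ | p
      · simp only [Option.elim_none, abs_neg]
        exact mul_le_mul_of_nonneg_left (ih T hT) (abs_nonneg A)
      · simp only [Option.elim_some]
        exact mul_le_mul (hh p) (ih _ (Finset.insert_subset (by simpa using ho) hT))
          (abs_nonneg _) zero_le_one
    refine (Finset.sum_le_sum h2).trans (le_of_eq ?_)
    rw [← Finset.sum_mul, Finset.sum_insertNone]
    simp only [Option.elim_none, Option.elim_some, Finset.sum_const, nsmul_eq_mul, mul_one]
    ring

theorem divisorMean_sub_modelMean_sum_ofReal {P : Finset ℕ} {n : ℕ} {ι : Type*} (s : Finset ι)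
    (c : ι → ℂ) (F : ι → Finset ℕ → ℝ) :
    divisorMean P n (fun S => ∑ i ∈ s, c i * (F i S : ℂ)) -
        modelMean P (fun S => ∑ i ∈ s, c i * (F i S : ℂ)) =
      ∑ i ∈ s, c i * ((divisorMean P n (F i) - modelMean P (F i) : ℝ) : ℂ) := by
  simp only [divisorMean, modelMean, smul_eq_mul, Complex.real_smul, Complex.ofReal_sub,
    Complex.ofReal_mul, Complex.ofReal_sum, mul_sub, Finset.sum_sub_distrib]
  congr 1
  · rw [Finset.sum_comm, Finset.mul_sum]
    refine Finset.sum_congr rfl fun i _ => ?_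
    rw [← Finset.mul_sum]
    ring
  · simp_rw [Finset.mul_sum]
    rw [Finset.sum_comm]
    exact Finset.sum_congr rfl fun i _ => Finset.sum_congr rfl fun S _ => by ring

theorem modelMean_congr {E : Type*} [AddCommGroup E] [Module ℝ E] {P : Finset ℕ}
    {F G : Finset ℕ → E} (h : ∀ S ⊆ P, F S = G S) : modelMean P F = modelMean P G :=
  Finset.sum_congr rfl fun S hS => by rw [h S (Finset.mem_powerset.1 hS)]

theorem modelMean_mono {P : Finset ℕ} (hP : ∀ p ∈ P, p.Prime) {F G : Finset ℕ → ℝ}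
    (h : ∀ S, F S ≤ G S) : modelMean P F ≤ modelMean P G :=
  Finset.sum_le_sum fun S _ => mul_le_mul_of_nonneg_left (h S) (modelWeight_nonneg hP)

theorem modelMean_const_mul {P : Finset ℕ} (c : ℝ) (F : Finset ℕ → ℝ) :
    modelMean P (fun S => c * F S) = c * modelMean P F := by
  simp only [modelMean, smul_eq_mul, Finset.mul_sum]
  exact Finset.sum_congr rfl fun S _ => by ring

theorem modelMean_add {P : Finset ℕ} (F G : Finset ℕ → ℝ) :
    modelMean P (fun S => F S + G S) = modelMean P F + modelMean P G := by
  simp only [modelMean, smul_add, Finset.sum_add_distrib]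

theorem norm_modelMean_sub_le {P : Finset ℕ} (hP : ∀ p ∈ P, p.Prime) {F G : Finset ℕ → ℂ}
    {H : Finset ℕ → ℝ} (h : ∀ S, ‖F S - G S‖ ≤ H S) :
    ‖modelMean P F - modelMean P G‖ ≤ modelMean P H := by
  rw [modelMean, modelMean, ← Finset.sum_sub_distrib]
  refine norm_sum_le_of_le _ fun S _ => ?_
  rw [← smul_sub, norm_smul, Real.norm_of_nonneg (modelWeight_nonneg hP), smul_eq_mul]
  exact mul_le_mul_of_nonneg_left (h S) (modelWeight_nonneg hP)

theorem norm_divisorMean_sub_le {P : Finset ℕ} {n : ℕ} {F G : Finset ℕ → ℂ}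
    {H : Finset ℕ → ℝ} (h : ∀ S, ‖F S - G S‖ ≤ H S) :
    ‖divisorMean P n F - divisorMean P n G‖ ≤ divisorMean P n H := by
  rw [divisorMean, divisorMean, divisorMean, ← smul_sub, ← Finset.sum_sub_distrib, norm_smul,
    Real.norm_of_nonneg (by positivity), smul_eq_mul]
  exact mul_le_mul_of_nonneg_left (norm_sum_le_of_le _ fun S _ => h _) (by positivity)

theorem Complex.norm_exp_mul_I_sub_sum_le (n : ℕ) (y : ℝ) : ∀ s : ℝ, 0 ≤ s →
    ‖Complex.exp (s * y * Complex.I) - ∑ j ∈ Finset.range n, (s * y * Complex.I) ^ j / j.factorial‖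
      ≤ (s * |y|) ^ n / n.factorial := by
  induction n with
  | zero =>
    intro s _
    have := Complex.norm_exp_ofReal_mul_I (s * y)
    push_cast at this
    simp [this]
  | succ n ih =>
    intro s hs
    have hd : ∀ t : ℝ, HasDerivAt (fun t : ℝ => Complex.exp (t * y * Complex.I) -
        ∑ j ∈ Finset.range (n + 1), (t * y * Complex.I) ^ j / j.factorial)
        ((y * Complex.I) * (Complex.exp (t * y * Complex.I) -
          ∑ j ∈ Finset.range n, (t * y * Complex.I) ^ j / j.factorial)) t := by
      intro t
      have h0 : HasDerivAt (fun t : ℝ => (t : ℂ) * y * Complex.I) (y * Complex.I) t := by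
        have := ((Complex.ofRealCLM.hasDerivAt (x := t)).mul_const ((y : ℂ) * Complex.I))
        simpa [mul_assoc] using this
      have h1 := h0.cexp
      have h2 : ∀ j ∈ Finset.range n,
          HasDerivAt (fun t : ℝ => (t * y * Complex.I : ℂ) ^ (j + 1) / ((j + 1).factorial : ℂ))
          ((y * Complex.I) * ((t * y * Complex.I : ℂ) ^ j / (j.factorial : ℂ))) t := by
        intro j _
        convert! (h0.pow (j + 1)).div_const ((j + 1).factorial : ℂ) using 1
        rw [Nat.factorial_succ, Nat.add_sub_cancel]
        have h3 : (j.factorial : ℂ) ≠ 0 := by exact_mod_cast j.factorial_ne_zero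
        have h4 : ((j : ℂ) + 1) ≠ 0 := by exact_mod_cast j.succ_ne_zero
        push_cast
        field_simp
      have h3 := h1.sub (HasDerivAt.fun_sum h2)
      have h4 := h3.sub_const (1 : ℂ)
      convert! h4 using 1
      · funext t
        rw [Finset.sum_range_succ']
        simp
        ring
      · rw [mul_sub, Finset.mul_sum]
        ring
    have hB : ∀ t : ℝ, HasDerivAt (fun t : ℝ => (t * |y|) ^ (n + 1) / (n + 1).factorial)
        (|y| * ((t * |y|) ^ n / n.factorial)) t := by
      intro t
      have h0 : HasDerivAt (fun t : ℝ => t * |y|) |y| t := by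
        simpa using (hasDerivAt_id t).mul_const |y|
      convert! (h0.pow (n + 1)).div_const ((n + 1).factorial : ℝ) using 1
      rw [Nat.factorial_succ, Nat.add_sub_cancel]
      have h3 : (n.factorial : ℝ) ≠ 0 := by exact_mod_cast n.factorial_ne_zero
      push_cast
      field_simp
    refine image_norm_le_of_norm_deriv_right_le_deriv_boundary (a := 0) (b := s)
      (fun t _ => (hd t).continuousAt.continuousWithinAt)
      (fun t _ => (hd t).hasDerivWithinAt) ?_ hB ?_ ⟨hs, le_rfl⟩
    · rw [Finset.sum_range_succ']
      simp
    · intro t ht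
      rw [norm_mul, norm_mul, Complex.norm_I, mul_one, Complex.norm_real, Real.norm_eq_abs]
      exact mul_le_mul_of_nonneg_left (ih t ht.1) (abs_nonneg y)

theorem Real.pow_div_factorial_le_exp_add_exp (y : ℝ) (K : ℕ) :
    y ^ (2 * K) / (2 * K).factorial ≤ (4 : ℝ)⁻¹ ^ K * (Real.exp (2 * y) + Real.exp (-(2 * y))) := by
  have h := (Real.hasSum_cosh (2 * y))
  have h1 : (2 * y) ^ (2 * K) / (2 * K).factorial ≤ Real.cosh (2 * y) := by
    refine le_hasSum h K fun j _ => ?_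
    rw [pow_mul]
    positivity
  rw [Real.cosh_eq, mul_pow, pow_mul 2] at h1
  have h2 : y ^ (2 * K) / (2 * K).factorial =
      (4 : ℝ)⁻¹ ^ K * ((2 ^ 2) ^ K * y ^ (2 * K) / (2 * K).factorial) := by
    rw [mul_div_assoc, ← mul_assoc, ← mul_pow]
    norm_num
  rw [h2]
  refine mul_le_mul_of_nonneg_left (h1.trans ?_) (by positivity)
  have := Real.exp_pos (2 * y)
  have := Real.exp_pos (-(2 * y))
  linarith

/-- The centred additive function determined by `h` on the subsets of `P`. -/
def centredSum (P : Finset ℕ) (h : ℕ → ℝ) (S : Finset ℕ) : ℝ :=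
  ∑ p ∈ P ∩ S, h p - ∑ p ∈ P, h p / p

theorem modelMean_exp_centredSum_le {P : Finset ℕ} (hP : ∀ p ∈ P, p.Prime) {h : ℕ → ℝ}
    (hh : ∀ p, |h p| ≤ 1) {s : ℝ} (hs : |s| ≤ 1) :
    modelMean P (fun S => Real.exp (s * centredSum P h S)) ≤
      Real.exp (s ^ 2 * ∑ p ∈ P, h p ^ 2 / p) := by
  have h1 : modelMean P (fun S => Real.exp (s * centredSum P h S)) =
      Real.exp (-(s * ∑ p ∈ P, h p / p)) * modelMean P (fun S => ∏ p ∈ S, Real.exp (s * h p)) := by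
    rw [← modelMean_const_mul]
    refine modelMean_congr fun S hS => ?_
    rw [centredSum, Finset.inter_eq_right.2 hS, ← Real.exp_sum, ← Real.exp_add, ← Finset.mul_sum]
    ring_nf
  rw [h1, modelMean_prod_real]
  have h2 : ∏ p ∈ P, (1 + (p : ℝ)⁻¹ * (Real.exp (s * h p) - 1)) ≤
      ∏ p ∈ P, Real.exp (s * (h p / p) + s ^ 2 * (h p ^ 2 / p)) := by
    refine Finset.prod_le_prod (fun p hp => ?_) fun p hp => ?_
    · have h1 : (1 : ℝ) ≤ p := by exact_mod_cast (hP p hp).one_le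
      have h2 := inv_le_one_of_one_le₀ h1
      have h3 : (0 : ℝ) ≤ (p : ℝ)⁻¹ := by positivity
      have h4 := mul_nonneg h3 (Real.exp_pos (s * h p)).le
      linarith
    · have h3 : (0 : ℝ) ≤ (p : ℝ)⁻¹ := by positivity
      have h4 : |s * h p| ≤ 1 := by
        rw [abs_mul]
        exact mul_le_one₀ hs (abs_nonneg _) (hh p)
      have h5 := (abs_le.1 (Real.abs_exp_sub_one_sub_id_le h4)).2
      have h6 : Real.exp (s * h p) - 1 ≤ s * h p + (s * h p) ^ 2 := by linarith
      have h7 := mul_le_mul_of_nonneg_left h6 h3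
      have h8 := Real.add_one_le_exp (s * (h p / p) + s ^ 2 * (h p ^ 2 / p))
      refine le_trans ?_ h8
      have h9 : (p : ℝ)⁻¹ * (s * h p + (s * h p) ^ 2) =
        s * (h p / p) + s ^ 2 * (h p ^ 2 / p) := by ring
      linarith
  refine (mul_le_mul_of_nonneg_left h2 (Real.exp_pos _).le).trans (le_of_eq ?_)
  rw [← Real.exp_sum, ← Real.exp_add, Finset.sum_add_distrib, ← Finset.mul_sum, ← Finset.mul_sum]
  ring_nf

theorem norm_prod_sub_prod_le_sum {ι : Type*} (s : Finset ι) {a b : ι → ℂ}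
    (ha : ∀ i ∈ s, ‖a i‖ ≤ 1) (hb : ∀ i ∈ s, ‖b i‖ ≤ 1) :
    ‖∏ i ∈ s, a i - ∏ i ∈ s, b i‖ ≤ ∑ i ∈ s, ‖a i - b i‖ := by
  classical
  induction s using Finset.induction_on with
  | empty => simp
  | insert i s hi ih =>
    rw [Finset.prod_insert hi, Finset.prod_insert hi, Finset.sum_insert hi]
    have h1 : ‖∏ j ∈ s, b j‖ ≤ 1 := by
      rw [norm_prod]
      exact Finset.prod_le_one (fun _ _ => norm_nonneg _)
        fun j hj => hb j (Finset.mem_insert_of_mem hj)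
    have h2 := ih (fun j hj => ha j (Finset.mem_insert_of_mem hj))
      fun j hj => hb j (Finset.mem_insert_of_mem hj)
    have h3 : a i * ∏ j ∈ s, a j - b i * ∏ j ∈ s, b j =
        (a i - b i) * ∏ j ∈ s, b j + a i * (∏ j ∈ s, a j - ∏ j ∈ s, b j) := by ring
    rw [h3]
    refine (norm_add_le _ _).trans (add_le_add ?_ ?_)
    · rw [norm_mul]
      exact mul_le_of_le_one_right (norm_nonneg _) h1
    · rw [norm_mul]
      exact (mul_le_of_le_one_left (norm_nonneg _) (ha i (Finset.mem_insert_self i s))).trans h2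

theorem norm_bernoulli_charFun_le {r : ℝ} (hr0 : 0 ≤ r) (hr : r ≤ 1) (x : ℝ) :
    ‖(1 + r * (Complex.exp (x * Complex.I) - 1) : ℂ)‖ ≤ 1 := by
  have h : (1 + r * (Complex.exp (x * Complex.I) - 1) : ℂ) =
    ((1 - r : ℝ) : ℂ) + r * Complex.exp (x * Complex.I) := by push_cast; ring
  rw [h]
  refine (norm_add_le _ _).trans ?_
  rw [norm_mul, Complex.norm_exp_ofReal_mul_I, Complex.norm_real, Complex.norm_real,
    Real.norm_of_nonneg hr0, Real.norm_of_nonneg (by linarith)]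
  linarith

theorem norm_bernoulli_charFun_sub_le {r x : ℝ} (hr0 : 0 ≤ r) (hr : r ≤ 1 / 2) (hx : |x| ≤ 1) :
    ‖Complex.exp (-(r * x * Complex.I)) * (1 + r * (Complex.exp (x * Complex.I) - 1)) -
      Complex.exp (-(r * x ^ 2 / 2))‖ ≤ r * |x| ^ 3 + 3 * (r ^ 2 * x ^ 2) := by
  set w : ℂ := r * x * Complex.I - r * x ^ 2 / 2 with hw
  have h1 : Complex.exp (-(r * x * Complex.I)) * (1 + r * (Complex.exp (x * Complex.I) - 1)) -
      Complex.exp (-(r * x ^ 2 / 2)) = Complex.exp (((-(r * x) : ℝ) : ℂ) * Complex.I) *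
        (r * (Complex.exp ((1 : ℝ) * x * Complex.I) -
            ∑ j ∈ Finset.range 3, ((1 : ℝ) * x * Complex.I) ^ j / j.factorial) -
          (Complex.exp w - 1 - w)) := by
    have h2 : Complex.exp (-(r * x ^ 2 / 2)) =
        Complex.exp (((-(r * x) : ℝ) : ℂ) * Complex.I) * Complex.exp w := by
      rw [← Complex.exp_add, hw]
      push_cast
      ring_nf
    have h3 : (-(r * x * Complex.I) : ℂ) = ((-(r * x) : ℝ) : ℂ) * Complex.I := by push_cast; ring
    rw [h2, h3, ← mul_sub]
    congr 1
    simp only [Finset.sum_range_succ, Finset.sum_range_zero, Nat.factorial, hw, mul_pow,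
      Complex.I_sq]
    push_cast
    ring_nf
  rw [h1, norm_mul, Complex.norm_exp_ofReal_mul_I, one_mul]
  have hxr : r * |x| ≤ 1 / 2 := by nlinarith [abs_nonneg x]
  have hwn : ‖w‖ ≤ 3 / 2 * (r * |x|) := by
    refine (norm_sub_le _ _).trans ?_
    have e1 : ‖(r * x * Complex.I : ℂ)‖ = r * |x| := by
      rw [norm_mul, norm_mul, Complex.norm_I, Complex.norm_real, Complex.norm_real,
        Real.norm_of_nonneg hr0, Real.norm_eq_abs, mul_one]
    have e2 : ‖(r * x ^ 2 / 2 : ℂ)‖ = r * |x| * |x| / 2 := by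
      rw [norm_div, norm_mul, norm_pow, Complex.norm_real, Complex.norm_real,
        Real.norm_of_nonneg hr0, Real.norm_eq_abs]
      norm_num
      rw [mul_assoc, abs_mul_abs_self]
      ring
    rw [e1, e2]
    have := mul_le_mul_of_nonneg_left hx (mul_nonneg hr0 (abs_nonneg x))
    linarith
  have hw1 : ‖w‖ ≤ 1 := by linarith
  have h5 := Complex.norm_exp_sub_one_sub_id_le hw1
  have h6 : ‖w‖ ^ 2 ≤ (3 / 2 * (r * |x|)) ^ 2 := pow_le_pow_left₀ (norm_nonneg _) hwn 2
  have h7 := Complex.norm_exp_mul_I_sub_sum_le 3 x 1 zero_le_one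
  refine (norm_sub_le _ _).trans ?_
  rw [norm_mul, Complex.norm_real, Real.norm_of_nonneg hr0]
  have h8 := mul_le_mul_of_nonneg_left h7 hr0
  have h9 : (3 / 2 * (r * |x|)) ^ 2 = 9 / 4 * (r ^ 2 * x ^ 2) := by
    rw [mul_pow, mul_pow, sq_abs]; ring
  have h10 : r * ((1 * |x|) ^ 3 / (Nat.factorial 3 : ℕ)) = r * |x| ^ 3 / 6 := by
    simp [Nat.factorial]; ring
  have h11 : 0 ≤ r * |x| ^ 3 := by positivity
  have h12 : 0 ≤ r ^ 2 * x ^ 2 := by positivity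
  linarith

theorem norm_modelMean_cexp_sub_le {P : Finset ℕ} (hP : ∀ p ∈ P, p.Prime) {h : ℕ → ℝ}
    (hh : ∀ p, |h p| ≤ 1) {u : ℝ} (hu : |u| ≤ 1) :
    ‖modelMean P (fun S => Complex.exp (u * centredSum P h S * Complex.I)) -
      Complex.exp (-(u ^ 2 * ∑ p ∈ P, h p ^ 2 / p : ℝ) / 2)‖ ≤
      |u| ^ 3 * ∑ p ∈ P, (p : ℝ)⁻¹ + 3 * (u ^ 2 * ∑ p ∈ P, ((p : ℝ)⁻¹) ^ 2) := by
  have h1 : modelMean P (fun S => Complex.exp (u * centredSum P h S * Complex.I)) =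
      ∏ p ∈ P, (Complex.exp (-(((p : ℝ)⁻¹ : ℝ) * (u * h p : ℝ) * Complex.I)) *
        (1 + ((p : ℝ)⁻¹ : ℝ) * (Complex.exp ((u * h p : ℝ) * Complex.I) - 1))) := by
    have e : ∀ p ∈ P, (1 + (((p : ℝ)⁻¹ : ℝ) : ℂ) *
          (Complex.exp ((u * h p : ℝ) * Complex.I) - 1)) =
        1 + (p : ℂ)⁻¹ * (Complex.exp ((u * h p : ℝ) * Complex.I) - 1) := fun p _ => by push_cast; rfl
    rw [Finset.prod_mul_distrib, Finset.prod_congr rfl e, ← modelMean_prod, ← Complex.exp_sum,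
      modelMean, modelMean, Finset.mul_sum]
    refine Finset.sum_congr rfl fun S hS => ?_
    rw [mul_smul_comm]
    congr 1
    rw [centredSum, Finset.inter_eq_right.2 (Finset.mem_powerset.1 hS), ← Complex.exp_sum,
      ← Complex.exp_add, ← Finset.sum_mul, Finset.sum_neg_distrib, ← Finset.sum_mul]
    push_cast
    rw [← Finset.mul_sum, mul_sub, Finset.mul_sum (s := P)]
    have e2 : ∀ p ∈ P, ((p : ℂ)⁻¹ * (u * h p)) = u * (h p / p) := fun p _ => by ring
    rw [Finset.sum_congr rfl e2]
    ring_nf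
  have h2 : Complex.exp (-(u ^ 2 * ∑ p ∈ P, h p ^ 2 / p : ℝ) / 2) =
      ∏ p ∈ P, Complex.exp (-(((p : ℝ)⁻¹ : ℝ) * (u * h p : ℝ) ^ 2 / 2)) := by
    rw [← Complex.exp_sum]
    congr 1
    push_cast
    rw [Finset.sum_neg_distrib, Finset.mul_sum, neg_div, Finset.sum_div]
    congr 1
    exact Finset.sum_congr rfl fun p _ => by ring
  have hr : ∀ p ∈ P, (p : ℝ)⁻¹ ≤ 1 / 2 := fun p hp => by
    rw [one_div]
    exact inv_anti₀ two_pos (by exact_mod_cast (hP p hp).two_le)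
  have hx : ∀ p, |u * h p| ≤ 1 := fun p => by
    rw [abs_mul]
    exact mul_le_one₀ hu (abs_nonneg _) (hh p)
  rw [h1, h2]
  refine (norm_prod_sub_prod_le_sum P (fun p hp => ?_) fun p hp => ?_).trans ?_
  · have e : -((((p : ℝ)⁻¹ : ℝ) : ℂ) * (u * h p : ℝ) * Complex.I) =
        ((-((p : ℝ)⁻¹ * (u * h p)) : ℝ) : ℂ) * Complex.I := by push_cast; ring
    rw [norm_mul, e, Complex.norm_exp_ofReal_mul_I, one_mul]
    exact norm_bernoulli_charFun_le (by positivity) ((hr p hp).trans (by norm_num)) _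
  · have e : -((((p : ℝ)⁻¹ : ℝ) : ℂ) * (u * h p : ℝ) ^ 2 / 2) =
        ((-((p : ℝ)⁻¹ * (u * h p) ^ 2 / 2) : ℝ) : ℂ) := by push_cast; ring
    rw [e, Complex.norm_exp_ofReal, Real.exp_le_one_iff]
    have : 0 ≤ (p : ℝ)⁻¹ * (u * h p) ^ 2 / 2 := by positivity
    linarith
  · rw [Finset.mul_sum, Finset.mul_sum, Finset.mul_sum, ← Finset.sum_add_distrib]
    refine Finset.sum_le_sum fun p hp => ?_
    refine (norm_bernoulli_charFun_sub_le (by positivity) (hr p hp) (hx p)).trans ?_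
    have e0 : (0 : ℝ) ≤ (p : ℝ)⁻¹ := by positivity
    have e1 : |u * h p| ≤ |u| := by
      rw [abs_mul]; exact mul_le_of_le_one_right (abs_nonneg _) (hh p)
    have e2 : |u * h p| ^ 3 ≤ |u| ^ 3 := pow_le_pow_left₀ (abs_nonneg _) e1 3
    have e3 : (u * h p) ^ 2 ≤ u ^ 2 := sq_le_sq.2 e1
    have e4 := mul_le_mul_of_nonneg_left e2 e0
    have e5 := mul_le_mul_of_nonneg_left e3 (sq_nonneg (p : ℝ)⁻¹)
    linarith

theorem abs_divisorMean_pow_sub_le {P : Finset ℕ} (hP : ∀ p ∈ P, p.Prime) (hne : P.Nonempty)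
    {h : ℕ → ℝ} (hh : ∀ p, |h p| ≤ 1) {n : ℕ} (hn : 0 < n) {j J : ℕ} (hj : j ≤ J) :
    |divisorMean P n (fun S => centredSum P h S ^ j) - modelMean P fun S => centredSum P h S ^ j| ≤
      (2 * P.card) ^ J / n := by
  have h1 := abs_moment_sub_le hP hh (∑ p ∈ P, h p / p) hn j ∅ (Finset.empty_subset P)
  simp only [subsetInd, Finset.empty_subset, if_true, one_mul] at h1
  refine h1.trans ?_
  have h2 : |∑ p ∈ P, h p / p| ≤ P.card := by
    refine (Finset.abs_sum_le_sum_abs _ _).trans ?_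
    rw [← nsmul_one]
    refine Finset.sum_le_card_nsmul _ _ _ fun p hp => ?_
    have h3 : (1 : ℝ) ≤ p := by exact_mod_cast (hP p hp).one_le
    rw [abs_div, Nat.abs_cast]
    exact (div_le_div_of_nonneg_right (hh p) (by positivity)).trans
      ((div_le_one (by positivity)).2 h3)
  have h4 : (1 : ℝ) ≤ P.card := by exact_mod_cast hne.card_pos
  refine div_le_div_of_nonneg_right ?_ (by positivity)
  exact (pow_le_pow_left₀ (by positivity) (by linarith) j).trans
    (pow_le_pow_right₀ (by linarith) hj)

theorem norm_divisorMean_cexp_sub_modelMean_le {P : Finset ℕ} (hP : ∀ p ∈ P, p.Prime)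
    (hne : P.Nonempty) {h : ℕ → ℝ} (hh : ∀ p, |h p| ≤ 1) {u : ℝ} (hu : |2 * u| ≤ 1) (K : ℕ)
    {n : ℕ} (hn : 0 < n) :
    ‖divisorMean P n (fun S => Complex.exp (u * centredSum P h S * Complex.I)) -
      modelMean P (fun S => Complex.exp (u * centredSum P h S * Complex.I))‖ ≤
      (2 * K + 1) * ((2 * P.card) ^ (2 * K) / n) +
        4 * ((4 : ℝ)⁻¹ ^ K * Real.exp (4 * u ^ 2 * ∑ p ∈ P, h p ^ 2 / p)) := by
  set F := centredSum P h with hF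
  set c : ℕ → ℂ := fun j => (u * Complex.I) ^ j / j.factorial with hc
  set T : Finset ℕ → ℂ := fun S => ∑ j ∈ Finset.range (2 * K), c j * ((F S ^ j : ℝ) : ℂ) with hT
  set H : Finset ℕ → ℝ := fun S => u ^ (2 * K) / (2 * K).factorial * F S ^ (2 * K) with hH
  set B : ℝ := (2 * P.card) ^ (2 * K) / n with hB
  have hB0 : 0 ≤ B := by positivity
  have hu1 : |u| ≤ 1 := by
    rw [abs_mul, abs_two] at hu
    have := abs_nonneg u
    linarith
  have hTH : ∀ S, ‖Complex.exp (u * F S * Complex.I) - T S‖ ≤ H S := by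
    intro S
    have h1 := Complex.norm_exp_mul_I_sub_sum_le (2 * K) (u * F S) 1 zero_le_one
    have h2 : (1 * |u * F S|) ^ (2 * K) / (2 * K).factorial = H S := by
      rw [one_mul, pow_mul, sq_abs, ← pow_mul, mul_pow, hH]
      ring
    rw [h2] at h1
    refine le_trans (le_of_eq ?_) h1
    congr 2
    · push_cast; ring_nf
    · rw [hT]
      refine Finset.sum_congr rfl fun j _ => ?_
      rw [hc]
      push_cast
      ring
  have hu2 : ∀ j : ℕ, |u| ^ j / j.factorial ≤ 1 := by
    intro j
    have h1 : (1 : ℝ) ≤ j.factorial := by exact_mod_cast Nat.one_le_iff_ne_zero.2 j.factorial_ne_zero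
    rw [div_le_one (by linarith)]
    exact (pow_le_one₀ (abs_nonneg _) hu1).trans h1
  have hMH : modelMean P H ≤
      2 * ((4 : ℝ)⁻¹ ^ K * Real.exp (4 * u ^ 2 * ∑ p ∈ P, h p ^ 2 / p)) := by
    have h1 : ∀ S, H S ≤ (4 : ℝ)⁻¹ ^ K *
        (Real.exp ((2 * u) * F S) + Real.exp ((-(2 * u)) * F S)) := by
      intro S
      have := Real.pow_div_factorial_le_exp_add_exp (u * F S) K
      have e : H S = (u * F S) ^ (2 * K) / (2 * K).factorial := by rw [hH, mul_pow]; ring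
      rw [e]
      convert this using 4 <;> ring
    refine (modelMean_mono hP h1).trans ?_
    rw [modelMean_const_mul, modelMean_add]
    have h2 := modelMean_exp_centredSum_le hP hh hu
    have h3 := modelMean_exp_centredSum_le hP hh (s := -(2 * u)) (by rwa [abs_neg])
    have e1 : (2 * u) ^ 2 = 4 * u ^ 2 := by ring
    rw [e1] at h2
    rw [neg_sq, e1] at h3
    have h4 : (0 : ℝ) ≤ (4 : ℝ)⁻¹ ^ K := by positivity
    have h5 := mul_le_mul_of_nonneg_left (add_le_add h2 h3) h4
    linarith
  have hDH : divisorMean P n H ≤ B + modelMean P H := by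
    have h1 := divisorMean_sub_modelMean_sum (P := P) (n := n) {()}
      (fun _ => u ^ (2 * K) / (2 * K).factorial) (fun _ S => F S ^ (2 * K))
    simp only [Finset.sum_singleton] at h1
    have h2 := abs_divisorMean_pow_sub_le hP hne hh hn (le_refl (2 * K))
    have h3 : |divisorMean P n H - modelMean P H| ≤ B := by
      rw [hH, h1, abs_mul, abs_div, abs_pow, Nat.abs_cast]
      exact (mul_le_of_le_one_left (abs_nonneg _) (hu2 _)).trans h2
    have := (abs_le.1 h3).2
    linarith
  have hDT : ‖divisorMean P n T - modelMean P T‖ ≤ 2 * K * B := by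
    rw [hT, divisorMean_sub_modelMean_sum_ofReal]
    have h1 : ∀ j ∈ Finset.range (2 * K), ‖c j * ((divisorMean P n (fun S => F S ^ j) -
        modelMean P (fun S => F S ^ j) : ℝ) : ℂ)‖ ≤ B := by
      intro j hj
      rw [norm_mul, Complex.norm_real, Real.norm_eq_abs]
      have h2 : ‖c j‖ ≤ 1 := by
        simp only [hc]
        rw [norm_div, norm_pow, norm_mul, Complex.norm_I, Complex.norm_real, mul_one,
          Complex.norm_natCast]
        exact hu2 j
      exact (mul_le_of_le_one_left (abs_nonneg _) h2).trans
        (abs_divisorMean_pow_sub_le hP hne hh hn (Finset.mem_range.1 hj).le)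
    refine (norm_sum_le_of_le _ h1).trans (le_of_eq ?_)
    rw [Finset.sum_const, Finset.card_range, nsmul_eq_mul]
    push_cast
    rfl
  have h1 := norm_divisorMean_sub_le (P := P) (n := n) hTH
  have h2 := norm_modelMean_sub_le hP hTH
  set X := divisorMean P n (fun S => Complex.exp (u * F S * Complex.I))
  set Y := modelMean P (fun S => Complex.exp (u * F S * Complex.I))
  have h3 : X - Y = (X - divisorMean P n T) + (divisorMean P n T - modelMean P T) -
    (Y - modelMean P T) := by ring
  rw [h3]
  refine (norm_sub_le _ _).trans ((add_le_add (norm_add_le _ _) le_rfl).trans ?_)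
  linarith

/-! ### The Erdős–Kac theorem -/

/-- The strongly additive function with values `h p` at the primes. -/
def addFun (h : ℕ → ℝ) (m : ℕ) : ℝ := ∑ p ∈ m.primeFactors, h p

/-- The sum of `h k / k` over `k ≤ n` is `a log log n + O(1)`. -/
def HasMertensMean (h : ℕ → ℝ) (a : ℝ) : Prop :=
  ∃ C, ∀ n : ℕ, 3 ≤ n → |∑ k ∈ Finset.Icc 1 n, h k / k - a * LL n| ≤ C

theorem tendsto_LL_atTop : Tendsto LL atTop atTop :=
  Real.tendsto_log_atTop.comp (Real.tendsto_log_atTop.comp tendsto_natCast_atTop_atTop)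

theorem exists_pow_le_lt_pow {N : ℕ} (hN : 0 < N) {n : ℕ} (hn : 3 ^ N ≤ n) :
    ∃ z : ℕ, 3 ≤ z ∧ z ^ N ≤ n ∧ n < z ^ (2 * N) := by
  have hself : ∀ k : ℕ, k ≤ k ^ N := fun k => Nat.le_self_pow hN.ne' k
  set z := Nat.findGreatest (fun z => z ^ N ≤ n) n with hz
  have h3 : 3 ≤ z := Nat.le_findGreatest ((hself 3).trans hn) hn
  have h1 : z ^ N ≤ n := Nat.findGreatest_spec (P := fun z => z ^ N ≤ n) ((hself 3).trans hn) hn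
  have h2 : n < (z + 1) ^ N := by
    rcases Nat.lt_or_ge n (z + 1) with h | h
    · exact h.trans_le (hself _)
    · exact not_le.1 (Nat.findGreatest_is_greatest (P := fun z => z ^ N ≤ n) (Nat.lt_succ_self z) h)
  refine ⟨z, h3, h1, h2.trans_le ?_⟩
  rw [pow_mul]
  exact Nat.pow_le_pow_left (by nlinarith) N

theorem abs_LL_sub_LL_le {z n M : ℕ} (hz : 3 ≤ z) (hzn : z ≤ n) (hM : 0 < M) (hn : n < z ^ M) :
    |LL z - LL n| ≤ Real.log M := by
  have h1 := one_le_log_of_three_le hz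
  have hz0 : (0 : ℝ) < z := by exact_mod_cast (by omega : 0 < z)
  have hn0 : (0 : ℝ) < n := by exact_mod_cast (by omega : 0 < n)
  have hM0 : (0 : ℝ) < M := by exact_mod_cast hM
  have h2 : Real.log z ≤ Real.log n := Real.log_le_log hz0 (by exact_mod_cast hzn)
  have h3 : Real.log n ≤ M * Real.log z := by
    rw [← Real.log_pow]
    exact Real.log_le_log hn0 (by exact_mod_cast hn.le)
  have h4 : LL z ≤ LL n := Real.log_le_log (by linarith) h2
  have h5 : LL n ≤ Real.log M + LL z := by
    rw [LL, LL, ← Real.log_mul hM0.ne' (by linarith)]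
    exact Real.log_le_log (by linarith) h3
  rw [abs_sub_comm, abs_of_nonneg (by linarith)]
  linarith

/-- The primes up to `z`. -/
def primesUpTo (z : ℕ) : Finset ℕ := (Finset.Icc 1 z).filter Nat.Prime

theorem prime_of_mem_primesUpTo {z : ℕ} : ∀ p ∈ primesUpTo z, p.Prime :=
  fun _ hp => (Finset.mem_filter.1 hp).2

theorem sum_primesUpTo {f : ℕ → ℝ} (hf : ∀ k, ¬ k.Prime → f k = 0) (z : ℕ) :
    ∑ p ∈ primesUpTo z, f p / p = ∑ k ∈ Finset.Icc 1 z, f k / k := by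
  rw [primesUpTo, Finset.sum_filter]
  refine Finset.sum_congr rfl fun k _ => ?_
  split_ifs with h
  · rfl
  · rw [hf k h, zero_div]

theorem card_primesUpTo_le (z : ℕ) : (primesUpTo z).card ≤ z :=
  (Finset.card_filter_le _ _).trans (by simp)

theorem abs_addFun_sub_le {h : ℕ → ℝ} (hh : ∀ p, |h p| ≤ 1) {m n z M : ℕ} (hm : 1 ≤ m) (hmn : m ≤ n)
    (hz : 1 ≤ z) (hn : n < z ^ M) :
    |addFun h m - ∑ p ∈ (primesUpTo z).filter (· ∣ m), h p| ≤ M := by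
  have h1 : (primesUpTo z).filter (· ∣ m) = m.primeFactors.filter (· ≤ z) := by
    ext p
    simp only [primesUpTo, Finset.mem_filter, Finset.mem_Icc, Nat.mem_primeFactors]
    constructor
    · rintro ⟨⟨⟨_, h2⟩, h3⟩, h4⟩
      exact ⟨⟨h3, h4, by omega⟩, h2⟩
    · rintro ⟨⟨h2, h3, _⟩, h4⟩
      exact ⟨⟨⟨h2.one_le, h4⟩, h2⟩, h3⟩
  have h2 : addFun h m - ∑ p ∈ (primesUpTo z).filter (· ∣ m), h p =
      ∑ p ∈ m.primeFactors.filter (¬ · ≤ z), h p := by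
    rw [h1, addFun, ← Finset.sum_filter_add_sum_filter_not m.primeFactors (· ≤ z)]
    ring
  have h3 : (m.primeFactors.filter (¬ · ≤ z)).card ≤ M := by
    refine not_lt.1 fun hlt => ?_
    have h4 : z ^ (m.primeFactors.filter (¬ · ≤ z)).card ≤ ∏ p ∈ m.primeFactors.filter (¬ · ≤ z), p :=
      Finset.pow_card_le_prod _ _ _ fun p hp => by
        have := (Finset.mem_filter.1 hp).2
        omega
    have h5 : ∏ p ∈ m.primeFactors.filter (¬ · ≤ z), p ≤ m :=
      Nat.le_of_dvd (by omega) ((Finset.prod_dvd_prod_of_subset _ _ _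
        (Finset.filter_subset _ _)).trans (Nat.prod_primeFactors_dvd m))
    have h6 := Nat.pow_le_pow_right hz hlt.le
    exact absurd (h6.trans (h4.trans (h5.trans hmn))) (not_le.2 hn)
  rw [h2]
  refine (Finset.abs_sum_le_sum_abs _ _).trans ?_
  refine (Finset.sum_le_card_nsmul _ _ 1 fun p _ => hh p).trans ?_
  rw [nsmul_one]
  exact_mod_cast h3

theorem norm_cexp_mul_I_sub_le (x y : ℝ) :
    ‖Complex.exp (x * Complex.I) - Complex.exp (y * Complex.I)‖ ≤ |x - y| := by
  have h : Complex.exp (x * Complex.I) - Complex.exp (y * Complex.I) =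
      Complex.exp (y * Complex.I) * (Complex.exp (Complex.I * (x - y : ℝ)) - 1) := by
    rw [mul_sub, ← Complex.exp_add, mul_one]
    push_cast
    ring_nf
  rw [h, norm_mul, Complex.norm_exp_ofReal_mul_I, one_mul]
  exact Real.norm_exp_I_mul_ofReal_sub_one_le

theorem cnt_eq_card (P : ℕ → Prop) [DecidablePred P] (n : ℕ) :
    cnt P n = ((Finset.Icc 1 n).filter P).card := by
  rw [cnt, ← Set.ncard_coe_finset]
  congr 1
  ext m
  simp [and_assoc]

open Classical in
theorem norm_sum_cexp_sub_le {f f' : ℕ → ℝ} {bad : ℕ → Prop} {C : ℝ} {n : ℕ} (hC : 0 ≤ C)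
    (h : ∀ m, 1 ≤ m → m ≤ n → ¬ bad m → |f m - f' m| ≤ C) :
    ‖(n : ℝ)⁻¹ • ∑ m ∈ Finset.Icc 1 n, Complex.exp (f m * Complex.I) -
      (n : ℝ)⁻¹ • ∑ m ∈ Finset.Icc 1 n, Complex.exp (f' m * Complex.I)‖ ≤
      C + 2 * ((cnt bad n : ℝ) / n) := by
  rw [← smul_sub, ← Finset.sum_sub_distrib, norm_smul, Real.norm_of_nonneg (by positivity),
    cnt_eq_card]
  have h1 : ∀ m ∈ Finset.Icc 1 n, ‖Complex.exp (f m * Complex.I) - Complex.exp (f' m * Complex.I)‖ ≤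
      C + 2 * if bad m then 1 else 0 := by
    intro m hm
    obtain ⟨hm1, hm2⟩ := Finset.mem_Icc.1 hm
    split_ifs with hb
    · refine (norm_sub_le _ _).trans ?_
      rw [Complex.norm_exp_ofReal_mul_I, Complex.norm_exp_ofReal_mul_I]
      linarith
    · have := (norm_cexp_mul_I_sub_le (f m) (f' m)).trans (h m hm1 hm2 hb)
      linarith
  have h2 := norm_sum_le_of_le _ h1
  rw [Finset.sum_add_distrib, ← Finset.mul_sum, Finset.sum_boole, Finset.sum_const, Nat.card_Icc,
    nsmul_eq_mul, Nat.add_sub_cancel] at h2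
  rcases Nat.eq_zero_or_pos n with rfl | hn
  · simpa using hC
  · have hn' : (0 : ℝ) < n := by exact_mod_cast hn
    calc (n : ℝ)⁻¹ * _ ≤ (n : ℝ)⁻¹ * _ := mul_le_mul_of_nonneg_left h2 (by positivity)
      _ = _ := by field_simp

theorem HasMertensMean.exists_abs_sub_le {h : ℕ → ℝ} {a : ℝ} (ha : HasMertensMean h a) {M : ℕ}
    (hM : 0 < M) : ∃ C, 0 ≤ C ∧ ∀ z n : ℕ, 3 ≤ z → z ≤ n → n < z ^ M →
      |∑ k ∈ Finset.Icc 1 z, h k / k - a * LL n| ≤ C := by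
  obtain ⟨C, hC⟩ := ha
  refine ⟨C + |a| * Real.log M, ?_, fun z n hz hzn hn => ?_⟩
  · have h1 := (abs_nonneg _).trans (hC 3 le_rfl)
    have h2 : 0 ≤ Real.log M := Real.log_natCast_nonneg M
    positivity
  · have h1 := hC z hz
    have h2 : |a * LL z - a * LL n| ≤ |a| * Real.log M := by
      rw [← mul_sub, abs_mul]
      exact mul_le_mul_of_nonneg_left (abs_LL_sub_LL_le hz hzn hM hn) (abs_nonneg a)
    exact (abs_sub_le _ (a * LL z) _).trans (add_le_add h1 h2)

theorem hasMertensMean_primeInd {q : ℕ} (hq : q ≠ 0) :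
    HasMertensMean (primeInd q) (q.totient : ℝ)⁻¹ :=
  exists_abs_sum_primeInd_sub_le q hq

theorem exists_sum_inv_sq_le : ∃ C : ℝ, 0 ≤ C ∧ ∀ P : Finset ℕ, ∑ p ∈ P, ((p : ℝ)⁻¹) ^ 2 ≤ C := by
  have h : Summable fun p : ℕ => ((p : ℝ)⁻¹) ^ 2 := by
    simp_rw [inv_pow]
    exact Real.summable_nat_pow_inv.2 one_lt_two
  exact ⟨_, tsum_nonneg fun p => by positivity,
    fun P => h.sum_le_tsum P fun p _ => by positivity⟩

theorem norm_ofReal_cexp_sub_le {x y : ℝ} (hx : x ≤ 0) (hy : y ≤ 0) :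
    ‖Complex.exp x - Complex.exp y‖ ≤ |x - y| := by
  rw [← Complex.ofReal_exp, ← Complex.ofReal_exp, ← Complex.ofReal_sub, Complex.norm_real,
    Real.norm_eq_abs]
  wlog hxy : x ≤ y generalizing x y
  · rw [abs_sub_comm, abs_sub_comm x]
    exact this hy hx (le_of_not_ge hxy)
  have h1 : Real.exp x ≤ Real.exp y := Real.exp_le_exp.2 hxy
  rw [abs_of_nonpos (by linarith), abs_of_nonpos (by linarith)]
  have h2 : Real.exp x = Real.exp y * Real.exp (x - y) := by rw [← Real.exp_add]; ring_nf
  have h3 := Real.add_one_le_exp (x - y)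
  have h4 : Real.exp y ≤ 1 := Real.exp_le_one_iff.2 hy
  have h5 := Real.exp_pos y
  nlinarith

theorem exists_norm_charMean_sub_le {h g : ℕ → ℝ} {a b C : ℝ} (hh : ∀ p, |h p| ≤ 1)
    (hsupp : ∀ k, ¬ k.Prime → h k = 0) (ha : HasMertensMean h a)
    (hb : HasMertensMean (fun k => h k ^ 2) b) (hb0 : 0 < b) (hC : 0 ≤ C) {K : ℕ} (hK : 0 < K) :
    ∃ D : ℝ, 0 ≤ D ∧ ∀ n : ℕ, 3 ^ (4 * K) ≤ n → ∀ u : ℝ, |2 * u| ≤ 1 →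
      ‖(n : ℝ)⁻¹ • ∑ m ∈ Finset.Icc 1 n, Complex.exp ((u * (g m - a * LL n) : ℝ) * Complex.I) -
        Complex.exp ((-(u ^ 2 * (b * LL n) / 2) : ℝ))‖ ≤
      |u| * D + 2 * ((cnt (fun m => C < |g m - addFun h m|) n : ℝ) / n) + D / Real.sqrt n +
        4 * ((4 : ℝ)⁻¹ ^ K * Real.exp (4 * u ^ 2 * (b * LL n + D))) +
        |u| ^ 3 * (LL n + D) + u ^ 2 * D := by
  obtain ⟨Da, hDa0, hDa⟩ := ha.exists_abs_sub_le (M := 2 * (4 * K)) (by omega)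
  obtain ⟨Db, hDb0, hDb⟩ := hb.exists_abs_sub_le (M := 2 * (4 * K)) (by omega)
  obtain ⟨Dc, hDc0, hDc⟩ :=
    (hasMertensMean_primeInd one_ne_zero).exists_abs_sub_le (M := 2 * (4 * K)) (by omega)
  obtain ⟨Ds, hDs0, hDs⟩ := exists_sum_inv_sq_le
  set D : ℝ := C + 8 * K + Da + Db + Dc + 3 * Ds + (2 * K + 1) * 4 ^ K with hD
  have hK0 : (0 : ℝ) ≤ K := by positivity
  have hK4 : (0 : ℝ) ≤ (2 * K + 1) * 4 ^ K := by positivity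
  have hD0 : 0 ≤ D := by linarith
  refine ⟨D, hD0, fun n hn u hu => ?_⟩
  obtain ⟨z, hz3, hzn, hnz⟩ := exists_pow_le_lt_pow (N := 4 * K) (by omega) hn
  have hzn' : z ≤ n := (Nat.le_self_pow (by omega) z).trans hzn
  have hn0 : 0 < n := by omega
  have hn0' : (0 : ℝ) < n := by exact_mod_cast hn0
  have hL : 0 ≤ LL n := by
    have := one_le_log_of_three_le (hz3.trans hzn')
    exact Real.log_nonneg this
  set P := primesUpTo z with hPdef
  have hP : ∀ p ∈ P, p.Prime := prime_of_mem_primesUpTo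
  have hne : P.Nonempty := ⟨2, by simp [hPdef, primesUpTo, Nat.prime_two]; omega⟩
  have hA := hDa z n hz3 hzn' hnz
  have hV := hDb z n hz3 hzn' hnz
  have hS := hDc z n hz3 hzn' hnz
  rw [← sum_primesUpTo hsupp] at hA
  rw [← sum_primesUpTo (fun k hk => by rw [hsupp k hk]; ring)] at hV
  have hS' : ∑ p ∈ P, (p : ℝ)⁻¹ ≤ LL n + D := by
    have e : ∑ p ∈ P, (p : ℝ)⁻¹ = ∑ p ∈ P, primeInd 1 p / p :=
      Finset.sum_congr rfl fun p hp => by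
        rw [primeInd, if_pos ⟨hP p hp, by simp [Nat.mod_one]⟩, one_div]
    rw [e, sum_primesUpTo fun k hk => by rw [primeInd, if_neg fun h => hk h.1]]
    have := (abs_le.1 hS).2
    rw [Nat.totient_one, Nat.cast_one, inv_one, one_mul] at this
    linarith
  set V := ∑ p ∈ P, h p ^ 2 / p with hVdef
  have hV0 : 0 ≤ V := Finset.sum_nonneg fun p _ => by positivity
  have hVL : V ≤ b * LL n + D := by
    have := (abs_le.1 hV).2
    linarith
  have hu1 : |u| ≤ 1 := by
    rw [abs_mul, abs_two] at hu
    have := abs_nonneg u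
    linarith
  have s1 := norm_sum_cexp_sub_le (n := n) (bad := fun m => C < |g m - addFun h m|)
    (f := fun m => u * (g m - a * LL n)) (f' := fun m => u * centredSum P h (P.filter (· ∣ m)))
    (C := |u| * (C + 8 * K + Da)) (by positivity) (fun m hm1 hm2 hgood => by
      rw [not_lt] at hgood
      rw [← mul_sub, abs_mul]
      refine mul_le_mul_of_nonneg_left ?_ (abs_nonneg u)
      have h1 := abs_addFun_sub_le hh hm1 hm2 (by omega) hnz
      rw [centredSum, Finset.inter_eq_right.2 (Finset.filter_subset _ _)]
      push_cast at h1
      rw [abs_le] at hgood h1 hA ⊢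
      constructor <;> linarith [hgood.1, hgood.2, h1.1, h1.2, hA.1, hA.2])
  have s2 := norm_divisorMean_cexp_sub_modelMean_le hP hne hh hu K hn0
  have s3 := norm_modelMean_cexp_sub_le hP hh hu1
  have s4 : ‖Complex.exp (-(u ^ 2 * V : ℝ) / 2) -
      Complex.exp ((-(u ^ 2 * (b * LL n) / 2) : ℝ))‖ ≤ u ^ 2 * Db := by
    have e : (-((u ^ 2 * V : ℝ) : ℂ) / 2) = ((-(u ^ 2 * V / 2) : ℝ) : ℂ) := by push_cast; ring
    rw [e]
    refine (norm_ofReal_cexp_sub_le (by rw [neg_nonpos]; positivity)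
      (by rw [neg_nonpos]; positivity)).trans ?_
    have e2 : -(u ^ 2 * V / 2) - -(u ^ 2 * (b * LL n) / 2) = -(u ^ 2 / 2) * (V - b * LL n) := by
      ring
    rw [e2, abs_mul, abs_neg, abs_of_nonneg (by positivity)]
    have := mul_le_mul_of_nonneg_left hV (by positivity : 0 ≤ u ^ 2 / 2)
    have h2 : 0 ≤ u ^ 2 * Db := by positivity
    linarith
  have t1 : (2 * (K : ℝ) + 1) * ((2 * P.card) ^ (2 * K) / n) ≤ D / Real.sqrt n := by
    have e1 : ((P.card : ℝ)) ^ (2 * K) ≤ Real.sqrt n := by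
      refine Real.le_sqrt_of_sq_le ?_
      rw [← pow_mul]
      have e2 : P.card ^ (2 * K * 2) ≤ n := by
        refine (Nat.pow_le_pow_left (card_primesUpTo_le z) _).trans ?_
        rwa [show 2 * K * 2 = 4 * K by ring]
      exact_mod_cast e2
    have e3 : (0 : ℝ) < Real.sqrt n := Real.sqrt_pos.2 hn0'
    have e4 : (2 * (P.card : ℝ)) ^ (2 * K) / n ≤ 4 ^ K / Real.sqrt n := by
      rw [div_le_div_iff₀ hn0' e3, mul_pow, pow_mul 2]
      have e5 := mul_le_mul_of_nonneg_right e1 e3.le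
      rw [Real.mul_self_sqrt hn0'.le] at e5
      have e6 : (0 : ℝ) ≤ 4 ^ K := by positivity
      have e7 := mul_le_mul_of_nonneg_left e5 e6
      norm_num
      linarith
    refine (mul_le_mul_of_nonneg_left e4 (by positivity)).trans ?_
    rw [← mul_div_assoc]
    exact div_le_div_of_nonneg_right (by linarith) e3.le
  have t2 : (4 : ℝ)⁻¹ ^ K * Real.exp (4 * u ^ 2 * V) ≤
      (4 : ℝ)⁻¹ ^ K * Real.exp (4 * u ^ 2 * (b * LL n + D)) := by
    refine mul_le_mul_of_nonneg_left (Real.exp_le_exp.2 ?_) (by positivity)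
    exact mul_le_mul_of_nonneg_left hVL (by positivity)
  have t3 : |u| ^ 3 * ∑ p ∈ P, (p : ℝ)⁻¹ ≤ |u| ^ 3 * (LL n + D) :=
    mul_le_mul_of_nonneg_left hS' (by positivity)
  have t4 : u ^ 2 * ∑ p ∈ P, ((p : ℝ)⁻¹) ^ 2 ≤ u ^ 2 * Ds :=
    mul_le_mul_of_nonneg_left (hDs P) (by positivity)
  have t5 : |u| * (C + 8 * K + Da) ≤ |u| * D :=
    mul_le_mul_of_nonneg_left (by linarith) (abs_nonneg u)
  have t6 : 3 * (u ^ 2 * Ds) + u ^ 2 * Db ≤ u ^ 2 * D := by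
    have := mul_le_mul_of_nonneg_left (by linarith : 3 * Ds + Db ≤ D) (sq_nonneg u)
    linarith
  have e1 : (n : ℝ)⁻¹ • ∑ m ∈ Finset.Icc 1 n,
      Complex.exp ((u * centredSum P h (P.filter (· ∣ m)) : ℝ) * Complex.I) =
      divisorMean P n fun S => Complex.exp (u * centredSum P h S * Complex.I) := by
    rw [divisorMean]
    simp only [Complex.ofReal_mul]
  rw [e1] at s1
  refine (norm_sub_le_norm_sub_add_norm_sub _ (divisorMean P n fun S =>
    Complex.exp (u * centredSum P h S * Complex.I)) _).trans ?_
  refine (add_le_add s1 ((norm_sub_le_norm_sub_add_norm_sub _ (modelMean P fun S =>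
    Complex.exp (u * centredSum P h S * Complex.I)) _).trans (add_le_add s2
      ((norm_sub_le_norm_sub_add_norm_sub _ _ _).trans (add_le_add s3 s4))))).trans ?_
  linarith

theorem tendsto_charMean {h g : ℕ → ℝ} {a b C : ℝ} (hh : ∀ p, |h p| ≤ 1)
    (hsupp : ∀ k, ¬ k.Prime → h k = 0) (ha : HasMertensMean h a)
    (hb : HasMertensMean (fun k => h k ^ 2) b) (hb0 : 0 < b)
    (hg : Tendsto (fun n : ℕ => (cnt (fun m => C < |g m - addFun h m|) n : ℝ) / n) atTop (nhds 0))
    (hC : 0 ≤ C) (t : ℝ) :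
    Tendsto (fun n : ℕ => (n : ℝ)⁻¹ • ∑ m ∈ Finset.Icc 1 n,
      Complex.exp ((t / Real.sqrt (b * LL n) * (g m - a * LL n) : ℝ) * Complex.I)) atTop
      (nhds (Complex.exp ((-(t ^ 2 / 2) : ℝ)))) := by
  rw [Metric.tendsto_atTop']
  intro ε hε
  have hK : ∃ K : ℕ, 0 < K ∧ 4 * ((4 : ℝ)⁻¹ ^ K * Real.exp (4 * t ^ 2 + 1)) < ε / 2 := by
    have h1 : Tendsto (fun K : ℕ => 4 * ((4 : ℝ)⁻¹ ^ K * Real.exp (4 * t ^ 2 + 1))) atTop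
        (nhds (4 * (0 * Real.exp (4 * t ^ 2 + 1)))) :=
      ((tendsto_pow_atTop_nhds_zero_of_lt_one (by norm_num) (by norm_num)).mul_const _).const_mul _
    rw [zero_mul, mul_zero] at h1
    exact ((eventually_gt_atTop 0).and (h1.eventually (gt_mem_nhds (half_pos hε)))).exists
  obtain ⟨K, hK0, hK⟩ := hK
  obtain ⟨D, hD0, hD⟩ := exists_norm_charMean_sub_le (g := g) hh hsupp ha hb hb0 hC hK0
  have hbL : Tendsto (fun n => b * LL n) atTop atTop := tendsto_LL_atTop.const_mul_atTop hb0
  have hs : Tendsto (fun n => Real.sqrt (b * LL n)) atTop atTop :=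
    Real.tendsto_sqrt_atTop.comp hbL
  set u : ℕ → ℝ := fun n => t / Real.sqrt (b * LL n) with hu
  have hu0 : Tendsto u atTop (nhds 0) := hs.const_div_atTop t
  have hua : Tendsto (fun n => |u n|) atTop (nhds 0) := by simpa using hu0.abs
  have huL : ∀ᶠ n in atTop, u n ^ 2 * (b * LL n) = t ^ 2 := by
    filter_upwards [hbL.eventually_gt_atTop 0] with n hn
    simp only [hu]
    rw [div_pow, Real.sq_sqrt hn.le, div_mul_cancel₀ _ hn.ne']
  have hsqrt : Tendsto (fun n : ℕ => D / Real.sqrt n) atTop (nhds 0) :=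
    (Real.tendsto_sqrt_atTop.comp tendsto_natCast_atTop_atTop).const_div_atTop D
  have hrest : Tendsto (fun n : ℕ => |u n| * D +
      2 * ((cnt (fun m => C < |g m - addFun h m|) n : ℝ) / n) + D / Real.sqrt n +
        (|u n| * (t ^ 2 / b) + |u n| ^ 3 * D) + u n ^ 2 * D) atTop (nhds 0) := by
    have := ((((hua.mul_const D).add (hg.const_mul 2)).add hsqrt).add
      ((hua.mul_const (t ^ 2 / b)).add ((hua.pow 3).mul_const D))).add ((hu0.pow 2).mul_const D)
    simpa using this
  have hu2 : Tendsto (fun n => 4 * u n ^ 2 * D) atTop (nhds 0) := by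
    simpa using ((hu0.pow 2).const_mul 4).mul_const D
  have h2u : Tendsto (fun n => |2 * u n|) atTop (nhds 0) := by
    simpa using (hu0.const_mul 2).abs
  have hev : ∀ᶠ n : ℕ in atTop, dist ((n : ℝ)⁻¹ • ∑ m ∈ Finset.Icc 1 n,
      Complex.exp ((t / Real.sqrt (b * LL n) * (g m - a * LL n) : ℝ) * Complex.I))
      (Complex.exp ((-(t ^ 2 / 2) : ℝ))) < ε := by
    filter_upwards [huL, hrest.eventually (gt_mem_nhds (half_pos hε)),
      hu2.eventually (ge_mem_nhds one_pos), h2u.eventually (ge_mem_nhds one_pos),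
      eventually_ge_atTop (3 ^ (4 * K))] with n h1 h2 h3 h4 h5
    have h6 := hD n h5 (u n) h4
    rw [h1] at h6
    rw [dist_eq_norm]
    refine h6.trans_lt ?_
    have e1 : |u n| ^ 3 * LL n = |u n| * (t ^ 2 / b) := by
      rw [← h1, pow_succ', sq_abs]
      field_simp
    have e2 : 4 * u n ^ 2 * (b * LL n + D) ≤ 4 * t ^ 2 + 1 := by
      have : 4 * u n ^ 2 * (b * LL n + D) = 4 * (u n ^ 2 * (b * LL n)) + 4 * u n ^ 2 * D := by ring
      rw [this, h1]
      linarith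
    have e3 : 4 * ((4 : ℝ)⁻¹ ^ K * Real.exp (4 * u n ^ 2 * (b * LL n + D))) < ε / 2 := by
      refine lt_of_le_of_lt ?_ hK
      have := Real.exp_le_exp.2 e2
      gcongr
    rw [mul_add (|u n| ^ 3), e1]
    linarith
  obtain ⟨N, hN⟩ := eventually_atTop.1 hev
  exact ⟨N, fun n hn => hN n hn.le⟩

/-- The uniform distribution on the values `Y 1, …, Y n`. -/
def empiricalMeasure (n : ℕ) (Y : ℕ → ℝ) : Measure ℝ :=
  (n : ENNReal)⁻¹ • ∑ m ∈ Finset.Icc 1 n, Measure.dirac (Y m)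

theorem isProbabilityMeasure_empiricalMeasure {n : ℕ} (hn : n ≠ 0) (Y : ℕ → ℝ) :
    IsProbabilityMeasure (empiricalMeasure n Y) := by
  constructor
  simp only [empiricalMeasure, Measure.smul_apply, Measure.finsetSum_apply, measure_univ,
    Finset.sum_const, Nat.card_Icc, Nat.add_sub_cancel, nsmul_eq_mul, mul_one, smul_eq_mul]
  exact ENNReal.inv_mul_cancel (by exact_mod_cast hn) (ENNReal.natCast_ne_top n)

theorem charFun_empiricalMeasure (n : ℕ) (Y : ℕ → ℝ) (t : ℝ) :
    charFun (empiricalMeasure n Y) t =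
      (n : ℝ)⁻¹ • ∑ m ∈ Finset.Icc 1 n, Complex.exp ((t * Y m : ℝ) * Complex.I) := by
  rw [charFun_apply_real, empiricalMeasure, integral_smul_measure, integral_finsetSum_measure]
  · simp only [integral_dirac, ENNReal.toReal_inv, ENNReal.toReal_natCast, Complex.ofReal_mul]
  · exact fun m _ => integrable_dirac (by simp)

theorem empiricalMeasure_Iic (n : ℕ) (Y : ℕ → ℝ) (x : ℝ) :
    (empiricalMeasure n Y (Set.Iic x)).toReal = (cnt (fun m => Y m ≤ x) n : ℝ) / n := by
  classical
  rw [empiricalMeasure, Measure.smul_apply, Measure.finsetSum_apply, smul_eq_mul, cnt_eq_card]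
  simp only [Measure.dirac_apply' _ measurableSet_Iic, Set.indicator_apply, Set.mem_Iic,
    Pi.one_apply, Finset.sum_boole]
  rw [ENNReal.toReal_mul, ENNReal.toReal_inv, ENNReal.toReal_natCast, ENNReal.toReal_natCast,
    div_eq_inv_mul]

theorem Phi_eq_gaussianReal (x : ℝ) : Phi x = (gaussianReal 0 1 (Set.Iic x)).toReal := by
  rw [gaussianReal_apply_eq_integral 0 one_ne_zero, ENNReal.toReal_ofReal
    (integral_nonneg fun y => gaussianPDFReal_nonneg _ _ y), Phi, gaussianPDFReal_def,
    integral_const_mul]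
  simp

theorem tendsto_Phi_atBot : Tendsto Phi atBot (nhds 0) := by
  have h := tendsto_measure_iInter_atBot (μ := gaussianReal 0 1) (s := fun x : ℝ => Set.Iic x)
    (fun _ => measurableSet_Iic.nullMeasurableSet) (fun _ _ h => Set.Iic_subset_Iic.2 h)
    ⟨0, measure_ne_top _ _⟩
  have h0 : ⋂ x : ℝ, Set.Iic x = ∅ := by
    ext y
    simpa using exists_lt y
  rw [h0, measure_empty] at h
  have := (ENNReal.tendsto_toReal ENNReal.zero_ne_top).comp h
  simpa [Function.comp_def, ← Phi_eq_gaussianReal] using this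

/-- The **Erdős–Kac theorem** for a function that is close to a strongly additive one. -/
theorem tendsto_cnt_div_Phi {h g : ℕ → ℝ} {a b C : ℝ} (hh : ∀ p, |h p| ≤ 1)
    (hsupp : ∀ k, ¬ k.Prime → h k = 0) (ha : HasMertensMean h a)
    (hb : HasMertensMean (fun k => h k ^ 2) b) (hb0 : 0 < b)
    (hg : Tendsto (fun n : ℕ => (cnt (fun m => C < |g m - addFun h m|) n : ℝ) / n) atTop (nhds 0))
    (hC : 0 ≤ C) (x : ℝ) :
    Tendsto (fun n : ℕ =>
      (cnt (fun m => g m ≤ a * LL n + x * Real.sqrt b * Real.sqrt (LL n)) n : ℝ) / n) atTop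
      (nhds (Phi x)) := by
  set Y : ℕ → ℕ → ℝ := fun n m => (g m - a * LL n) / Real.sqrt (b * LL n) with hY
  set μ : ℕ → ProbabilityMeasure ℝ := fun n =>
    ⟨empiricalMeasure (n + 1) (Y (n + 1)),
      isProbabilityMeasure_empiricalMeasure n.succ_ne_zero _⟩ with hμ
  set μ₀ : ProbabilityMeasure ℝ := ⟨gaussianReal 0 1, inferInstance⟩ with hμ₀
  have hlim : Tendsto μ atTop (nhds μ₀) := by
    refine ProbabilityMeasure.tendsto_of_tendsto_charFun fun t => ?_
    have h1 := (tendsto_add_atTop_iff_nat 1).2 (tendsto_charMean hh hsupp ha hb hb0 hg hC t)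
    convert h1 using 1
    · funext n
      simp only [hμ, ProbabilityMeasure.coe_mk]
      rw [charFun_empiricalMeasure]
      congr 1
      refine Finset.sum_congr rfl fun m _ => ?_
      rw [hY]
      congr 3
      ring
    · simp only [hμ₀, ProbabilityMeasure.coe_mk]
      rw [charFun_gaussianReal]
      congr 2
      push_cast
      ring
  have h1 : Tendsto (fun n => (μ n : Measure ℝ) (Set.Iic x)) atTop
      (nhds ((μ₀ : Measure ℝ) (Set.Iic x))) := by
    refine ProbabilityMeasure.tendsto_measure_of_null_frontier_of_tendsto' hlim ?_
    rw [frontier_Iic]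
    have := nullSingletonClass_gaussianReal (μ := 0) one_ne_zero
    exact measure_singleton (μ := gaussianReal 0 1) x
  have h2 := (ENNReal.tendsto_toReal (measure_ne_top (μ₀ : Measure ℝ) (Set.Iic x))).comp h1
  have h3 : ((μ₀ : Measure ℝ) (Set.Iic x)).toReal = Phi x := (Phi_eq_gaussianReal x).symm
  rw [h3] at h2
  refine (tendsto_add_atTop_iff_nat 1).1 (h2.congr' ?_)
  have hL : ∀ᶠ n : ℕ in atTop, 0 < LL (n + 1) :=
    (tendsto_add_atTop_iff_nat 1).2 tendsto_LL_atTop |>.eventually_gt_atTop 0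
  filter_upwards [hL] with n hn
  have h4 := empiricalMeasure_Iic (n + 1) (Y (n + 1)) x
  refine h4.trans ?_
  congr 3
  funext m
  rw [hY]
  beta_reduce
  rw [div_le_iff₀ (Real.sqrt_pos.2 (mul_pos hb0 hn)), Real.sqrt_mul hb0.le, sub_le_iff_le_add,
    add_comm, ← mul_assoc]

/-! ### A Chebyshev-type bound for primes congruent to `1` modulo a large prime -/

theorem ordCompl_factorial_dvd_prod {r : ℕ} (hr : r.Prime) (K : ℕ) :
    ordCompl[r] (K.factorial) ∣ ∏ k ∈ Finset.range K, ((k + 1) * r + 1) := by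
  set D := ordCompl[r] (K.factorial) with hD
  have hcop : Nat.Coprime r D := Nat.coprime_ordCompl hr K.factorial_ne_zero
  have hD0 : D ≠ 0 := (Nat.ordCompl_pos r K.factorial_ne_zero).ne'
  obtain ⟨s, hs⟩ : ∃ s : ℕ, r * s ≡ 1 [MOD D] := by
    obtain ⟨s, -, hs⟩ := Nat.exists_mul_mod_eq_of_coprime 1 hcop hD0
    exact ⟨s, hs⟩
  have hsD : Nat.Coprime D s := by
    have h1 : Nat.Coprime (r * s) D := by
      rw [Nat.Coprime, hs.gcd_eq, Nat.gcd_one_left]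
    exact (h1.coprime_mul_left).symm
  have h1 : s ^ K * ∏ k ∈ Finset.range K, ((k + 1) * r + 1) ≡
      ∏ k ∈ Finset.range K, (s + 1 + k) [MOD D] := by
    rw [← Finset.card_range K, ← Finset.prod_const, Finset.card_range, ← Finset.prod_mul_distrib]
    refine Nat.ModEq.prod fun k _ => ?_
    have h2 : s * ((k + 1) * r + 1) = (k + 1) * (r * s) + s := by ring
    have h3 : s + 1 + k = (k + 1) * 1 + s := by ring
    rw [h2, h3]
    exact (hs.mul_left _).add_right _
  rw [← Nat.ascFactorial_eq_prod_range] at h1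
  have h2 : D ∣ (s + 1).ascFactorial K :=
    (Nat.ordCompl_dvd _ r).trans (Nat.factorial_dvd_ascFactorial (s + 1) K)
  exact (hsD.pow_right K).dvd_of_dvd_mul_left ((h1.dvd_iff dvd_rfl).2 h2)

theorem prod_primes_le_pow {r : ℕ} (hr : r.Prime) (K : ℕ) {Q : Finset ℕ}
    (hQ : ∀ p ∈ Q, p.Prime ∧ p % r = 1 ∧ K < p ∧ p ≤ K * r + 1) :
    ∏ p ∈ Q, p ≤ (r + 1) ^ (2 * K) := by
  set N := ∏ k ∈ Finset.range K, ((k + 1) * r + 1) with hN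
  set D := ordCompl[r] (K.factorial) with hD
  have hD0 : 0 < D := Nat.ordCompl_pos r K.factorial_ne_zero
  have h1 : ∏ p ∈ Q, p ∣ N := by
    refine Finset.prod_primes_dvd N (fun p hp => (hQ p hp).1.prime) fun p hp => ?_
    obtain ⟨hp1, hp2, -, hp3⟩ := hQ p hp
    have h2 := Nat.div_add_mod p r
    rw [hp2] at h2
    have h3 : 0 < p / r := by
      rcases Nat.eq_zero_or_pos (p / r) with h | h
      · rw [h] at h2
        have := hp1.two_le
        omega
      · exact h
    have h4 : p / r ≤ K := by
      have h5 : r * (p / r) ≤ r * K := by rw [mul_comm r K]; omega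
      exact Nat.le_of_mul_le_mul_left h5 hr.pos
    have h5 : p = (p / r - 1 + 1) * r + 1 := by
      rw [Nat.sub_add_cancel h3, mul_comm]
      exact h2.symm
    rw [hN]
    conv_lhs => rw [h5]
    exact Finset.dvd_prod_of_mem (fun k => (k + 1) * r + 1) (Finset.mem_range.2 (by omega))
  have h2 : Nat.Coprime D (∏ p ∈ Q, p) := by
    refine Nat.Coprime.prod_right fun p hp => ?_
    obtain ⟨hp1, -, hp2, -⟩ := hQ p hp
    have h3 : Nat.Coprime (K.factorial) p :=
      ((hp1.coprime_iff_not_dvd.2 fun h => by have := hp1.dvd_factorial.1 h; omega).symm)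
    exact h3.coprime_dvd_left (Nat.ordCompl_dvd _ r)
  have h3 : D * ∏ p ∈ Q, p ∣ N := h2.mul_dvd_of_dvd_of_dvd (ordCompl_factorial_dvd_prod hr K) h1
  have h4 : N ≤ K.factorial * (r + 1) ^ K := by
    rw [hN, ← Finset.prod_range_add_one_eq_factorial, ← Finset.card_range K, ← Finset.prod_const,
      Finset.card_range, ← Finset.prod_mul_distrib]
    exact Finset.prod_le_prod' fun k _ => by nlinarith
  have hN0 : 0 < N := Finset.prod_pos fun k _ => by omega
  have h5 : K.factorial = ordProj[r] (K.factorial) * D :=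
    (Nat.ordProj_mul_ordCompl_eq_self _ r).symm
  have h6 : ordProj[r] (K.factorial) ≤ (r + 1) ^ K := by
    have h7 : (K.factorial).factorization r ≤ K := by
      have := Nat.factorization_factorial_le_div_pred hr K
      exact this.trans (Nat.div_le_self _ _)
    exact (Nat.pow_le_pow_right hr.pos h7).trans (Nat.pow_le_pow_left (Nat.le_succ r) K)
  have h7 := (Nat.le_of_dvd hN0 h3).trans h4
  rw [h5] at h7
  refine Nat.le_of_mul_le_mul_left ?_ hD0
  calc D * ∏ p ∈ Q, p ≤ ordProj[r] (K.factorial) * D * (r + 1) ^ K := h7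
    _ ≤ (r + 1) ^ K * D * (r + 1) ^ K := by gcongr
    _ = D * (r + 1) ^ (2 * K) := by ring

/-- The primes `p ≤ n` with `p ≡ 1 (mod r)`. -/
def primesOneMod (r n : ℕ) : Finset ℕ := (Finset.Icc 1 n).filter fun p => p.Prime ∧ p % r = 1

theorem sum_inv_block_le {r : ℕ} (hr : r.Prime) (hr5 : 5 ≤ r) (n : ℕ) {j : ℕ} (hj : j ≠ 0) :
    ∑ p ∈ (primesOneMod r n).filter (fun p => Nat.log 2 p = j), (p : ℝ)⁻¹ ≤
      12 * (Real.log (r + 1) / r) * (j : ℝ)⁻¹ := by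
  set Q := (primesOneMod r n).filter (fun p => Nat.log 2 p = j) with hQ
  have hQp : ∀ p ∈ Q, p.Prime ∧ p % r = 1 ∧ 2 ^ j ≤ p ∧ p < 2 ^ (j + 1) := by
    intro p hp
    simp only [hQ, primesOneMod, Finset.mem_filter] at hp
    obtain ⟨⟨-, hp1, hp2⟩, rfl⟩ := hp
    exact ⟨hp1, hp2, Nat.pow_log_le_self 2 hp1.ne_zero, Nat.lt_pow_succ_log_self one_lt_two p⟩
  have hr0 : (0 : ℝ) < r := by exact_mod_cast hr.pos
  have hlogr : 0 ≤ Real.log (r + 1) := Real.log_nonneg (by linarith)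
  rcases Q.eq_empty_or_nonempty with he | ⟨p₀, hp₀⟩
  · rw [he, Finset.sum_empty]
    positivity
  have hrj : r < 2 ^ (j + 1) := by
    obtain ⟨h1, h2, -, h3⟩ := hQp p₀ hp₀
    refine lt_of_le_of_lt ?_ h3
    by_contra! h4
    rw [Nat.mod_eq_of_lt h4] at h2
    exact h1.ne_one h2
  set K := 2 ^ (j + 1) / r + 1 with hK
  have hK1 : K * r ≤ 2 * 2 ^ (j + 1) := by
    have := Nat.div_mul_le_self (2 ^ (j + 1)) r
    rw [hK, add_mul, one_mul]
    omega
  have hK2 : 2 ^ (j + 1) ≤ K * r := by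
    have := Nat.lt_div_mul_add hr.pos (a := 2 ^ (j + 1))
    rw [hK, add_mul, one_mul]
    exact this.le
  have hKj : K < 2 ^ j := by
    have h1 : K * 5 ≤ K * r := Nat.mul_le_mul_left K hr5
    have h2 : 2 ^ (j + 1) = 2 * 2 ^ j := pow_succ' 2 j
    have h3 : 0 < 2 ^ j := by positivity
    omega
  have h1 := prod_primes_le_pow hr K (Q := Q) fun p hp => by
    obtain ⟨h1, h2, h3, h4⟩ := hQp p hp
    exact ⟨h1, h2, by omega, by omega⟩
  have h2 : (2 ^ j) ^ Q.card ≤ (r + 1) ^ (2 * K) :=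
    (Finset.pow_card_le_prod _ _ _ fun p hp => (hQp p hp).2.2.1).trans h1
  have h3 : (Q.card : ℝ) * (j * Real.log 2) ≤ 2 * K * Real.log (r + 1) := by
    have h4 : ((2 : ℝ) ^ j) ^ Q.card ≤ ((r : ℝ) + 1) ^ (2 * K) := by exact_mod_cast h2
    have h5 := Real.log_le_log (by positivity) h4
    rw [Real.log_pow, Real.log_pow, Real.log_pow] at h5
    push_cast at h5
    exact h5
  have hlog2 : (2 : ℝ) / 3 ≤ Real.log 2 := by
    have := Real.log_two_gt_d9
    linarith
  have hj0 : (0 : ℝ) < j := by exact_mod_cast Nat.pos_of_ne_zero hj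
  have h4 : ∑ p ∈ Q, (p : ℝ)⁻¹ ≤ Q.card * ((2 : ℝ) ^ j)⁻¹ := by
    rw [← nsmul_eq_mul]
    refine Finset.sum_le_card_nsmul _ _ _ fun p hp => inv_anti₀ (by positivity) ?_
    exact_mod_cast (hQp p hp).2.2.1
  refine h4.trans ?_
  have hK3 : (K : ℝ) * r ≤ 4 * 2 ^ j := by
    have : (K : ℝ) * r ≤ 2 * 2 ^ (j + 1) := by exact_mod_cast hK1
    rw [pow_succ] at this
    linarith
  have h6 : (Q.card : ℝ) * j * r ≤ 12 * Real.log (r + 1) * 2 ^ j := by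
    have hc : (0 : ℝ) ≤ Q.card * j := by positivity
    have e1 : (Q.card : ℝ) * j * (2 / 3) ≤ Q.card * j * Real.log 2 :=
      mul_le_mul_of_nonneg_left hlog2 hc
    have e2 : (Q.card : ℝ) * j ≤ 3 * K * Real.log (r + 1) := by linarith
    have e3 := mul_le_mul_of_nonneg_right e2 hr0.le
    have e4 := mul_le_mul_of_nonneg_right hK3 hlogr
    linarith
  have h2j : (0 : ℝ) < 2 ^ j := by positivity
  have e : 12 * (Real.log (r + 1) / r) * (j : ℝ)⁻¹ = 12 * Real.log (r + 1) / (r * j) := by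
    field_simp
  rw [e, ← div_eq_mul_inv, div_le_div_iff₀ h2j (by positivity)]
  linarith

theorem sum_inv_primesOneMod_le {r n : ℕ} (hr : r.Prime) (hr5 : 5 ≤ r) (hn : 3 ≤ n) :
    ∑ p ∈ primesOneMod r n, (p : ℝ)⁻¹ ≤ 12 * (Real.log (r + 1) / r) * (LL n + 2) := by
  set N := Nat.log 2 n with hN
  have hmaps : ∀ p ∈ primesOneMod r n, Nat.log 2 p ∈ Finset.Icc 1 N := by
    intro p hp
    simp only [primesOneMod, Finset.mem_filter, Finset.mem_Icc] at hp
    obtain ⟨⟨-, hp1⟩, hp2, -⟩ := hp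
    exact Finset.mem_Icc.2 ⟨Nat.log_pos one_lt_two hp2.two_le, Nat.log_mono_right hp1⟩
  rw [← Finset.sum_fiberwise_of_maps_to hmaps]
  have hlogr : 0 ≤ Real.log (r + 1) / r :=
    div_nonneg (Real.log_nonneg (by linarith [(Nat.cast_nonneg r : (0 : ℝ) ≤ r)]))
      (Nat.cast_nonneg r)
  have h1 : ∑ j ∈ Finset.Icc 1 N, (j : ℝ)⁻¹ ≤ 1 + Real.log N := by
    have := harmonic_le_one_add_log N
    rw [harmonic_eq_sum_Icc] at this
    push_cast at this
    exact this
  have hN1 : 0 < N := Nat.log_pos one_lt_two (by omega)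
  have hlog2 : (1 : ℝ) / 2 ≤ Real.log 2 := by
    have := Real.log_two_gt_d9
    linarith
  have hlogn : 1 ≤ Real.log n := one_le_log_of_three_le hn
  have h2 : Real.log N ≤ LL n + 1 := by
    have e1 : (N : ℝ) * Real.log 2 ≤ Real.log n := by
      rw [← Real.log_pow]
      refine Real.log_le_log (by positivity) ?_
      exact_mod_cast Nat.pow_log_le_self 2 (by omega)
    have e2 : (N : ℝ) ≤ 2 * Real.log n := by
      have : (N : ℝ) * (1 / 2) ≤ N * Real.log 2 :=
        mul_le_mul_of_nonneg_left hlog2 (Nat.cast_nonneg N)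
      linarith
    have e3 := Real.log_le_log (by exact_mod_cast hN1) e2
    rw [Real.log_mul two_ne_zero (by linarith)] at e3
    have e4 := Real.log_two_lt_d9
    change _ ≤ Real.log (Real.log n) + 1
    linarith
  calc ∑ j ∈ Finset.Icc 1 N, ∑ p ∈ (primesOneMod r n).filter (fun p => Nat.log 2 p = j), (p : ℝ)⁻¹
      ≤ ∑ j ∈ Finset.Icc 1 N, 12 * (Real.log (r + 1) / r) * (j : ℝ)⁻¹ :=
        Finset.sum_le_sum fun j hj =>
          sum_inv_block_le hr hr5 n (Nat.one_le_iff_ne_zero.1 (Finset.mem_Icc.1 hj).1)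
    _ = 12 * (Real.log (r + 1) / r) * ∑ j ∈ Finset.Icc 1 N, (j : ℝ)⁻¹ := by rw [Finset.mul_sum]
    _ ≤ 12 * (Real.log (r + 1) / r) * (LL n + 2) := by
        refine mul_le_mul_of_nonneg_left (by linarith) (by positivity)

theorem log_succ_div_sq_le {r : ℕ} (hr : 2 ≤ r) :
    (Real.log (r + 1) / r) ^ 2 ≤ 64 * ((r : ℝ) ^ (3 / 2 : ℝ))⁻¹ := by
  have hr2 : (2 : ℝ) ≤ r := by exact_mod_cast hr
  have hr0 : (0 : ℝ) < r := by linarith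
  have h1 : Real.log (r + 1) ≤ 8 * (r : ℝ) ^ (1 / 4 : ℝ) := by
    have e1 : Real.log (r + 1) ≤ Real.log ((r : ℝ) ^ 2) :=
      Real.log_le_log (by linarith) (by nlinarith)
    rw [Real.log_pow] at e1
    have e2 := Real.log_le_rpow_div hr0.le (show (0 : ℝ) < 1 / 4 by norm_num)
    push_cast at e1
    linarith
  have h0 : 0 ≤ Real.log (r + 1) := Real.log_nonneg (by linarith)
  have h2 : (Real.log (r + 1)) ^ 2 ≤ 64 * (r : ℝ) ^ (1 / 2 : ℝ) := by
    have e1 := pow_le_pow_left₀ h0 h1 2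
    have e2 : ((r : ℝ) ^ (1 / 4 : ℝ)) ^ 2 = (r : ℝ) ^ (1 / 2 : ℝ) := by
      rw [← Real.rpow_natCast, ← Real.rpow_mul hr0.le]
      norm_num
    rw [mul_pow, e2] at e1
    linarith
  have h3 : (r : ℝ) ^ (1 / 2 : ℝ) * (r : ℝ) ^ (3 / 2 : ℝ) = (r : ℝ) ^ 2 := by
    rw [← Real.rpow_add hr0, ← Real.rpow_natCast]
    norm_num
  have h4 : 0 < (r : ℝ) ^ (3 / 2 : ℝ) := Real.rpow_pos_of_pos hr0 _
  rw [div_pow, div_le_iff₀ (by positivity), ← h3]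
  calc _ ≤ 64 * (r : ℝ) ^ (1 / 2 : ℝ) := h2
    _ = _ := by field_simp

theorem omegaQ_eq_card {r m n : ℕ} (hr : 1 < r) (hm : 1 ≤ m) (hmn : m ≤ n) :
    omegaQ m r = ((primesOneMod r n).filter fun p => p ∣ m).card := by
  rw [omegaQ, primesOneMod, Finset.filter_filter]
  congr 1
  ext p
  simp only [Finset.mem_filter, Nat.mem_primeFactors, Finset.mem_Icc, Nat.mod_eq_of_lt hr]
  constructor
  · rintro ⟨⟨h1, h2, -⟩, h3⟩
    exact ⟨⟨h1.one_le, (Nat.le_of_dvd hm h2).trans hmn⟩, ⟨h1, h3⟩, h2⟩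
  · rintro ⟨-, ⟨h1, h3⟩, h2⟩
    exact ⟨⟨h1, h2, by omega⟩, h3⟩

theorem sum_offDiag_le {P : Finset ℕ} (hP : ∀ p ∈ P, p.Prime) (n : ℕ) :
    (∑ m ∈ Finset.Icc 1 n, ((P.filter fun p => p ∣ m).offDiag.card : ℝ)) ≤
      n * (∑ p ∈ P, (p : ℝ)⁻¹) ^ 2 := by
  have h1 : ∀ m, ((P.filter fun p => p ∣ m).offDiag.card : ℝ) ≤
      ∑ x ∈ P ×ˢ P, if x.1 ≠ x.2 ∧ x.1 * x.2 ∣ m then (1 : ℝ) else 0 := by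
    intro m
    rw [Finset.sum_boole, Nat.cast_le]
    refine Finset.card_le_card fun x hx => ?_
    simp only [Finset.mem_offDiag, Finset.mem_filter, Finset.mem_product] at hx ⊢
    obtain ⟨⟨h1, h2⟩, ⟨h3, h4⟩, h5⟩ := hx
    exact ⟨⟨h1, h3⟩, h5,
      ((Nat.coprime_primes (hP _ h1) (hP _ h3)).2 h5).mul_dvd_of_dvd_of_dvd h2 h4⟩
  refine (Finset.sum_le_sum (s := Finset.Icc 1 n) fun m _ => h1 m).trans ?_
  have h3 : n * (∑ p ∈ P, (p : ℝ)⁻¹) ^ 2 =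
      ∑ x ∈ P ×ˢ P, (n : ℝ) * ((x.1 : ℝ)⁻¹ * (x.2 : ℝ)⁻¹) := by
    rw [sq, Finset.sum_mul_sum, ← Finset.mul_sum, Finset.sum_product]
  rw [Finset.sum_comm, h3]
  refine Finset.sum_le_sum fun x _ => ?_
  rw [Finset.sum_boole]
  have h2 : ((Finset.Icc 1 n).filter fun m => x.1 ≠ x.2 ∧ x.1 * x.2 ∣ m).card ≤
      n / (x.1 * x.2) := by
    rw [← Nat.Ioc_filter_dvd_card_eq_div]
    refine Finset.card_le_card fun m hm => ?_
    simp only [Finset.mem_filter, Finset.mem_Icc, Finset.mem_Ioc] at hm ⊢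
    exact ⟨⟨hm.1.1, hm.1.2⟩, hm.2.2⟩
  refine (Nat.cast_le.2 h2).trans (Nat.cast_div_le.trans (le_of_eq ?_))
  rw [div_eq_mul_inv, Nat.cast_mul, mul_inv]

theorem card_le_omegaQ_le {r n : ℕ} (hr : r.Prime) (hr5 : 5 ≤ r) (hn : 3 ≤ n) {T : ℝ} (hT : 2 ≤ T) :
    (((Finset.Icc 1 n).filter fun m => T ≤ omegaQ m r).card : ℝ) ≤
      n * (18432 * (LL n + 2) ^ 2 / T ^ 2) * ((r : ℝ) ^ (3 / 2 : ℝ))⁻¹ := by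
  have hP : ∀ p ∈ primesOneMod r n, p.Prime := fun p hp => (Finset.mem_filter.1 hp).2.1
  have h1 : (((Finset.Icc 1 n).filter fun m => T ≤ omegaQ m r).card : ℝ) * (T ^ 2 / 2) ≤
      ∑ m ∈ Finset.Icc 1 n, (((primesOneMod r n).filter fun p => p ∣ m).offDiag.card : ℝ) := by
    rw [← nsmul_eq_mul]
    refine (Finset.card_nsmul_le_sum _ _ _ fun m hm => ?_).trans
      (Finset.sum_le_sum_of_subset_of_nonneg (Finset.filter_subset _ _)
        fun m _ _ => Nat.cast_nonneg _)
    simp only [Finset.mem_filter, Finset.mem_Icc] at hm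
    obtain ⟨⟨hm1, hm2⟩, hm3⟩ := hm
    rw [omegaQ_eq_card hr.one_lt hm1 hm2] at hm3
    rw [Finset.offDiag_card, Nat.cast_sub (Nat.le_mul_self _), Nat.cast_mul]
    nlinarith
  have h2 := h1.trans (sum_offDiag_le hP n)
  have hS0 : 0 ≤ ∑ p ∈ primesOneMod r n, (p : ℝ)⁻¹ :=
    Finset.sum_nonneg fun p _ => by positivity
  have h3 : (∑ p ∈ primesOneMod r n, (p : ℝ)⁻¹) ^ 2 ≤
      9216 * ((r : ℝ) ^ (3 / 2 : ℝ))⁻¹ * (LL n + 2) ^ 2 := by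
    refine (pow_le_pow_left₀ hS0 (sum_inv_primesOneMod_le hr hr5 hn) 2).trans ?_
    rw [mul_pow, mul_pow]
    have := mul_le_mul_of_nonneg_right (log_succ_div_sq_le hr.two_le) (sq_nonneg (LL n + 2))
    linarith
  have h4 := h2.trans (mul_le_mul_of_nonneg_left h3 (Nat.cast_nonneg n))
  rw [← le_div_iff₀ (by positivity)] at h4
  refine h4.trans (le_of_eq ?_)
  field_simp
  ring

/-- Outside a set of arbitrarily small density, no large prime `r` has many prime factors
`p ≡ 1 (mod r)` of `m`. -/
theorem exists_eventually_cnt_omegaQ_le {κ ε : ℝ} (hκ : 0 < κ) (hε : 0 < ε) :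
    ∃ Y : ℕ, ∀ᶠ n : ℕ in atTop,
      (cnt (fun m => ∃ r : ℕ, r.Prime ∧ Y < r ∧ κ * LL n ≤ omegaQ m r) n : ℝ) / n ≤ ε := by
  have hsum : Summable fun r : ℕ => ((r : ℝ) ^ (3 / 2 : ℝ))⁻¹ :=
    Real.summable_nat_rpow_inv.2 (by norm_num)
  obtain ⟨s, hs⟩ := summable_iff_vanishing_norm.1 hsum (ε * κ ^ 2 / 73728) (by positivity)
  obtain ⟨Y₀, hY₀⟩ := s.exists_nat_subset_range
  set Y := Y₀ + 4 with hY
  refine ⟨Y, ?_⟩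
  filter_upwards [eventually_ge_atTop 3, tendsto_LL_atTop.eventually_ge_atTop 2,
    tendsto_LL_atTop.eventually_ge_atTop (2 / κ)] with n hn hL2 hLκ
  have hn0 : (0 : ℝ) < n := by exact_mod_cast (by omega : 0 < n)
  have hT : 2 ≤ κ * LL n := by rwa [div_le_iff₀' hκ] at hLκ
  classical
  rw [cnt_eq_card, div_le_iff₀ hn0]
  have hsub : ((Finset.Icc 1 n).filter fun m => ∃ r : ℕ, r.Prime ∧ Y < r ∧ κ * LL n ≤ omegaQ m r) ⊆
      ((Finset.Ioc Y n).filter Nat.Prime).biUnion fun r =>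
        (Finset.Icc 1 n).filter fun m => κ * LL n ≤ omegaQ m r := by
    intro m hm
    simp only [Finset.mem_filter, Finset.mem_biUnion, Finset.mem_Ioc] at hm ⊢
    obtain ⟨hm1, r, hr, hYr, hmr⟩ := hm
    refine ⟨r, ⟨⟨hYr, ?_⟩, hr⟩, hm1, hmr⟩
    have h0 : 0 < omegaQ m r := by
      have : (0 : ℝ) < omegaQ m r := by linarith
      exact_mod_cast this
    obtain ⟨p, hp⟩ := Finset.card_pos.1 h0
    simp only [Finset.mem_filter, Nat.mem_primeFactors] at hp
    obtain ⟨⟨hp1, hp2, hp3⟩, hp4⟩ := hp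
    rw [Nat.mod_eq_of_lt hr.one_lt] at hp4
    have hpm := (Nat.le_of_dvd (by omega) hp2).trans (Finset.mem_Icc.1 hm1).2
    by_contra! h
    rw [Nat.mod_eq_of_lt (by omega)] at hp4
    exact hp1.ne_one hp4
  have h1 : (((Finset.Icc 1 n).filter fun m =>
      ∃ r : ℕ, r.Prime ∧ Y < r ∧ κ * LL n ≤ omegaQ m r).card : ℝ) ≤
      ∑ r ∈ (Finset.Ioc Y n).filter Nat.Prime,
        n * (18432 * (LL n + 2) ^ 2 / (κ * LL n) ^ 2) * ((r : ℝ) ^ (3 / 2 : ℝ))⁻¹ := by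
    refine (Nat.cast_le.2 ((Finset.card_le_card hsub).trans Finset.card_biUnion_le)).trans ?_
    rw [Nat.cast_sum]
    refine Finset.sum_le_sum fun r hr => ?_
    simp only [Finset.mem_filter, Finset.mem_Ioc] at hr
    exact card_le_omegaQ_le hr.2 (by omega) hn hT
  rw [← Finset.mul_sum] at h1
  have h2 : ∑ r ∈ (Finset.Ioc Y n).filter Nat.Prime, ((r : ℝ) ^ (3 / 2 : ℝ))⁻¹ ≤
      ε * κ ^ 2 / 73728 := by
    refine (le_abs_self _).trans (hs _ ?_).le
    rw [Finset.disjoint_left]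
    intro r hr hrs
    have := Finset.mem_range.1 (hY₀ hrs)
    simp only [Finset.mem_filter, Finset.mem_Ioc] at hr
    omega
  have h3 : 18432 * (LL n + 2) ^ 2 / (κ * LL n) ^ 2 ≤ 73728 / κ ^ 2 := by
    rw [div_le_div_iff₀ (by positivity) (by positivity), mul_pow]
    have : (LL n + 2) ^ 2 ≤ 4 * LL n ^ 2 := by nlinarith
    have := mul_le_mul_of_nonneg_right this (sq_nonneg κ)
    linarith
  calc _ ≤ _ := h1
    _ ≤ n * (73728 / κ ^ 2) * (ε * κ ^ 2 / 73728) := by gcongr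
    _ = ε * n := by field_simp

/-! ### Counting functions of prime factors in residue classes -/

theorem HasMertensMean.add {h h' : ℕ → ℝ} {a a' : ℝ} (ha : HasMertensMean h a)
    (ha' : HasMertensMean h' a') : HasMertensMean (fun k => h k + h' k) (a + a') := by
  obtain ⟨C, hC⟩ := ha
  obtain ⟨C', hC'⟩ := ha'
  refine ⟨C + C', fun n hn => ?_⟩
  have h1 : ∑ k ∈ Finset.Icc 1 n, (h k + h' k) / k - (a + a') * LL n =
      (∑ k ∈ Finset.Icc 1 n, h k / k - a * LL n) +
        (∑ k ∈ Finset.Icc 1 n, h' k / k - a' * LL n) := by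
    simp only [add_div, Finset.sum_add_distrib]
    ring
  rw [h1]
  exact (abs_add_le _ _).trans (add_le_add (hC n hn) (hC' n hn))

theorem HasMertensMean.const_mul {h : ℕ → ℝ} {a : ℝ} (ha : HasMertensMean h a) (c : ℝ) :
    HasMertensMean (fun k => c * h k) (c * a) := by
  obtain ⟨C, hC⟩ := ha
  refine ⟨|c| * C, fun n hn => ?_⟩
  have h1 : ∑ k ∈ Finset.Icc 1 n, c * h k / k - c * a * LL n =
      c * (∑ k ∈ Finset.Icc 1 n, h k / k - a * LL n) := by
    simp only [mul_div_assoc, ← Finset.mul_sum]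
    ring
  rw [h1, abs_mul]
  exact mul_le_mul_of_nonneg_left (hC n hn) (abs_nonneg c)

theorem addFun_primeInd (q m : ℕ) : addFun (primeInd q) m = omegaQ m q := by
  unfold addFun omegaQ
  rw [Finset.card_filter, Nat.cast_sum]
  refine Finset.sum_congr rfl fun p hp => ?_
  simp [primeInd, Nat.prime_of_mem_primeFactors hp]

theorem addFun_primeInd_sub (s s' m : ℕ) :
    addFun (fun p => primeInd s p - primeInd s' p) m = (omegaQ m s : ℝ) - omegaQ m s' := by
  rw [← addFun_primeInd, ← addFun_primeInd]
  exact Finset.sum_sub_distrib _ _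

theorem primeInd_mul (s s' p : ℕ) : primeInd s p * primeInd s' p = primeInd (Nat.lcm s s') p := by
  have h : (p % s = 1 % s ∧ p % s' = 1 % s') ↔ p % Nat.lcm s s' = 1 % Nat.lcm s s' := by
    have := @Int.modEq_and_modEq_iff_modEq_lcm (p : ℤ) 1 s s'
    rw [Int.lcm_natCast_natCast] at this
    exact_mod_cast this
  simp only [primeInd, ← ite_and, mul_ite, mul_one, mul_zero, ← h]
  refine if_congr ?_ rfl rfl
  tauto

theorem primeInd_sub_sq (s s' p : ℕ) :
    (primeInd s p - primeInd s' p) ^ 2 =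
      primeInd s p + primeInd s' p + -2 * primeInd (Nat.lcm s s') p := by
  have h : ∀ t, primeInd t p * primeInd t p = primeInd t p := fun t => by
    rw [primeInd_mul, Nat.lcm_self]
  rw [← primeInd_mul]
  linear_combination h s + h s'

theorem abs_primeInd_sub_le_one (s s' p : ℕ) : |primeInd s p - primeInd s' p| ≤ 1 := by
  have h1 := primeInd_nonneg s p
  have h2 := primeInd_nonneg s' p
  have h3 := primeInd_le_one s p
  have h4 := primeInd_le_one s' p
  rw [abs_le]
  constructor <;> linarith

theorem primeInd_of_not_prime (s : ℕ) {k : ℕ} (hk : ¬ k.Prime) : primeInd s k = 0 := by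
  simp [primeInd, hk]

/-- Joint Erdős–Kac theorem for the difference of two prime factor counts. -/
theorem tendsto_cnt_of_close_omegaQ_sub {s s' : ℕ} (hs : s ≠ 0) (hs' : s' ≠ 0)
    (hlt : Nat.totient s < Nat.totient s') {g : ℕ → ℝ} {C : ℝ} (hC : 0 ≤ C)
    (hg : Tendsto (fun n : ℕ =>
      (cnt (fun m => C < |g m - ((omegaQ m s : ℝ) - omegaQ m s')|) n : ℝ) / n) atTop (nhds 0))
    (x : ℝ) :
    Tendsto (fun n : ℕ => (cnt (fun m => g m ≤
      ((Nat.totient s : ℝ)⁻¹ - (Nat.totient s' : ℝ)⁻¹) * LL n +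
        x * Real.sqrt ((Nat.totient s : ℝ)⁻¹ + (Nat.totient s' : ℝ)⁻¹ -
          2 * (Nat.totient (Nat.lcm s s') : ℝ)⁻¹) * Real.sqrt (LL n)) n : ℝ) / n) atTop
      (nhds (Phi x)) := by
  have hl : Nat.lcm s s' ≠ 0 := Nat.lcm_ne_zero hs hs'
  refine tendsto_cnt_div_Phi (h := fun p => primeInd s p - primeInd s' p) (C := C)
    (abs_primeInd_sub_le_one s s')
    (fun k hk => by rw [primeInd_of_not_prime s hk, primeInd_of_not_prime s' hk, sub_zero])
    ?_ ?_ ?_ ?_ hC x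
  · simpa [sub_eq_add_neg] using
      (hasMertensMean_primeInd hs).add ((hasMertensMean_primeInd hs').const_mul (-1))
  · simp only [primeInd_sub_sq]
    have := ((hasMertensMean_primeInd hs).add (hasMertensMean_primeInd hs')).add
      ((hasMertensMean_primeInd hl).const_mul (-2))
    rwa [neg_mul, ← sub_eq_add_neg] at this
  · have h0 : 0 < Nat.totient s := Nat.totient_pos.2 (Nat.pos_of_ne_zero hs)
    have h1 : Nat.totient s' ≤ Nat.totient (Nat.lcm s s') :=
      Nat.le_of_dvd (Nat.totient_pos.2 (Nat.pos_of_ne_zero hl))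
        (Nat.totient_dvd_of_dvd (Nat.dvd_lcm_right s s'))
    have h2 : (Nat.totient (Nat.lcm s s') : ℝ)⁻¹ ≤ (Nat.totient s' : ℝ)⁻¹ :=
      inv_anti₀ (by exact_mod_cast h0.trans hlt) (by exact_mod_cast h1)
    have h3 : (Nat.totient s' : ℝ)⁻¹ < (Nat.totient s : ℝ)⁻¹ :=
      inv_strictAnti₀ (by exact_mod_cast h0) (by exact_mod_cast hlt)
    linarith
  · simpa only [addFun_primeInd_sub] using hg

/-- The sets `{m ≤ n : P n m}` have density tending to `0`. -/
def IsNegligible (P : ℕ → ℕ → Prop) : Prop :=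
  Tendsto (fun n : ℕ => (cnt (P n) n : ℝ) / n) atTop (nhds 0)

theorem cnt_mono {P Q : ℕ → Prop} {n : ℕ} (h : ∀ m, 1 ≤ m → m ≤ n → P m → Q m) :
    cnt P n ≤ cnt Q n :=
  Set.ncard_le_ncard (fun m hm => ⟨hm.1, hm.2.1, h m hm.1 hm.2.1 hm.2.2⟩)
    ((Set.finite_Icc 1 n).subset fun _ hm => ⟨hm.1, hm.2.1⟩)

theorem cnt_or_le (P Q : ℕ → Prop) (n : ℕ) : cnt (fun m => P m ∨ Q m) n ≤ cnt P n + cnt Q n := by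
  refine (Set.ncard_le_ncard ?_ ?_).trans (Set.ncard_union_le _ _)
  · rintro m ⟨h1, h2, h | h⟩
    exacts [Or.inl ⟨h1, h2, h⟩, Or.inr ⟨h1, h2, h⟩]
  · exact (Set.finite_Icc 1 n).subset fun m hm => by
      rcases hm with hm | hm <;> exact ⟨hm.1, hm.2.1⟩

theorem IsNegligible.mono {P Q : ℕ → ℕ → Prop} (hQ : IsNegligible Q)
    (h : ∀ᶠ n in atTop, ∀ m, 1 ≤ m → m ≤ n → P n m → Q n m) : IsNegligible P := by
  refine tendsto_of_tendsto_of_tendsto_of_le_of_le' tendsto_const_nhds hQ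
    (Eventually.of_forall fun n => by positivity) ?_
  filter_upwards [h] with n hn
  exact div_le_div_of_nonneg_right (Nat.cast_le.2 (cnt_mono hn)) (Nat.cast_nonneg n)

theorem IsNegligible.or {P Q : ℕ → ℕ → Prop} (hP : IsNegligible P) (hQ : IsNegligible Q) :
    IsNegligible fun n m => P n m ∨ Q n m := by
  have h := hP.add hQ
  rw [add_zero] at h
  refine tendsto_of_tendsto_of_tendsto_of_le_of_le tendsto_const_nhds h
    (fun n => by positivity) fun n => ?_
  have h1 : (cnt (fun m => P n m ∨ Q n m) n : ℝ) ≤ cnt (P n) n + cnt (Q n) n := by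
    exact_mod_cast cnt_or_le (P n) (Q n) n
  rw [← add_div]
  exact div_le_div_of_nonneg_right h1 (Nat.cast_nonneg n)

theorem isNegligible_false : IsNegligible fun _ _ => False := by
  simp [IsNegligible, cnt]

theorem isNegligible_exists_mem {ι : Type*} (S : Finset ι) {P : ι → ℕ → ℕ → Prop}
    (hP : ∀ s ∈ S, IsNegligible (P s)) : IsNegligible fun n m => ∃ s ∈ S, P s n m := by
  classical
  induction S using Finset.induction_on with
  | empty => simpa using isNegligible_false
  | insert s S _ ih =>
    simp only [Finset.mem_insert, exists_eq_or_imp]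
    exact (hP s (Finset.mem_insert_self s S)).or
      (ih fun t ht => hP t (Finset.mem_insert_of_mem ht))

/-- A function with a Gaussian limit law and mean `a log log n` is rarely below `κ log log n`
when `κ < a`. -/
theorem isNegligible_le_of_tendsto_Phi {g : ℕ → ℝ} {a c κ : ℝ} (hκ : κ < a)
    (h : ∀ x : ℝ, Tendsto (fun n : ℕ =>
      (cnt (fun m => g m ≤ a * LL n + x * c * Real.sqrt (LL n)) n : ℝ) / n) atTop (nhds (Phi x))) :
    IsNegligible fun n m => g m ≤ κ * LL n := by
  rw [IsNegligible, tendsto_order]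
  refine ⟨fun ε hε => Eventually.of_forall fun n => hε.trans_le (by positivity), fun ε hε => ?_⟩
  obtain ⟨x, hx⟩ := (tendsto_Phi_atBot.eventually_lt_const hε).exists
  have hsq : Tendsto (fun n => Real.sqrt (LL n)) atTop atTop :=
    Real.tendsto_sqrt_atTop.comp tendsto_LL_atTop
  filter_upwards [(h x).eventually_lt_const hx, tendsto_LL_atTop.eventually_ge_atTop 0,
    hsq.eventually_ge_atTop (-(x * c) / (a - κ))] with n hn hL hS
  refine lt_of_le_of_lt (div_le_div_of_nonneg_right (Nat.cast_le.2 (cnt_mono ?_))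
    (Nat.cast_nonneg n)) hn
  intro m _ _ hm
  refine hm.trans ?_
  rw [div_le_iff₀ (sub_pos.2 hκ)] at hS
  have h1 := mul_le_mul_of_nonneg_right hS (Real.sqrt_nonneg (LL n))
  have h2 := Real.mul_self_sqrt hL
  have h3 : Real.sqrt (LL n) * (a - κ) * Real.sqrt (LL n) = (a - κ) * LL n := by
    rw [← h2]
    ring_nf
    simp [hL]
  linarith

theorem isNegligible_omegaQ_lt {s s' : ℕ} (hs : s ≠ 0) (hs' : s' ≠ 0)
    (hlt : Nat.totient s < Nat.totient s') :
    IsNegligible fun _ m => omegaQ m s < omegaQ m s' + 2 := by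
  have h0 : 0 < Nat.totient s := Nat.totient_pos.2 (Nat.pos_of_ne_zero hs)
  have h3 : (Nat.totient s' : ℝ)⁻¹ < (Nat.totient s : ℝ)⁻¹ :=
    inv_strictAnti₀ (by exact_mod_cast h0) (by exact_mod_cast hlt)
  obtain ⟨κ, hκ0, hκ⟩ := exists_between (sub_pos.2 h3)
  refine (isNegligible_le_of_tendsto_Phi hκ (tendsto_cnt_of_close_omegaQ_sub hs hs' hlt
    (g := fun m => (omegaQ m s : ℝ) - omegaQ m s') le_rfl ?_)).mono ?_
  · simp [cnt]
  · filter_upwards [tendsto_LL_atTop.eventually_ge_atTop (2 / κ)] with n hn m _ _ hm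
    rw [div_le_iff₀' hκ0] at hn
    have : (omegaQ m s : ℝ) < omegaQ m s' + 2 := by exact_mod_cast hm
    linarith

theorem isNegligible_omegaQ_le {q : ℕ} (hq : q ≠ 0) {κ : ℝ} (hκ : κ < (Nat.totient q : ℝ)⁻¹) :
    IsNegligible fun n m => (omegaQ m q : ℝ) ≤ κ * LL n := by
  refine isNegligible_le_of_tendsto_Phi (c := Real.sqrt (Nat.totient q : ℝ)⁻¹) hκ
    (tendsto_cnt_div_Phi (h := primeInd q) (C := 0) (fun p => ?_)
      (fun k => primeInd_of_not_prime q) (hasMertensMean_primeInd hq) ?_ ?_ ?_ le_rfl)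
  · rw [abs_of_nonneg (primeInd_nonneg q p)]
    exact primeInd_le_one q p
  · simp only [sq, primeInd_mul, Nat.lcm_self]
    exact hasMertensMean_primeInd hq
  · have := Nat.totient_pos.2 (Nat.pos_of_ne_zero hq)
    positivity
  · simp [addFun_primeInd, cnt]

theorem isNegligible_of_forall_exists {P : ℕ → ℕ → Prop}
    (h : ∀ ε > 0, ∃ Q R : ℕ → ℕ → Prop, IsNegligible Q ∧
      (∀ᶠ n : ℕ in atTop, (cnt (R n) n : ℝ) / n ≤ ε) ∧
      ∀ᶠ n in atTop, ∀ m, 1 ≤ m → m ≤ n → P n m → Q n m ∨ R n m) : IsNegligible P := by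
  rw [IsNegligible, tendsto_order]
  refine ⟨fun ε hε => Eventually.of_forall fun n => hε.trans_le (by positivity), fun ε hε => ?_⟩
  obtain ⟨Q, R, hQ, hR, hP⟩ := h (ε / 2) (half_pos hε)
  filter_upwards [hQ.eventually_lt_const (half_pos hε), hR, hP] with n h1 h2 h3
  have h4 : (cnt (P n) n : ℝ) ≤ cnt (Q n) n + cnt (R n) n := by
    exact_mod_cast (cnt_mono h3).trans (cnt_or_le (Q n) (R n) n)
  have h5 := div_le_div_of_nonneg_right h4 (Nat.cast_nonneg n)
  rw [add_div] at h5
  linarith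

theorem IsInvCount.isNegligible {d q q' : ℕ} (hd : IsIsolatedPair d q q') {J : ℕ → ℕ}
    (hJ : IsInvCount d J) :
    IsNegligible fun _ m => 2 < |(J m : ℝ) - ((omegaQ m q : ℝ) - omegaQ m q')| := by
  refine isNegligible_of_forall_exists fun ε hε => ?_
  have hq := hd.left.ne_zero
  have hq' := hd.right.ne_zero
  have ht' : (0 : ℝ) < (Nat.totient q' : ℝ)⁻¹ := by
    have := Nat.totient_pos.2 (Nat.pos_of_ne_zero hq')
    positivity
  obtain ⟨κ, hκ0, hκ⟩ := exists_between ht'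
  obtain ⟨Y, hY⟩ := exists_eventually_cnt_omegaQ_le (half_pos hκ0) hε
  set S := (Finset.range (2 * Nat.totient q)).filter
    fun s => IsPrimePow s ∧ Nat.totient s < Nat.totient q with hS
  set S' := (Finset.range (Y * (2 * Nat.totient q' + 1) + 1)).filter
    fun s => IsPrimePow s ∧ Nat.totient q' < Nat.totient s with hS'
  refine ⟨fun n m => ((∃ s ∈ S, omegaQ m s < omegaQ m q + 2) ∨ omegaQ m q < omegaQ m q' + 2) ∨
    (∃ s ∈ S', omegaQ m q' < omegaQ m s + 2) ∨ (omegaQ m q' : ℝ) ≤ κ * LL n, _, ?_, hY, ?_⟩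
  · refine ((isNegligible_exists_mem S fun s hs => ?_).or
      (isNegligible_omegaQ_lt hq hq' hd.lt)).or
      ((isNegligible_exists_mem S' fun s hs => ?_).or (isNegligible_omegaQ_le hq' hκ))
    · obtain ⟨-, h1, h2⟩ := Finset.mem_filter.1 hs
      exact isNegligible_omegaQ_lt h1.ne_zero hq h2
    · obtain ⟨-, h1, h2⟩ := Finset.mem_filter.1 hs
      exact isNegligible_omegaQ_lt hq' h1.ne_zero h2
  · filter_upwards [tendsto_LL_atTop.eventually_ge_atTop (4 / κ)] with n hn m hm _ hP
    rw [div_le_iff₀' hκ0] at hn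
    by_contra! hcon
    obtain ⟨⟨⟨hc1, hc2⟩, hc3, hc4⟩, hc5⟩ := hcon
    refine hP.not_ge (hJ.abs_sub_le hd hm (Y := Y) ?_ hc2 ?_ ?_)
    · intro s hs hlt
      refine hc1 s (Finset.mem_filter.2 ⟨Finset.mem_range.2 ?_, hs, hlt⟩)
      have := hs.le_two_mul_totient
      omega
    · intro s hs hlt hle
      exact hc3 s (Finset.mem_filter.2 ⟨Finset.mem_range.2 (by omega), hs, hlt⟩)
    · intro r hr hYr
      have h1 := hc5 r hr hYr
      have h2 : (omegaQ m r : ℝ) + 2 ≤ omegaQ m q' := by linarith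
      exact_mod_cast h2

theorem statement8 (i : ℕ) (hi : 2 ≤ i)
    (h1 : (UFO (i - 1)).ncard = 1) (h2 : (UFO i).ncard = 1) (h3 : (UFO (i + 1)).ncard = 1)
    (d : ℕ) (hd : UFO i = {d}) (J : ℕ → ℕ) (hJ : IsInvCount d J) :
    ∀ x : ℝ, Filter.Tendsto
      (fun n : ℕ => ((cnt (fun m =>
          (J m : ℝ) ≤ muSeq i * LL n + x * sigSeq i * Real.sqrt (LL n)) n : ℝ)) / n)
      Filter.atTop (nhds (Phi x)) := by
  intro x
  have hp := isIsolatedPair_qt hi h1 h2 h3 hd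
  have h := tendsto_cnt_of_close_omegaQ_sub hp.left.ne_zero hp.right.ne_zero hp.lt zero_le_two
    (hJ.isNegligible hp) x
  rw [hp.coprime.lcm_eq_mul, Nat.totient_mul hp.coprime, Nat.cast_mul, ← div_eq_mul_inv] at h
  simpa only [muSeq, sigSeq, phiQ, one_div] using h

end
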